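/- Let M be a weight sequence satisfying (M.2) and (M.2)*, and let 𝒱 = (v_n)_{n∈ℕ} be a decreasing weight system on ℝ^d. Then 𝒦^{(M)}(ℝ^d) ∗ ℬ^{(M)}_𝒱(ℝ^d) = ℬ^{(M)}_𝒱(ℝ^d) and 𝒦^{{M}}(ℝ^d) ∗ ℬ^{{M}}_𝒱(ℝ^d) = ℬ^{{M}}_𝒱(ℝ^d). Moreover: (Beurling) for every n ∈ ℕ and every set B ⊆ ℬ^{(M)}_{v_n}(ℝ^d) with sup_{φ∈B} ‖φ‖_{ℬ^{M,h}_{v_n}} < ∞ for all h > 0, there exist ψ ∈ 𝒦^{(M)}(ℝ^d), m ∈ ℕ, and a set A ⊆ ℬ^{(M)}_{v_m}(ℝ^d) bounded in ℬ^{(M)}_{v_m}(ℝ^d) with ψ ∗ A = B; (Roumieu) for every set B ⊆ ℬ^{{M}}_𝒱(ℝ^d) bounded in ℬ^{{M}}_𝒱(ℝ^d) (i.e., B ⊆ ℬ^{M,1/n}_{v_n}(ℝ^d) with sup_{φ∈B} ‖φ‖_{ℬ^{M,1/n}_{v_n}} < ∞ for some n) there exist ψ ∈ 𝒦^{{M}}(ℝ^d)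 and a bounded set A ⊆ ℬ^{{M}}_𝒱(ℝ^d) with ψ ∗ A = B. -/

import Mathlib

open Filter MeasureTheory
open scoped BigOperators

noncomputable section

abbrev Rd (d : ℕ) := EuclideanSpace ℝ (Fin d)

/-- Partial derivative in the `j`-th coordinate direction. -/
def dop {d : ℕ} {E : Type*} [NormedAddCommGroup E] [NormedSpace ℝ E]
    (j : Fin d) (f : Rd d → E) : Rd d → E :=
  fun x => fderiv ℝ f x (EuclideanSpace.single j (1:ℝ))

/-- Iterated partial derivative `∂^α` for a multi-index `α : Fin d → ℕ`. -/
def pD {d : ℕ} {E : Type*} [NormedAddCommGroup E] [NormedSpace ℝ E]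
    (α : Fin d → ℕ) (f : Rd d → E) : Rd d → E :=
  (List.finRange d).foldr (fun j g => (dop j)^[α j] g) f

/-- Length `|α|` of a multi-index. -/
def msize {d : ℕ} (α : Fin d → ℕ) : ℕ := ∑ j, α j

/-- `M` is a weight sequence: positive, normalized, `M_p^{1/p} → ∞`, log-convex. -/
def IsWeightSeq (M : ℕ → ℝ) : Prop :=
  (∀ p, 0 < M p) ∧ M 0 = 1 ∧ M 1 = 1 ∧
  Tendsto (fun p : ℕ => (M p) ^ ((p : ℝ)⁻¹)) atTop atTop ∧
  ∀ p : ℕ, 1 ≤ p → (M p)^2 ≤ M (p-1) * M (p+1)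

/-- Condition (M.2) with explicit constants `C₀, H ≥ 1`. -/
def HasM2 (M : ℕ → ℝ) (C₀ H : ℝ) : Prop :=
  1 ≤ C₀ ∧ 1 ≤ H ∧ ∀ p q : ℕ, M (p+q) ≤ C₀ * H^(p+q) * M p * M q

/-- Condition (M.2). -/
def M2 (M : ℕ → ℝ) : Prop := ∃ C₀ H, HasM2 M C₀ H

/-- Condition (M.2)*: `2 m_p ≤ m_{Np}` for `p ≥ p₀`. -/
def M2star (M : ℕ → ℝ) : Prop :=
  ∃ p₀ N : ℕ, 0 < p₀ ∧ 0 < N ∧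
    ∀ p, p₀ ≤ p → 2 * (M p / M (p-1)) ≤ M (N*p) / M (N*p - 1)

/-- Associated function `ν_M(t) = sup_p log(t^p / M_p)`. -/
def nuA (M : ℕ → ℝ) (t : ℝ) : ℝ := ⨆ p : ℕ, Real.log (t ^ p / M p)

/-- `φ ∈ 𝒦^{(M)}(ℝ^d)` (Beurling type). -/
def KBeu (d : ℕ) (M : ℕ → ℝ) (φ : Rd d → ℂ) : Prop :=
  ContDiff ℝ (⊤ : ℕ∞) φ ∧ ∀ k : ℝ, 0 < k → ∀ n : ℕ, ∃ C : ℝ,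
    ∀ (α : Fin d → ℕ) (x : Rd d),
      k ^ msize α * ‖pD α φ x‖ * Real.exp ((n : ℝ) * ‖x‖) ≤ C * M (msize α)

/-- `φ ∈ 𝒦^{{M}}(ℝ^d)` (Roumieu type). -/
def KRou (d : ℕ) (M : ℕ → ℝ) (φ : Rd d → ℂ) : Prop :=
  ContDiff ℝ (⊤ : ℕ∞) φ ∧ ∃ k : ℝ, 0 < k ∧ ∀ n : ℕ, ∃ C : ℝ,
    ∀ (α : Fin d → ℕ) (x : Rd d),
      k ^ msize α * ‖pD α φ x‖ * Real.exp ((n : ℝ) * ‖x‖) ≤ C * M (msize α)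

/-- Convolution `(ψ ∗ χ)(x) = ∫ ψ(t) χ(x - t) dt`. -/
def convF {d : ℕ} (ψ χ : Rd d → ℂ) : Rd d → ℂ := fun x => ∫ t : Rd d, ψ t * χ (x - t)

/-- The set of all convolutions `ψ ∗ χ` with `ψ ∈ X`, `χ ∈ Y`. -/
def convSet {d : ℕ} (X Y : Set (Rd d → ℂ)) : Set (Rd d → ℂ) :=
  {f | ∃ ψ ∈ X, ∃ χ ∈ Y, f = convF ψ χ}

/-- Decreasing weight system `𝒱 = (v_n)_n` on `ℝ^d`. -/
def DecWS (d : ℕ) (v : ℕ → Rd d → ℝ) : Prop :=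
  (∀ n x, 0 < v n x) ∧ (∀ n, Continuous (v n)) ∧
  (∀ n m : ℕ, n ≤ m → ∀ x, v m x ≤ v n x) ∧
  (∀ n : ℕ, ∃ m : ℕ, n ≤ m ∧ ∀ ε : ℝ, 0 < ε →
    ∃ R : ℝ, ∀ x : Rd d, R ≤ ‖x‖ → v m x / v n x < ε) ∧
  (∀ n : ℕ, ∃ m : ℕ, n ≤ m ∧ ∃ κ C : ℝ, 0 < κ ∧ 0 < C ∧
    ∀ x y : Rd d, v m (x + y) ≤ C * v n x * Real.exp (κ * ‖y‖))

/-- Finiteness of the norm `‖φ‖_{ℬ^{M,h}_w}`. -/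
def BNorm (d : ℕ) (M : ℕ → ℝ) (h : ℝ) (w : Rd d → ℝ) (φ : Rd d → ℂ) : Prop :=
  ∃ C : ℝ, ∀ (α : Fin d → ℕ) (x : Rd d),
    h ^ msize α * ‖pD α φ x‖ * w x ≤ C * M (msize α)

/-- `φ ∈ ℬ^{(M)}_{v_n}(ℝ^d) = ⋂_{h>0} ℬ^{M,h}_{v_n}(ℝ^d)`. -/
def BBeuV (d : ℕ) (M : ℕ → ℝ) (vn : Rd d → ℝ) (φ : Rd d → ℂ) : Prop :=
  ContDiff ℝ (⊤ : ℕ∞) φ ∧ ∀ h : ℝ, 0 < h → BNorm d M h vn φ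

/-- `φ ∈ ℬ^{(M)}_𝒱(ℝ^d) = ⋃_n ℬ^{(M)}_{v_n}(ℝ^d)`. -/
def BBeuVS (d : ℕ) (M : ℕ → ℝ) (v : ℕ → Rd d → ℝ) (φ : Rd d → ℂ) : Prop :=
  ∃ n : ℕ, BBeuV d M (v n) φ

/-- `φ ∈ ℬ^{{M}}_𝒱(ℝ^d) = ⋃_{n≥1} ℬ^{M,1/n}_{v_n}(ℝ^d)`. -/
def BRouVS (d : ℕ) (M : ℕ → ℝ) (v : ℕ → Rd d → ℝ) (φ : Rd d → ℂ) : Prop :=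
  ∃ n : ℕ, 1 ≤ n ∧ ContDiff ℝ (⊤ : ℕ∞) φ ∧ BNorm d M (1 / (n : ℝ)) (v n) φ

/-- Bounded subset of `ℬ^{(M)}_{v_n}(ℝ^d)`. -/
def BBeuVBdd (d : ℕ) (M : ℕ → ℝ) (vn : Rd d → ℝ) (B : Set (Rd d → ℂ)) : Prop :=
  (∀ φ ∈ B, BBeuV d M vn φ) ∧ ∀ h : ℝ, 0 < h → ∃ C : ℝ,
    ∀ φ ∈ B, ∀ (α : Fin d → ℕ) (x : Rd d),
      h ^ msize α * ‖pD α φ x‖ * vn x ≤ C * M (msize α)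

/-- Bounded subset of `ℬ^{{M}}_𝒱(ℝ^d)`. -/
def BRouVBdd (d : ℕ) (M : ℕ → ℝ) (v : ℕ → Rd d → ℝ) (B : Set (Rd d → ℂ)) : Prop :=
  (∀ φ ∈ B, BRouVS d M v φ) ∧ ∃ n : ℕ, 1 ≤ n ∧ ∃ C : ℝ,
    ∀ φ ∈ B, ∀ (α : Fin d → ℕ) (x : Rd d),
      (1 / (n : ℝ)) ^ msize α * ‖pD α φ x‖ * v n x ≤ C * M (msize α)

section Calculus

variable {d : ℕ}

lemma contDiff_dop {f : Rd d → ℂ} (hf : ContDiff ℝ (⊤ : ℕ∞) f) (j : Fin d) :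
    ContDiff ℝ (⊤ : ℕ∞) (dop j f) := by
  have h : ContDiff ℝ (⊤ : ℕ∞) (fderiv ℝ f) := hf.fderiv_right (by simp)
  exact h.clm_apply contDiff_const

lemma contDiff_dop_iterate {f : Rd d → ℂ} (hf : ContDiff ℝ (⊤ : ℕ∞) f) (j : Fin d) (n : ℕ) :
    ContDiff ℝ (⊤ : ℕ∞) ((dop j)^[n] f) := by
  induction n with
  | zero => simpa
  | succ n ih => rw [Function.iterate_succ_apply']; exact contDiff_dop ih j

lemma dop_comm {f : Rd d → ℂ} (hf : ContDiff ℝ (⊤ : ℕ∞) f) (i j : Fin d) :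
    dop i (dop j f) = dop j (dop i f) := by
  have h : ContDiff ℝ (⊤ : ℕ∞) (fderiv ℝ f) := hf.fderiv_right (by simp)
  have key : ∀ (a b : Fin d) (x : Rd d), dop a (dop b f) x =
      fderiv ℝ (fderiv ℝ f) x (EuclideanSpace.single a 1) (EuclideanSpace.single b 1) := by
    intro a b x
    have hd : DifferentiableAt ℝ (fderiv ℝ f) x := h.differentiable (by simp) x
    have : HasFDerivAt (dop b f) _ x :=
      hd.hasFDerivAt.clm_apply (hasFDerivAt_const (EuclideanSpace.single b (1:ℝ)) x)
    simp [dop, this.fderiv]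
  funext x
  rw [key, key]
  have hs : IsSymmSndFDerivAt ℝ f x :=
    hf.contDiffAt.isSymmSndFDerivAt (by
      simp only [minSmoothness_of_isRCLikeNormedField]; exact WithTop.coe_le_coe.2 le_top)
  exact hs _ _

lemma dop_iterate_comm {f : Rd d → ℂ} (hf : ContDiff ℝ (⊤ : ℕ∞) f) (i j : Fin d) (n : ℕ) :
    dop i ((dop j)^[n] f) = (dop j)^[n] (dop i f) := by
  induction n with
  | zero => simp
  | succ n ih =>
    rw [Function.iterate_succ_apply', Function.iterate_succ_apply',
      dop_comm (contDiff_dop_iterate hf j n), ih]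

/-- Iterated partial derivatives along a list of coordinates. -/
def listD (l : List (Fin d)) (α : Fin d → ℕ) (f : Rd d → ℂ) : Rd d → ℂ :=
  l.foldr (fun j g => (dop j)^[α j] g) f

lemma contDiff_listD {f : Rd d → ℂ} (hf : ContDiff ℝ (⊤ : ℕ∞) f) (l : List (Fin d))
    (α : Fin d → ℕ) : ContDiff ℝ (⊤ : ℕ∞) (listD l α f) := by
  induction l with
  | nil => simpa [listD]
  | cons i l ih => exact contDiff_dop_iterate ih i _

lemma listD_dop {f : Rd d → ℂ} (hf : ContDiff ℝ (⊤ : ℕ∞) f) (l : List (Fin d))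
    (α : Fin d → ℕ) (j : Fin d) : listD l α (dop j f) = dop j (listD l α f) := by
  induction l with
  | nil => simp [listD]
  | cons i l ih =>
    change (dop i)^[α i] (listD l α (dop j f)) = dop j ((dop i)^[α i] (listD l α f))
    rw [ih, dop_iterate_comm (contDiff_listD hf l α)]

lemma listD_congr (l : List (Fin d)) {α β : Fin d → ℕ} (f : Rd d → ℂ)
    (h : ∀ i ∈ l, α i = β i) : listD l α f = listD l β f := by
  induction l with
  | nil => simp [listD]
  | cons i l ih =>
    change (dop i)^[α i] (listD l α f) = (dop i)^[β i] (listD l β f)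
    rw [ih fun k hk => h k (List.mem_cons_of_mem _ hk), h i List.mem_cons_self]

lemma dop_listD {f : Rd d → ℂ} (hf : ContDiff ℝ (⊤ : ℕ∞) f) (l : List (Fin d)) (hl : l.Nodup)
    (α : Fin d → ℕ) (j : Fin d) (hj : j ∈ l) :
    dop j (listD l α f) = listD l (α + Pi.single j 1) f := by
  induction l with
  | nil => simp at hj
  | cons i l ih =>
    have hnd := List.nodup_cons.1 hl
    change dop j ((dop i)^[α i] (listD l α f)) =
      (dop i)^[(α + Pi.single j 1 : Fin d → ℕ) i] (listD l (α + Pi.single j 1) f)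
    by_cases hij : i = j
    · subst hij
      have h1 : listD l (α + Pi.single i 1) f = listD l α f := by
        refine listD_congr l f fun k hk => ?_
        have : k ≠ i := fun h => hnd.1 (h ▸ hk)
        simp [this]
      rw [h1]
      simp only [Pi.add_apply, Pi.single_eq_same]
      rw [Function.iterate_succ_apply']
    · have hj' : j ∈ l := by
        rcases List.mem_cons.1 hj with h | h
        · exact absurd h.symm hij
        · exact h
      rw [dop_iterate_comm (contDiff_listD hf l α), ih hnd.2 hj']
      simp [hij]

lemma dop_pD {f : Rd d → ℂ} (hf : ContDiff ℝ (⊤ : ℕ∞) f) (α : Fin d → ℕ) (j : Fin d) :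
    dop j (pD α f) = pD (α + Pi.single j 1) f :=
  dop_listD hf _ (List.nodup_finRange d) α j (List.mem_finRange j)

lemma pD_dop {f : Rd d → ℂ} (hf : ContDiff ℝ (⊤ : ℕ∞) f) (α : Fin d → ℕ) (j : Fin d) :
    pD α (dop j f) = pD (α + Pi.single j 1) f := by
  rw [← dop_pD hf]; exact listD_dop hf _ α j

lemma pD_zero (f : Rd d → ℂ) : pD (0 : Fin d → ℕ) f = f := by
  change List.foldr _ f (List.finRange d) = f
  induction List.finRange d with
  | nil => rfl
  | cons i l ih => simp

lemma msize_zero : msize (0 : Fin d → ℕ) = 0 := by simp [msize]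

lemma msize_add_single (α : Fin d → ℕ) (j : Fin d) :
    msize (α + Pi.single j 1) = msize α + 1 := by
  simp [msize, Finset.sum_add_distrib]

lemma multiIndex_induction {P : (Fin d → ℕ) → Prop} (h0 : P 0)
    (hs : ∀ α j, P α → P (α + Pi.single j 1)) (α : Fin d → ℕ) : P α := by
  induction hn : msize α generalizing α with
  | zero =>
    have : α = 0 := by
      funext i
      have := Finset.sum_eq_zero_iff.1 hn i (Finset.mem_univ i)
      simpa using this
    rwa [this]
  | succ n ih =>
    have : ∃ j, α j ≠ 0 := by
      by_contra! h
      simp [msize, h] at hn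
    obtain ⟨j, hj⟩ := this
    have he : (α - Pi.single j 1) + Pi.single j 1 = α := by
      funext i
      by_cases hij : i = j
      · subst hij; simp; omega
      · simp [hij]
    rw [← he]
    apply hs
    apply ih
    have := msize_add_single (α - Pi.single j 1) j
    rw [he] at this
    omega

lemma fderiv_eq_sum_dop (f : Rd d → ℂ) (x : Rd d) :
    fderiv ℝ f x = ∑ j, (EuclideanSpace.proj j : Rd d →L[ℝ] ℝ).smulRight (dop j f x) := by
  ext v
  have hv : v = ∑ j, v j • EuclideanSpace.single j (1:ℝ) := by
    simpa using ((EuclideanSpace.basisFun (Fin d) ℝ).sum_repr v).symm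
  conv_lhs => rw [hv]
  simp [dop, map_sum]

lemma dop_of_hasFDerivAt {f : Rd d → ℂ} {c : Fin d → ℂ} {x : Rd d}
    (h : HasFDerivAt f (∑ j, (EuclideanSpace.proj j : Rd d →L[ℝ] ℝ).smulRight (c j)) x)
    (j : Fin d) : dop j f x = c j := by
  rw [dop, h.fderiv, sum_apply, Finset.sum_eq_single j]
  · simp
  · intro i _ hij; simp [hij]
  · simp

/-- A family of functions whose gradients are again given by the family consists of smooth
functions. -/
theorem commute_dop {ι : Type*} {T : ι → Rd d → ℂ} {S : Set ι} {D : Fin d → ι → ι}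
    (hS : ∀ φ ∈ S, ∀ j, D j φ ∈ S)
    (hT : ∀ φ ∈ S, ∀ x, HasFDerivAt (T φ)
      (∑ j, (EuclideanSpace.proj j : Rd d →L[ℝ] ℝ).smulRight (T (D j φ) x)) x) :
    ∀ φ ∈ S, ContDiff ℝ (⊤ : ℕ∞) (T φ) ∧ ∀ j, dop j (T φ) = T (D j φ) := by
  have hn : ∀ n : ℕ, ∀ φ ∈ S, ContDiff ℝ n (T φ) := by
    intro n
    induction n with
    | zero =>
      intro φ hφ
      refine contDiff_zero.2 (Differentiable.continuous (𝕜 := ℝ) fun x => ?_)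
      exact (hT φ hφ x).differentiableAt
    | succ n ih =>
      intro φ hφ
      rw [Nat.cast_succ]
      refine contDiff_succ_iff_fderiv.2 ⟨fun x => (hT φ hφ x).differentiableAt,
        fun h => absurd h (by simp), ?_⟩
      have : fderiv ℝ (T φ) = fun x => ∑ j, (EuclideanSpace.proj j : Rd d →L[ℝ] ℝ).smulRight
          (T (D j φ) x) := by
        funext x; exact (hT φ hφ x).fderiv
      rw [this]
      refine ContDiff.sum fun j _ => ?_
      exact ContDiff.smulRight contDiff_const (ih _ (hS φ hφ j))
  intro φ hφ
  refine ⟨contDiff_infty.2 fun n => hn n φ hφ, fun j => ?_⟩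
  funext x
  exact dop_of_hasFDerivAt (c := fun j => T (D j φ) x) (hT φ hφ x) j

theorem pD_commute {T : (Rd d → ℂ) → Rd d → ℂ} {S : Set (Rd d → ℂ)}
    (hS : ∀ φ ∈ S, ∀ j, dop j φ ∈ S) (hsm : ∀ φ ∈ S, ContDiff ℝ (⊤ : ℕ∞) φ)
    (hT : ∀ φ ∈ S, ContDiff ℝ (⊤ : ℕ∞) (T φ) ∧ ∀ j, dop j (T φ) = T (dop j φ))
    (α : Fin d → ℕ) : ∀ φ ∈ S, pD α (T φ) = T (pD α φ) := by
  induction α using multiIndex_induction with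
  | h0 => intro φ _; simp [pD_zero]
  | hs α j ih =>
    intro φ hφ
    rw [← pD_dop (hT φ hφ).1, (hT φ hφ).2 j, ih _ (hS φ hφ j), pD_dop (hsm φ hφ)]

end Calculus

section Convolution

variable {d : ℕ}

lemma integrable_exp_neg_norm {a : ℝ} (ha : 0 < a) :
    Integrable (fun x : Rd d => Real.exp (-(a * ‖x‖))) := by
  obtain ⟨C, hC⟩ : ∃ C : ℝ, ∀ r : ℝ, 0 ≤ r →
      Real.exp (-(a * r)) ≤ C * (1 + r) ^ (-((d : ℝ) + 1)) := by
    refine ⟨(d + 1).factorial * Real.exp a / a ^ (d + 1), fun r hr => ?_⟩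
    have h1 := Real.pow_div_factorial_le_exp (a * (1 + r)) (by positivity) (d + 1)
    have h2 : (1 + r) ^ (-((d : ℝ) + 1)) = ((1 + r) ^ (d + 1))⁻¹ := by
      rw [Real.rpow_neg (by positivity)]
      norm_cast
    rw [h2, mul_pow, div_le_iff₀ (by positivity)] at *
    have h3 : Real.exp (a * (1 + r)) = Real.exp a * Real.exp (a * r) := by
      rw [← Real.exp_add]; ring_nf
    rw [h3] at h1
    rw [Real.exp_neg, ← div_eq_mul_inv, inv_eq_one_div, div_le_div_iff₀ (by positivity)
      (by positivity), div_mul_eq_mul_div, le_div_iff₀ (by positivity)]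
    linarith
  have hI := (integrable_one_add_norm (E := Rd d) (μ := volume) (r := (d : ℝ) + 1)
    (by simp)).const_mul C
  refine hI.mono' (by fun_prop) (Eventually.of_forall fun x => ?_)
  rw [Real.norm_of_nonneg (Real.exp_pos _).le]
  exact hC _ (norm_nonneg x)

/-- Smooth functions all of whose derivatives grow at most like `exp (κ |x|)`. -/
def ExpSmooth (d : ℕ) (κ : ℝ) : Set (Rd d → ℂ) :=
  {φ | ContDiff ℝ (⊤ : ℕ∞) φ ∧ ∀ α : Fin d → ℕ, ∃ C : ℝ, ∀ x,
    ‖pD α φ x‖ ≤ C * Real.exp (κ * ‖x‖)}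

lemma ExpSmooth.dop_mem {κ : ℝ} {φ : Rd d → ℂ} (h : φ ∈ ExpSmooth d κ) (j : Fin d) :
    dop j φ ∈ ExpSmooth d κ := by
  refine ⟨contDiff_dop h.1 j, fun α => ?_⟩
  rw [pD_dop h.1]
  exact h.2 _

lemma ExpSmooth.pD_mem {κ : ℝ} {φ : Rd d → ℂ} (h : φ ∈ ExpSmooth d κ) (α : Fin d → ℕ) :
    pD α φ ∈ ExpSmooth d κ := by
  induction α using multiIndex_induction with
  | h0 => rwa [pD_zero]
  | hs α j ih => rw [← dop_pD h.1]; exact ExpSmooth.dop_mem ih j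

lemma ExpSmooth.bound {κ : ℝ} {φ : Rd d → ℂ} (h : φ ∈ ExpSmooth d κ) :
    ∃ C : ℝ, 0 ≤ C ∧ ∀ x, ‖φ x‖ ≤ C * Real.exp (κ * ‖x‖) := by
  obtain ⟨C, hC⟩ := h.2 0
  rw [pD_zero] at hC
  refine ⟨|C|, abs_nonneg _, fun x => (hC x).trans ?_⟩
  gcongr
  exact le_abs_self C

/-- Measurable kernels decaying at least like `exp (-a |x|)`. -/
def ExpKernel (d : ℕ) (a : ℝ) : Set (Rd d → ℂ) :=
  {k | AEStronglyMeasurable k ∧ ∃ C : ℝ, 0 ≤ C ∧ ∀ x, ‖k x‖ ≤ C * Real.exp (-(a * ‖x‖))}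

lemma ExpKernel.integrable {a : ℝ} (ha : 0 < a) {k : Rd d → ℂ} (hk : k ∈ ExpKernel d a) :
    Integrable k := by
  obtain ⟨hm, C, -, hC⟩ := hk
  exact ((integrable_exp_neg_norm ha).const_mul C).mono' hm (Eventually.of_forall hC)

lemma exp_mul_norm_sub_le {κ : ℝ} (hκ : 0 ≤ κ) (x t : Rd d) :
    Real.exp (κ * ‖x - t‖) ≤ Real.exp (κ * ‖x‖) * Real.exp (κ * ‖t‖) := by
  rw [← Real.exp_add, ← mul_add]
  gcongr
  exact norm_sub_le x t

lemma conv_bound {κ a C D : ℝ} (hκ : 0 ≤ κ) (hC : 0 ≤ C) {k φ : Rd d → ℂ}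
    (hk : ∀ x, ‖k x‖ ≤ C * Real.exp (-(a * ‖x‖))) (hφ : ∀ x, ‖φ x‖ ≤ D * Real.exp (κ * ‖x‖))
    (x t : Rd d) :
    ‖k t * φ (x - t)‖ ≤ C * D * Real.exp (κ * ‖x‖) * Real.exp (-((a - κ) * ‖t‖)) := by
  have hD : 0 ≤ D := by
    have := (norm_nonneg _).trans (hφ 0)
    simpa using this
  rw [norm_mul]
  calc ‖k t‖ * ‖φ (x - t)‖ ≤ (C * Real.exp (-(a * ‖t‖))) *
        (D * (Real.exp (κ * ‖x‖) * Real.exp (κ * ‖t‖))) := by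
        refine mul_le_mul (hk t) ((hφ _).trans ?_) (norm_nonneg _) (by positivity)
        gcongr
        exact exp_mul_norm_sub_le hκ x t
    _ = C * D * Real.exp (κ * ‖x‖) * (Real.exp (-(a * ‖t‖)) * Real.exp (κ * ‖t‖)) := by ring
    _ = _ := by rw [← Real.exp_add]; ring_nf

lemma aestronglyMeasurable_conv {a : ℝ} {k φ : Rd d → ℂ} (hk : k ∈ ExpKernel d a)
    (hφ : Continuous φ) (x : Rd d) :
    AEStronglyMeasurable (fun t => k t * φ (x - t)) :=
  hk.1.mul (by fun_prop : Continuous fun t => φ (x - t)).aestronglyMeasurable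

lemma integrable_conv {κ a : ℝ} (hκ : 0 ≤ κ) (ha : κ < a) {k φ : Rd d → ℂ}
    (hk : k ∈ ExpKernel d a) (hφ : Continuous φ) {D : ℝ}
    (hb : ∀ x, ‖φ x‖ ≤ D * Real.exp (κ * ‖x‖)) (x : Rd d) :
    Integrable (fun t => k t * φ (x - t)) := by
  obtain ⟨C, hC, hkC⟩ := hk.2
  exact ((integrable_exp_neg_norm (sub_pos.2 ha)).const_mul _).mono'
    (aestronglyMeasurable_conv hk hφ x)
    (Eventually.of_forall fun t => conv_bound hκ hC hkC hb x t)

lemma hasFDerivAt_convF {κ a : ℝ} (hκ : 0 ≤ κ) (ha : κ < a) {k φ : Rd d → ℂ}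
    (hk : k ∈ ExpKernel d a) (hφ : φ ∈ ExpSmooth d κ) (x : Rd d) :
    HasFDerivAt (convF k φ)
      (∑ j, (EuclideanSpace.proj j : Rd d →L[ℝ] ℝ).smulRight (convF k (dop j φ) x)) x := by
  obtain ⟨C, hC, hkC⟩ := hk.2
  obtain ⟨D, hD, hφD⟩ := ExpSmooth.bound hφ
  choose E hE hφE using fun j => ExpSmooth.bound (ExpSmooth.dop_mem hφ j)
  let L : Fin d → ℂ →L[ℝ] (Rd d →L[ℝ] ℂ) := fun j =>
    ContinuousLinearMap.smulRightL ℝ (Rd d) ℂ (EuclideanSpace.proj j)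
  have hL : ∀ j c, L j c = (EuclideanSpace.proj j : Rd d →L[ℝ] ℝ).smulRight c := fun j c => rfl
  have hint : ∀ j y, Integrable (fun t => k t * dop j φ (y - t)) := fun j y =>
    integrable_conv hκ ha hk (contDiff_dop hφ.1 j).continuous (hφE j) y
  have key := hasFDerivAt_integral_of_dominated_of_fderiv_le (𝕜 := ℝ) (μ := volume)
    (F := fun y t => k t * φ (y - t)) (F' := fun y t => ∑ j, L j (k t * dop j φ (y - t)))
    (x₀ := x) (s := Metric.ball x 1)
    (bound := fun t => ∑ j, C * E j * Real.exp (κ * (‖x‖ + 1)) * Real.exp (-((a - κ) * ‖t‖)))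
    (Metric.ball_mem_nhds x one_pos)
    (Eventually.of_forall fun y => aestronglyMeasurable_conv hk hφ.1.continuous y)
    (integrable_conv hκ ha hk hφ.1.continuous hφD x)
    (by
      refine Finset.aestronglyMeasurable_fun_sum _ fun j _ => ?_
      exact (L j).continuous.comp_aestronglyMeasurable (hint j x).1)
    (Eventually.of_forall fun t y hy => by
      refine (norm_sum_le _ _).trans (Finset.sum_le_sum fun j _ => ?_)
      rw [hL, ContinuousLinearMap.norm_smulRight_apply]
      have h1 : ‖(EuclideanSpace.proj j : Rd d →L[ℝ] ℝ)‖ ≤ 1 := by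
        refine ContinuousLinearMap.opNorm_le_bound _ zero_le_one fun y => ?_
        simpa using PiLp.norm_apply_le y j
      refine (mul_le_of_le_one_left (norm_nonneg _) h1).trans
        ((conv_bound hκ hC hkC (hφE j) y t).trans ?_)
      have hy' : ‖y‖ ≤ ‖x‖ + 1 := by
        have := norm_le_norm_add_norm_sub' y x
        rw [mem_ball_iff_norm] at hy
        linarith
      have := hE j
      gcongr)
    (integrable_finsetSum _ fun j _ =>
      (integrable_exp_neg_norm (sub_pos.2 ha)).const_mul _)
    (Eventually.of_forall fun t y _ => by
      have h1 : HasFDerivAt φ (fderiv ℝ φ (y - t)) (y - t) :=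
        (hφ.1.differentiable (by simp) _).hasFDerivAt
      have h2 := (h1.comp y ((hasFDerivAt_id y).sub_const t)).const_mul (k t)
      refine h2.congr_fderiv ?_
      rw [fderiv_eq_sum_dop]
      ext v
      simp [hL, Finset.mul_sum, sum_apply]
      refine Finset.sum_congr rfl fun j _ => ?_
      ring)
  refine key.congr_fderiv ?_
  rw [integral_finsetSum _ fun j _ => (L j).integrable_comp (hint j x)]
  refine Finset.sum_congr rfl fun j _ => ?_
  rw [← hL]
  exact (L j).integral_comp_comm (hint j x)

theorem convF_smooth {κ a : ℝ} (hκ : 0 ≤ κ) (ha : κ < a) {k φ : Rd d → ℂ}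
    (hk : k ∈ ExpKernel d a) (hφ : φ ∈ ExpSmooth d κ) :
    ContDiff ℝ (⊤ : ℕ∞) (convF k φ) ∧ ∀ α, pD α (convF k φ) = convF k (pD α φ) := by
  have h := commute_dop (T := convF k) (S := ExpSmooth d κ) (D := dop)
    (fun φ hφ j => ExpSmooth.dop_mem hφ j) (fun φ hφ x => hasFDerivAt_convF hκ ha hk hφ x)
  exact ⟨(h φ hφ).1, fun α =>
    pD_commute (fun φ hφ j => ExpSmooth.dop_mem hφ j) (fun φ hφ => hφ.1) h α φ hφ⟩

/-- Weighted sup-bound for a convolution. -/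
lemma convF_weighted_bound {κ a C C₁ D : ℝ} (ha : κ < a) {k φ : Rd d → ℂ} {v w : Rd d → ℝ}
    (hw : ∀ x, 0 < w x) (hvw : ∀ x y, w (x + y) ≤ C₁ * v x * Real.exp (κ * ‖y‖)) (hC : 0 ≤ C)
    (hC₁ : 0 ≤ C₁)
    (hk : ∀ x, ‖k x‖ ≤ C * Real.exp (-(a * ‖x‖))) (hφ : ∀ x, ‖φ x‖ * v x ≤ D) (x : Rd d) :
    ‖convF k φ x‖ * w x ≤ C * C₁ * D * ∫ t : Rd d, Real.exp (-((a - κ) * ‖t‖)) := by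
  have hI := (integrable_exp_neg_norm (d := d) (sub_pos.2 ha)).const_mul (C * C₁ * D / w x)
  have h : ‖convF k φ x‖ ≤ ∫ t : Rd d, C * C₁ * D / w x * Real.exp (-((a - κ) * ‖t‖)) := by
    refine norm_integral_le_of_norm_le hI (Eventually.of_forall fun t => ?_)
    have h1 := hvw (x - t) t
    rw [sub_add_cancel] at h1
    rw [norm_mul, div_mul_eq_mul_div, le_div_iff₀ (hw x)]
    calc ‖k t‖ * ‖φ (x - t)‖ * w x
        ≤ (C * Real.exp (-(a * ‖t‖))) * ‖φ (x - t)‖ * (C₁ * v (x - t) * Real.exp (κ * ‖t‖)) := by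
          refine mul_le_mul ?_ h1 (hw x).le (by positivity)
          gcongr
          exact hk t
      _ = C * C₁ * (‖φ (x - t)‖ * v (x - t)) * (Real.exp (-(a * ‖t‖)) * Real.exp (κ * ‖t‖)) := by
          ring
      _ ≤ C * C₁ * D * (Real.exp (-(a * ‖t‖)) * Real.exp (κ * ‖t‖)) := by
          gcongr
          exact hφ _
      _ = _ := by rw [← Real.exp_add]; ring_nf
  rw [integral_const_mul, div_mul_eq_mul_div, le_div_iff₀ (hw x)] at h
  exact h

/-- Weighted bounds give exponential growth. -/
lemma norm_le_exp_of_weighted {κ C₁ D : ℝ} {φ : Rd d → ℂ} {v w : Rd d → ℝ}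
    (hw : ∀ x, 0 < w x) (hv : ∀ x, 0 < v x)
    (hvw : ∀ x y, w (x + y) ≤ C₁ * v x * Real.exp (κ * ‖y‖))
    (hφ : ∀ x, ‖φ x‖ * v x ≤ D) (x : Rd d) :
    ‖φ x‖ ≤ D * (C₁ / w 0) * Real.exp (κ * ‖x‖) := by
  have h1 := hvw x (-x)
  rw [add_neg_cancel, norm_neg] at h1
  have hD : 0 ≤ D := (mul_nonneg (norm_nonneg _) (hv 0).le).trans (hφ 0)
  have hw0 := hw 0
  have hvx := hv x
  have h2 : 1 ≤ C₁ / w 0 * v x * Real.exp (κ * ‖x‖) := by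
    rw [div_mul_eq_mul_div, div_mul_eq_mul_div, one_le_div hw0]; exact h1
  calc ‖φ x‖ ≤ ‖φ x‖ * (C₁ / w 0 * v x * Real.exp (κ * ‖x‖)) :=
        le_mul_of_one_le_right (norm_nonneg _) h2
    _ = (‖φ x‖ * v x) * ((C₁ / w 0) * Real.exp (κ * ‖x‖)) := by ring
    _ ≤ D * ((C₁ / w 0) * Real.exp (κ * ‖x‖)) := by
        refine mul_le_mul_of_nonneg_right (hφ x) ?_
        by_contra hneg
        push Not at hneg
        have : C₁ / w 0 * v x * Real.exp (κ * ‖x‖) < 0 := by nlinarith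
        linarith
    _ = _ := by ring

end Convolution

section Sequences

/-- The sequence with prescribed quotients `m`. -/
def seqM (m : ℕ → ℝ) (p : ℕ) : ℝ := ∏ j ∈ Finset.range p, m j

lemma seqM_zero (m : ℕ → ℝ) : seqM m 0 = 1 := by simp [seqM]

lemma seqM_succ (m : ℕ → ℝ) (p : ℕ) : seqM m (p + 1) = seqM m p * m p := by
  simp [seqM, Finset.prod_range_succ]

/-- Log-convex sequences with (M.2) and the doubling property, in terms of their quotients. -/
structure RegSeq (m : ℕ → ℝ) : Prop where
  mono : Monotone m
  one_le : 1 ≤ m 0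
  m2 : M2 (seqM m)
  dbl : ∃ K p₀ : ℕ, ∀ p, p₀ ≤ p → 2 * m p ≤ m (K * p)

variable {m : ℕ → ℝ}

namespace RegSeq

lemma one_le_quot (h : RegSeq m) (j : ℕ) : 1 ≤ m j := h.one_le.trans (h.mono (Nat.zero_le j))

lemma quot_pos (h : RegSeq m) (j : ℕ) : 0 < m j := one_pos.trans_le (h.one_le_quot j)

lemma pos (h : RegSeq m) (p : ℕ) : 0 < seqM m p := Finset.prod_pos fun j _ => h.quot_pos j

lemma seq_mono (h : RegSeq m) : Monotone (seqM m) :=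
  monotone_nat_of_le_succ fun p => by
    rw [seqM_succ]; exact le_mul_of_one_le_right (h.pos p).le (h.one_le_quot p)

lemma one_le_seq (h : RegSeq m) (p : ℕ) : 1 ≤ seqM m p := by
  simpa [seqM_zero] using h.seq_mono (Nat.zero_le p)

lemma exists_dbl (h : RegSeq m) : ∃ K p₀ : ℕ, 2 ≤ K ∧ 1 ≤ p₀ ∧
    ∀ i p, p₀ ≤ p → 2 ^ i * m p ≤ m (K ^ i * p) := by
  obtain ⟨K, p₀, hK⟩ := h.dbl
  refine ⟨K + 2, p₀ + 1, by omega, by omega, fun i => ?_⟩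
  have h1 : ∀ p, p₀ + 1 ≤ p → 2 * m p ≤ m ((K + 2) * p) := fun p hp =>
    (hK p (by omega)).trans (h.mono (Nat.mul_le_mul_right p (by omega)))
  induction i with
  | zero => simp
  | succ i ih =>
    intro p hp
    have h2 := h1 ((K + 2) ^ i * p) (hp.trans (Nat.le_mul_of_pos_left _ (by positivity)))
    have h3 := ih p hp
    calc (2 : ℝ) ^ (i + 1) * m p = 2 * (2 ^ i * m p) := by ring
      _ ≤ 2 * m ((K + 2) ^ i * p) := by linarith
      _ ≤ m ((K + 2) * ((K + 2) ^ i * p)) := h2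
      _ = _ := by rw [← mul_assoc, pow_succ']

lemma tendsto_quot (h : RegSeq m) : Tendsto m atTop atTop := by
  obtain ⟨K, p₀, -, -, hd⟩ := h.exists_dbl
  refine tendsto_atTop_atTop_of_monotone h.mono fun b => ?_
  obtain ⟨i, hi⟩ := pow_unbounded_of_one_lt b (one_lt_two (α := ℝ))
  refine ⟨K ^ i * p₀, hi.le.trans (le_trans ?_ (hd i p₀ le_rfl))⟩
  exact le_mul_of_one_le_right (by positivity) (h.one_le_quot _)

lemma exists_pow_le (h : RegSeq m) (K : ℝ) : ∃ C : ℝ, 0 < C ∧ ∀ p, |K| ^ p ≤ C * seqM m p := by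
  obtain ⟨j₀, hj⟩ := eventually_atTop.1 (h.tendsto_quot.eventually_ge_atTop |K|)
  refine ⟨max 1 |K| ^ j₀, by positivity, fun p => ?_⟩
  have h1 : (1 : ℝ) ≤ max 1 |K| := le_max_left _ _
  induction p with
  | zero => simpa [seqM_zero] using one_le_pow₀ h1
  | succ p ih =>
    by_cases hp : j₀ ≤ p
    · rw [seqM_succ, pow_succ, ← mul_assoc]
      exact mul_le_mul ih (hj p hp) (abs_nonneg _) (mul_nonneg (by positivity) (h.pos p).le)
    · calc |K| ^ (p + 1) ≤ max 1 |K| ^ (p + 1) := by gcongr; exact le_max_right _ _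
        _ ≤ max 1 |K| ^ j₀ := pow_le_pow_right₀ h1 (by omega)
        _ ≤ _ := le_mul_of_one_le_right (by positivity) (h.one_le_seq _)

lemma seq_mul_le {C₀ H : ℝ} (h : RegSeq m) (hM : HasM2 (seqM m) C₀ H) (n k : ℕ) :
    seqM m (n * k) ≤ C₀ ^ n * (H ^ (n * n)) ^ k * seqM m k ^ n := by
  obtain ⟨hC, hH, hM⟩ := hM
  induction n with
  | zero => simp [seqM_zero]
  | succ n ih =>
    have h1 := hM (n * k) k
    rw [← Nat.succ_mul] at h1
    have hk := (h.pos k).le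
    calc seqM m ((n + 1) * k) ≤ C₀ * H ^ ((n + 1) * k) * seqM m (n * k) * seqM m k := h1
      _ ≤ C₀ * H ^ ((n + 1) * k) * (C₀ ^ n * (H ^ (n * n)) ^ k * seqM m k ^ n) * seqM m k := by
        gcongr
      _ = C₀ ^ (n + 1) * H ^ ((n + 1) * k + n * n * k) * seqM m k ^ (n + 1) := by
        rw [pow_add, ← pow_mul]; ring
      _ ≤ C₀ ^ (n + 1) * H ^ ((n + 1) * (n + 1) * k) * seqM m k ^ (n + 1) := by
        have : (n + 1) * k + n * n * k ≤ (n + 1) * (n + 1) * k := by nlinarith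
        gcongr
      _ = _ := by rw [← pow_mul]

/-- Decay of the quotients, up to a high power. -/
lemma exists_ratio_pow_le (h : RegSeq m) : ∃ l₀ : ℕ, ∃ C : ℝ, 0 < C ∧ ∀ l, l₀ ≤ l →
    ∀ p j : ℕ, p ≤ j → (m p / m j) ^ (2 * l) ≤ C * (((p : ℝ) + 1) / ((j : ℝ) + 1)) ^ 2 := by
  obtain ⟨K, p₀, hK, hp₀, hd⟩ := h.exists_dbl
  have hK0 : (0 : ℝ) < K := by exact_mod_cast (by omega : 0 < K)
  have key : ∀ l, K ≤ l → ∀ p j : ℕ, p₀ ≤ p → p ≤ j →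
      (m p / m j) ^ (2 * l) ≤ (K : ℝ) ^ 2 * (((p : ℝ) + 1) / ((j : ℝ) + 1)) ^ 2 := by
    intro l hl p j hp hpj
    have hp1 : 0 < p := by omega
    have hjp : j / p ≠ 0 := (Nat.div_pos hpj hp1).ne'
    have h1 : K ^ Nat.log K (j / p) * p ≤ j :=
      (Nat.le_div_iff_mul_le hp1).1 (Nat.pow_log_le_self K hjp)
    have h2 : j < K ^ (Nat.log K (j / p) + 1) * p :=
      (Nat.div_lt_iff_lt_mul hp1).1 (Nat.lt_pow_succ_log_self (by omega) _)
    set i := Nat.log K (j / p)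
    have h3 : m p / m j ≤ (1 / 2 : ℝ) ^ i := by
      rw [div_le_iff₀ (h.quot_pos j)]
      have := (hd i p hp).trans (h.mono h1)
      calc m p = (1 / 2 : ℝ) ^ i * (2 ^ i * m p) := by
            rw [← mul_assoc, ← mul_pow]; norm_num
        _ ≤ _ := by gcongr
    have h4 : (1 : ℝ) / K ^ (i + 1) ≤ ((p : ℝ) + 1) / ((j : ℝ) + 1) := by
      rw [div_le_div_iff₀ (by positivity) (by positivity)]
      have : ((j + 1 : ℕ) : ℝ) ≤ ((K ^ (i + 1) * p : ℕ) : ℝ) := by exact_mod_cast h2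
      push_cast at this
      nlinarith [pow_pos hK0 (i + 1)]
    have h5 : (1 / 2 : ℝ) ^ (2 * l) ≤ (1 / K : ℝ) ^ 2 := by
      rw [pow_mul', one_div_pow]
      refine pow_le_pow_left₀ (by positivity) (one_div_le_one_div_of_le hK0 ?_) 2
      calc (K : ℝ) ≤ l := by exact_mod_cast hl
        _ ≤ 2 ^ l := by exact_mod_cast (Nat.lt_two_pow_self).le
    calc (m p / m j) ^ (2 * l) ≤ ((1 / 2 : ℝ) ^ i) ^ (2 * l) := by
          gcongr
          exact (div_pos (h.quot_pos p) (h.quot_pos j)).le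
      _ = ((1 / 2 : ℝ) ^ (2 * l)) ^ i := by rw [← pow_mul, ← pow_mul, mul_comm]
      _ ≤ ((1 / K : ℝ) ^ 2) ^ i := by gcongr
      _ = (K : ℝ) ^ 2 * (1 / (K : ℝ) ^ (i + 1)) ^ 2 := by
          rw [one_div_pow, one_div_pow, one_div_pow, ← pow_mul, ← pow_mul]
          field_simp
          rw [← pow_add]; congr 1; ring
      _ ≤ _ := by gcongr
  refine ⟨K, (K : ℝ) ^ 2 * ((p₀ : ℝ) + 1) ^ 2, by positivity, fun l hl p j hpj => ?_⟩
  have hKone : (1 : ℝ) ≤ (K : ℝ) ^ 2 := one_le_pow₀ (by exact_mod_cast (by omega : 1 ≤ K))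
  have hq0 : 0 ≤ m p / m j := (div_pos (h.quot_pos p) (h.quot_pos j)).le
  by_cases hp : p₀ ≤ p
  · refine (key l hl p j hp hpj).trans ?_
    refine mul_le_mul_of_nonneg_right ?_ (by positivity)
    exact le_mul_of_one_le_right (by positivity)
      (one_le_pow₀ (by linarith [p₀.cast_nonneg (α := ℝ)]))
  · have hpj' : (1 : ℝ) / ((j : ℝ) + 1) ≤ ((p : ℝ) + 1) / ((j : ℝ) + 1) := by
      gcongr; linarith [p.cast_nonneg (α := ℝ)]
    by_cases hj : p₀ ≤ j
    · have h1 := key l hl p₀ j le_rfl hj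
      calc (m p / m j) ^ (2 * l) ≤ (m p₀ / m j) ^ (2 * l) := by
            have := h.quot_pos j
            have := h.mono (by omega : p ≤ p₀)
            gcongr
        _ ≤ _ := h1
        _ = (K : ℝ) ^ 2 * ((p₀ : ℝ) + 1) ^ 2 * (1 / ((j : ℝ) + 1)) ^ 2 := by ring
        _ ≤ _ := by gcongr
    · have h1 : m p / m j ≤ 1 := (div_le_one (h.quot_pos j)).2 (h.mono hpj)
      have h2 : (j : ℝ) ≤ p₀ := by exact_mod_cast (by omega : j ≤ p₀)
      calc (m p / m j) ^ (2 * l) ≤ 1 := pow_le_one₀ hq0 h1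
        _ ≤ (K : ℝ) ^ 2 * (((p₀ : ℝ) + 1) * (1 / ((j : ℝ) + 1))) ^ 2 := by
            refine one_le_mul_of_one_le_of_one_le hKone (one_le_pow₀ ?_)
            rw [mul_one_div, one_le_div (by positivity)]
            linarith
        _ = (K : ℝ) ^ 2 * ((p₀ : ℝ) + 1) ^ 2 * (1 / ((j : ℝ) + 1)) ^ 2 := by ring
        _ ≤ _ := by gcongr

lemma exists_sum_ratio_le (h : RegSeq m) : ∃ l₀ : ℕ, ∃ C : ℝ, 0 < C ∧ ∀ l, l₀ ≤ l →
    ∀ p N : ℕ, ∑ j ∈ Finset.Ico p N, (m p / m j) ^ (2 * l) ≤ C * ((p : ℝ) + 1) := by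
  obtain ⟨l₀, C, hC, hb⟩ := h.exists_ratio_pow_le
  refine ⟨l₀, 2 * C, by positivity, fun l hl p N => ?_⟩
  calc ∑ j ∈ Finset.Ico p N, (m p / m j) ^ (2 * l)
      ≤ ∑ j ∈ Finset.Ico p N, C * ((p : ℝ) + 1) ^ 2 * ((((j + 1 : ℕ) : ℝ)) ^ 2)⁻¹ := by
        refine Finset.sum_le_sum fun j hj => (hb l hl p j (Finset.mem_Ico.1 hj).1).trans_eq ?_
        push_cast
        field_simp
    _ = C * ((p : ℝ) + 1) ^ 2 * ∑ i ∈ Finset.Ioo p (N + 1), ((i : ℝ) ^ 2)⁻¹ := by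
        rw [← Finset.mul_sum]
        congr 1
        have : Finset.Ioo p (N + 1) = (Finset.Ico p N).map (addRightEmbedding 1) := by
          rw [Finset.map_add_right_Ico]; ext i; simp
        rw [this, Finset.sum_map]
        simp
    _ ≤ C * ((p : ℝ) + 1) ^ 2 * (2 / ((p : ℝ) + 1)) := by
        gcongr
        exact sum_Ioo_inv_sq_le p (N + 1)
    _ = _ := by field_simp

end RegSeq

end Sequences

section EntireProduct

/-- Elementary symmetric polynomials of `x 0, …, x (N - 1)`. -/
def esym (x : ℕ → ℝ) : ℕ → ℕ → ℝ
  | _, 0 => 1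
  | 0, _ + 1 => 0
  | N + 1, k + 1 => esym x N (k + 1) + x N * esym x N k

/-- Elementary symmetric functions of the full sequence `x`. -/
def esymLim (x : ℕ → ℝ) (k : ℕ) : ℝ := ⨆ N, esym x N k

variable {x : ℕ → ℝ}

lemma esym_zero_right (N : ℕ) : esym x N 0 = 1 := by cases N <;> rfl

lemma esym_eq_zero {N k : ℕ} (h : N < k) : esym x N k = 0 := by
  induction N generalizing k with
  | zero => obtain ⟨k, rfl⟩ := Nat.exists_eq_succ_of_ne_zero h.ne'; rfl
  | succ N ih =>
    obtain ⟨k, rfl⟩ := Nat.exists_eq_succ_of_ne_zero (by omega : k ≠ 0)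
    change esym x N (k + 1) + x N * esym x N k = 0
    rw [ih (by omega), ih (by omega)]; simp

lemma esym_nonneg (hx : ∀ j, 0 ≤ x j) (N k : ℕ) : 0 ≤ esym x N k := by
  induction N generalizing k with
  | zero => cases k <;> simp [esym]
  | succ N ih =>
    cases k with
    | zero => simp [esym]
    | succ k => exact add_nonneg (ih _) (mul_nonneg (hx N) (ih k))

lemma esym_le_succ (hx : ∀ j, 0 ≤ x j) (N k : ℕ) : esym x N k ≤ esym x (N + 1) k := by
  cases k with
  | zero => simp [esym_zero_right]
  | succ k => exact le_add_of_nonneg_right (mul_nonneg (hx N) (esym_nonneg hx N k))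

lemma prod_one_add_eq_sum_esym {R : Type*} [CommRing R] (f : ℝ →+* R) (N : ℕ) (y : R) :
    ∏ j ∈ Finset.range N, (1 + f (x j) * y) =
      ∑ k ∈ Finset.range (N + 1), f (esym x N k) * y ^ k := by
  induction N with
  | zero => simp [esym]
  | succ N ih =>
    rw [Finset.prod_range_succ, ih, Finset.sum_range_succ' _ (N + 1)]
    simp only [esym, map_add, map_mul]
    have h1 : ∑ k ∈ Finset.range (N + 1), f (esym x N (k + 1)) * y ^ (k + 1) + f (esym x N 0)
        = ∑ k ∈ Finset.range (N + 1), f (esym x N k) * y ^ k := by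
      have := Finset.sum_range_succ' (fun k => f (esym x N k) * y ^ k) (N + 1)
      rw [Finset.sum_range_succ, esym_eq_zero (Nat.lt_succ_self N)] at this
      simpa using this.symm
    have h2 : ∑ k ∈ Finset.range (N + 1), (f (esym x N (k + 1)) + f (x N) * f (esym x N k)) *
        y ^ (k + 1) = ∑ k ∈ Finset.range (N + 1), f (esym x N (k + 1)) * y ^ (k + 1) +
          f (x N) * y * ∑ k ∈ Finset.range (N + 1), f (esym x N k) * y ^ k := by
      rw [Finset.mul_sum, ← Finset.sum_add_distrib]
      exact Finset.sum_congr rfl fun k _ => by ring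
    rw [h2, ← h1, esym_zero_right]
    simp only [map_one, pow_zero, mul_one]
    ring

/-- Nonnegative sequences `x` for which `∏ (1 + x j y)` is an entire function of `y`. -/
structure ProdSeq (x : ℕ → ℝ) : Prop where
  nonneg : ∀ j, 0 ≤ x j
  decay : ∀ R : ℝ, 0 < R → ∃ C : ℝ, 0 ≤ C ∧ ∀ N k, esym x N k * R ^ k ≤ C * (1 / 2) ^ k

namespace ProdSeq

lemma bddAbove (h : ProdSeq x) (k : ℕ) : BddAbove (Set.range fun N => esym x N k) := by
  obtain ⟨C, -, hC⟩ := h.decay 1 one_pos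
  exact ⟨C * (1 / 2) ^ k, by rintro _ ⟨N, rfl⟩; simpa using hC N k⟩

lemma tendsto_esym (h : ProdSeq x) (k : ℕ) :
    Tendsto (fun N => esym x N k) atTop (nhds (esymLim x k)) :=
  tendsto_atTop_ciSup (monotone_nat_of_le_succ fun N => esym_le_succ h.nonneg N k) (h.bddAbove k)

lemma esymLim_nonneg (h : ProdSeq x) (k : ℕ) : 0 ≤ esymLim x k :=
  ge_of_tendsto' (h.tendsto_esym k) fun N => esym_nonneg h.nonneg N k

lemma esymLim_decay (h : ProdSeq x) {R : ℝ} (hR : 0 < R) :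
    ∃ C : ℝ, 0 ≤ C ∧ (∀ N k, esym x N k * R ^ k ≤ C * (1 / 2) ^ k) ∧
      ∀ k, esymLim x k * R ^ k ≤ C * (1 / 2) ^ k := by
  obtain ⟨C, hC0, hC⟩ := h.decay R hR
  exact ⟨C, hC0, hC, fun k => le_of_tendsto' ((h.tendsto_esym k).mul_const _) fun N => hC N k⟩

lemma norm_term_le {c A D R C : ℝ} {k : ℕ} {a : ℂ} (hc : 0 ≤ c) (hD : 0 ≤ D) (ha : ‖a‖ ≤ D * R ^ k)
    (h : c * R ^ k ≤ C * A) : ‖(c : ℂ) * a‖ ≤ D * C * A := by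
  rw [norm_mul, Complex.norm_real, Real.norm_of_nonneg hc]
  calc c * ‖a‖ ≤ c * (D * R ^ k) := by gcongr
    _ = D * (c * R ^ k) := by ring
    _ ≤ D * (C * A) := by gcongr
    _ = _ := by ring

lemma summable_geom (D : ℝ) : Summable fun k : ℕ => D * (1 / 2 : ℝ) ^ k :=
  (summable_geometric_of_lt_one (by norm_num) (by norm_num)).mul_left D

/-- Convergence of the operators `∑ e_{N,k} a_k` on geometrically bounded sequences, with a
bound uniform in `N`. -/
lemma exists_series_bound (h : ProdSeq x) {R : ℝ} (hR : 0 < R) : ∃ C : ℝ, 0 ≤ C ∧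
    ∀ (D : ℝ) (a : ℕ → ℂ), (∀ k, ‖a k‖ ≤ D * R ^ k) →
      (∀ k, ‖(esymLim x k : ℂ) * a k‖ ≤ D * C * (1 / 2) ^ k) ∧
      ‖∑' k, (esymLim x k : ℂ) * a k‖ ≤ D * C ∧
      (∀ N, ‖∑ k ∈ Finset.range (N + 1), (esym x N k : ℂ) * a k‖ ≤ D * C) ∧
      Tendsto (fun N => ∑ k ∈ Finset.range (N + 1), (esym x N k : ℂ) * a k) atTop
        (nhds (∑' k, (esymLim x k : ℂ) * a k)) := by
  obtain ⟨C, hC0, hC, hC'⟩ := h.esymLim_decay hR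
  refine ⟨C * 2, by positivity, fun D a ha => ?_⟩
  have hD : 0 ≤ D := by simpa using (norm_nonneg _).trans (ha 0)
  have h1 : ∀ k, ‖(esymLim x k : ℂ) * a k‖ ≤ D * C * (1 / 2) ^ k := fun k =>
    norm_term_le (h.esymLim_nonneg k) hD (ha k) (hC' k)
  have h2 : ∀ N k, ‖(esym x N k : ℂ) * a k‖ ≤ D * C * (1 / 2) ^ k := fun N k =>
    norm_term_le (esym_nonneg h.nonneg N k) hD (ha k) (hC N k)
  have hsum : ∑' k : ℕ, D * C * (1 / 2 : ℝ) ^ k = D * (C * 2) := by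
    rw [tsum_mul_left, tsum_geometric_two]; ring
  have h3 : ∀ N, ∑ k ∈ Finset.range (N + 1), (esym x N k : ℂ) * a k =
      ∑' k, (esym x N k : ℂ) * a k := fun N => by
    refine (tsum_eq_sum fun k hk => ?_).symm
    rw [esym_eq_zero (by simpa using hk)]; simp
  refine ⟨fun k => (h1 k).trans ?_, ?_, fun N => ?_, ?_⟩
  · have : D * C ≤ D * (C * 2) := by gcongr; linarith
    gcongr
  · rw [← hsum]
    exact tsum_of_norm_bounded (summable_geom _).hasSum h1
  · rw [h3, ← hsum]
    exact tsum_of_norm_bounded (summable_geom _).hasSum (h2 N)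
  · simp_rw [h3]
    refine tendsto_tsum_of_dominated_convergence (summable_geom (D * C)) (fun k => ?_)
      (Eventually.of_forall fun N k => h2 N k)
    exact ((Complex.continuous_ofReal.tendsto _).comp (h.tendsto_esym k)).mul_const _

end ProdSeq

/-- The entire function `∏ (1 + x j y)`. -/
def prodC (x : ℕ → ℝ) (y : ℂ) : ℂ := ∑' k, (esymLim x k : ℂ) * y ^ k

/-- The product `∏ (1 + x j t)` for real `t`. -/
def prodR (x : ℕ → ℝ) (t : ℝ) : ℝ := ∑' k, esymLim x k * t ^ k

lemma prodC_ofReal (t : ℝ) : prodC x t = (prodR x t : ℂ) := by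
  simp [prodC, prodR, Complex.ofReal_tsum]

namespace ProdSeq

lemma tendsto_prodC (h : ProdSeq x) (y : ℂ) :
    Tendsto (fun N => ∏ j ∈ Finset.range N, (1 + (x j : ℂ) * y)) atTop (nhds (prodC x y)) := by
  obtain ⟨C, -, hC⟩ := h.exists_series_bound (R := ‖y‖ + 1) (by positivity)
  have := (hC 1 (fun k => y ^ k) fun k => by
    rw [norm_pow, one_mul]; gcongr; linarith).2.2.2
  refine this.congr fun N => ?_
  exact (prod_one_add_eq_sum_esym Complex.ofRealHom N y).symm

lemma tendsto_prodR (h : ProdSeq x) (t : ℝ) :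
    Tendsto (fun N => ∏ j ∈ Finset.range N, (1 + x j * t)) atTop (nhds (prodR x t)) := by
  have := h.tendsto_prodC t
  rw [prodC_ofReal] at this
  have h2 := (Complex.continuous_re.tendsto _).comp this
  rw [Complex.ofReal_re] at h2
  refine h2.congr fun N => ?_
  simp only [Function.comp]
  norm_cast

lemma differentiable_prodC (h : ProdSeq x) : Differentiable ℂ (prodC x) := by
  intro y
  obtain ⟨C, -, hC⟩ := h.exists_series_bound (R := ‖y‖ + 1) (by positivity)
  have hd : DifferentiableOn ℂ (prodC x) (Metric.ball 0 (‖y‖ + 1)) := by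
    refine Complex.differentiableOn_tsum_of_summable_norm (u := fun k => 1 * C * (1 / 2 : ℝ) ^ k)
      (summable_geom _) (fun k => by fun_prop) Metric.isOpen_ball fun k z hz => ?_
    rw [mem_ball_zero_iff] at hz
    refine (hC 1 (fun k => z ^ k) fun k => ?_).1 k
    rw [norm_pow, one_mul]; gcongr
  exact hd.differentiableAt (Metric.isOpen_ball.mem_nhds (by simp))

lemma one_le_factor (h : ProdSeq x) {y : ℂ} (hy : 0 ≤ y.re) (j : ℕ) :
    1 ≤ ‖1 + (x j : ℂ) * y‖ := by
  refine le_trans ?_ (Complex.re_le_norm _)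
  simpa using mul_nonneg (h.nonneg j) hy

lemma norm_partial_le (h : ProdSeq x) {y : ℂ} (hy : 0 ≤ y.re) (N : ℕ) :
    ‖∏ j ∈ Finset.range N, (1 + (x j : ℂ) * y)‖ ≤ ‖prodC x y‖ := by
  refine Monotone.ge_of_tendsto (f := fun N => ‖∏ j ∈ Finset.range N, (1 + (x j : ℂ) * y)‖)
    (monotone_nat_of_le_succ fun N => ?_) (h.tendsto_prodC y).norm N
  rw [Finset.prod_range_succ, norm_mul]
  exact le_mul_of_one_le_right (norm_nonneg _) (h.one_le_factor hy N)

lemma partial_le_prodR (h : ProdSeq x) {t : ℝ} (ht : 0 ≤ t) (N : ℕ) :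
    ∏ j ∈ Finset.range N, (1 + x j * t) ≤ prodR x t := by
  refine Monotone.ge_of_tendsto (f := fun N => ∏ j ∈ Finset.range N, (1 + x j * t))
    (monotone_nat_of_le_succ fun N => ?_) (h.tendsto_prodR t) N
  rw [Finset.prod_range_succ]
  have h0 : ∀ j, 0 ≤ x j * t := fun j => mul_nonneg (h.nonneg j) ht
  exact le_mul_of_one_le_right (Finset.prod_nonneg fun j _ => by linarith [h0 j])
    (by linarith [h0 N])

lemma one_le_prodR (h : ProdSeq x) {t : ℝ} (ht : 0 ≤ t) : 1 ≤ prodR x t := by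
  simpa using h.partial_le_prodR ht 0

lemma pow_mul_le_prodR (h : ProdSeq x) {t : ℝ} (ht : 0 ≤ t) (k : ℕ) :
    t ^ k * ∏ j ∈ Finset.range k, x j ≤ prodR x t := by
  refine le_trans ?_ (h.partial_le_prodR ht k)
  have h0 : ∀ j, 0 ≤ x j * t := fun j => mul_nonneg (h.nonneg j) ht
  calc t ^ k * ∏ j ∈ Finset.range k, x j = ∏ j ∈ Finset.range k, x j * t := by
        rw [Finset.prod_mul_distrib]; simp [mul_comm]
    _ ≤ _ := Finset.prod_le_prod (fun j _ => h0 j) fun j _ => by linarith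

lemma prodR_mono (h : ProdSeq x) {s t : ℝ} (hs : 0 ≤ s) (hst : s ≤ t) :
    prodR x s ≤ prodR x t := by
  refine le_of_tendsto_of_tendsto' (h.tendsto_prodR s) (h.tendsto_prodR t) fun N => ?_
  have h0 : ∀ j, 0 ≤ x j * s := fun j => mul_nonneg (h.nonneg j) hs
  refine Finset.prod_le_prod (fun j _ => by linarith [h0 j]) fun j _ => ?_
  have := h.nonneg j
  gcongr

lemma prodR_le_norm_sq (h : ProdSeq x) {t : ℝ} (ht : 0 ≤ t) {y : ℂ} (hy : t / 2 ≤ y.re) :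
    prodR x t ≤ ‖prodC x y‖ ^ 2 := by
  refine le_of_tendsto_of_tendsto' (h.tendsto_prodR t) ((h.tendsto_prodC y).norm.pow 2) fun N => ?_
  rw [norm_prod, ← Finset.prod_pow]
  have h0 : ∀ j, 0 ≤ x j * t := fun j => mul_nonneg (h.nonneg j) ht
  refine Finset.prod_le_prod (fun j _ => by linarith [h0 j]) fun j _ => ?_
  have h1 : 1 + x j * (t / 2) ≤ ‖1 + (x j : ℂ) * y‖ := by
    refine le_trans ?_ (Complex.re_le_norm _)
    simpa using mul_le_mul_of_nonneg_left hy (h.nonneg j)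
  nlinarith [h0 j]

lemma prodR_mul_le (h : ProdSeq x) {t r : ℝ} (ht : 0 ≤ t) (hr : 1 ≤ r) :
    prodR x (r * t) ≤ prodR x t ^ r := by
  have h1 : prodR x t ≠ 0 := (one_pos.trans_le (h.one_le_prodR ht)).ne'
  refine le_of_tendsto_of_tendsto' (h.tendsto_prodR _)
    ((h.tendsto_prodR t).rpow_const (Or.inl h1)) fun N => ?_
  have h0 : ∀ j, 0 ≤ x j * t := fun j => mul_nonneg (h.nonneg j) ht
  rw [← Real.finsetProd_rpow _ _ fun j _ => by linarith [h0 j]]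
  refine Finset.prod_le_prod (fun j _ => ?_) fun j _ => ?_
  · have := mul_nonneg (by linarith : 0 ≤ r) (h0 j)
    nlinarith
  · have := one_add_mul_self_le_rpow_one_add (s := x j * t) (by linarith [h0 j]) hr
    linarith

end ProdSeq

end EntireProduct

section Coefficients

/-- The coefficients `(c m_j)^{-2l}` of the infinite product. -/
def coefX (m : ℕ → ℝ) (c : ℝ) (l : ℕ) (j : ℕ) : ℝ := ((c * m j) ^ (2 * l))⁻¹

variable {m : ℕ → ℝ}

lemma prod_coefX (m : ℕ → ℝ) (c : ℝ) (l k : ℕ) :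
    ∏ j ∈ Finset.range k, coefX m c l j = ((c ^ k * seqM m k) ^ (2 * l))⁻¹ := by
  simp only [coefX, Finset.prod_inv_distrib, Finset.prod_pow, Finset.prod_mul_distrib, seqM]
  simp

namespace RegSeq

lemma coefX_pos (h : RegSeq m) {c : ℝ} (hc : 0 < c) (l j : ℕ) : 0 < coefX m c l j := by
  have := h.quot_pos j
  rw [coefX]; positivity

lemma coefX_div (h : RegSeq m) {c : ℝ} (hc : 0 < c) (l j k : ℕ) :
    coefX m c l j * (coefX m c l k)⁻¹ = (m k / m j) ^ (2 * l) := by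
  have := h.quot_pos j
  have := h.quot_pos k
  rw [coefX, coefX, inv_inv, div_pow, mul_pow, mul_pow]
  field_simp

lemma exists_esym_le (h : RegSeq m) : ∃ l₀ : ℕ, ∃ C : ℝ, 0 < C ∧ ∀ l, l₀ ≤ l → ∀ c : ℝ, 0 < c →
    ∀ N k : ℕ, esym (coefX m c l) N k ≤ C ^ (k + 1) * ((c ^ k * seqM m k) ^ (2 * l))⁻¹ := by
  obtain ⟨l₀, C, hC, hb⟩ := h.exists_sum_ratio_le
  refine ⟨l₀, 2 * Real.exp C, by positivity, fun l hl c hc N k => ?_⟩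
  rw [← prod_coefX]
  have hx := h.coefX_pos hc l
  have hX : 0 < ∏ j ∈ Finset.range k, coefX m c l j := Finset.prod_pos fun j _ => hx j
  rcases lt_or_ge N k with hN | hN
  · rw [esym_eq_zero hN]; positivity
  set t := (coefX m c l k)⁻¹ with ht
  have ht0 : 0 < t := inv_pos.2 (hx k)
  have h1 : esym (coefX m c l) N k * t ^ k ≤ ∏ j ∈ Finset.range N, (1 + coefX m c l j * t) := by
    have := prod_one_add_eq_sum_esym (x := coefX m c l) (RingHom.id ℝ) N t
    simp only [RingHom.id_apply] at this
    rw [this]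
    refine Finset.single_le_sum (f := fun k => esym (coefX m c l) N k * t ^ k)
      (fun i _ => ?_) (Finset.mem_range.2 (by omega))
    exact mul_nonneg (esym_nonneg (fun j => (hx j).le) N i) (by positivity)
  have h2 : ∏ j ∈ Finset.range k, (1 + coefX m c l j * t) ≤
      2 ^ k * ((∏ j ∈ Finset.range k, coefX m c l j) * t ^ k) := by
    have : ∏ j ∈ Finset.range k, (2 * (coefX m c l j * t)) =
        2 ^ k * ((∏ j ∈ Finset.range k, coefX m c l j) * t ^ k) := by
      simp only [Finset.prod_mul_distrib]; simp
    rw [← this]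
    refine Finset.prod_le_prod (fun j _ => by have := hx j; positivity) fun j hj => ?_
    have : 1 ≤ coefX m c l j * t := by
      rw [ht, h.coefX_div hc]
      refine one_le_pow₀ ((one_le_div (h.quot_pos j)).2 (h.mono (Finset.mem_range.1 hj).le))
    linarith
  have h3 : ∏ j ∈ Finset.Ico k N, (1 + coefX m c l j * t) ≤ Real.exp C ^ (k + 1) := by
    calc ∏ j ∈ Finset.Ico k N, (1 + coefX m c l j * t)
        ≤ ∏ j ∈ Finset.Ico k N, Real.exp ((m k / m j) ^ (2 * l)) := by
          refine Finset.prod_le_prod (fun j _ => by have := hx j; positivity) fun j hj => ?_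
          rw [ht, h.coefX_div hc, add_comm]
          exact Real.add_one_le_exp _
      _ = Real.exp (∑ j ∈ Finset.Ico k N, (m k / m j) ^ (2 * l)) := (Real.exp_sum _ _).symm
      _ ≤ Real.exp (C * ((k : ℝ) + 1)) := Real.exp_le_exp.2 (hb l hl k N)
      _ = _ := by rw [← Real.exp_nat_mul]; push_cast; ring_nf
  rw [← Finset.prod_range_mul_prod_Ico _ hN] at h1
  have h4 : esym (coefX m c l) N k * t ^ k ≤
      (2 * Real.exp C) ^ (k + 1) * (∏ j ∈ Finset.range k, coefX m c l j) * t ^ k := by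
    refine h1.trans ((mul_le_mul h2 h3 (Finset.prod_nonneg fun j _ => ?_) (by positivity)).trans ?_)
    · have := hx j; positivity
    · rw [mul_pow]
      have : (2 : ℝ) ^ k ≤ 2 ^ (k + 1) := pow_le_pow_right₀ (by norm_num) (by omega)
      calc _ = 2 ^ k * (Real.exp C ^ (k + 1) * (∏ j ∈ Finset.range k, coefX m c l j) * t ^ k) := by
            ring
        _ ≤ 2 ^ (k + 1) *
            (Real.exp C ^ (k + 1) * (∏ j ∈ Finset.range k, coefX m c l j) * t ^ k) := by gcongr
        _ = _ := by ring
  exact le_of_mul_le_mul_right h4 (by positivity)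

/-- Choice of the coefficients of the infinite order operator. -/
theorem exists_coef (h : RegSeq m) {C₀ H : ℝ} (hM : HasM2 (seqM m) C₀ H) (l₁ : ℕ) :
    ∃ l, l₁ ≤ l ∧ ∀ Λ : ℝ, 0 < Λ → ∃ c : ℝ, 1 ≤ c ∧ ProdSeq (coefX m c l) ∧ ∃ D : ℝ, 0 < D ∧
      ∀ p N k, esym (coefX m c l) N k * (Λ ^ (l * k) * seqM m (p + 2 * (l * k))) ≤
        D * H ^ p * seqM m p * (1 / 2) ^ k := by
  obtain ⟨l₀, C, hC, hb⟩ := h.exists_esym_le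
  set l := max l₀ l₁ + 1
  refine ⟨l, by omega, fun Λ hΛ => ?_⟩
  have hl := hb l (by omega)
  have hH : 0 < H := one_pos.trans_le hM.2.1
  have hC₀ : 0 < C₀ := one_pos.trans_le hM.1
  set A := C * H ^ (2 * l) * H ^ (2 * l * (2 * l)) * Λ ^ l with hA
  have hA0 : 0 < A := by positivity
  set c := 2 * A + 1
  have hc : 1 ≤ c := by simp only [c]; linarith
  have hc0 : 0 < c := by linarith
  have hAc : A / c ^ (2 * l) ≤ 1 / 2 := by
    rw [div_le_div_iff₀ (by positivity) two_pos]
    have : c ≤ c ^ (2 * l) := le_self_pow₀ hc (by omega)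
    simp only [c] at *; linarith
  refine ⟨c, hc, ⟨fun j => (h.coefX_pos hc0 l j).le, fun R hR => ?_⟩,
    C * C₀ ^ (2 * l + 1), by positivity, fun p N k => ?_⟩
  · obtain ⟨E, hE, hK⟩ := h.exists_pow_le (2 * C * R)
    refine ⟨C * E, by positivity, fun N k => ?_⟩
    have hMk := h.one_le_seq k
    have h1 : seqM m k ≤ (c ^ k * seqM m k) ^ (2 * l) := by
      have h2 : seqM m k ≤ c ^ k * seqM m k :=
        le_mul_of_one_le_left (h.pos k).le (one_le_pow₀ hc)
      exact h2.trans (le_self_pow₀ (hMk.trans h2) (by omega))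
    have hk := hK k
    rw [abs_of_pos (by positivity)] at hk
    calc esym (coefX m c l) N k * R ^ k ≤ C ^ (k + 1) * (seqM m k)⁻¹ * R ^ k := by
          refine mul_le_mul_of_nonneg_right ((hl c hc0 N k).trans ?_) (by positivity)
          have := h.pos k
          gcongr
      _ = C * ((2 * C * R) ^ k * (seqM m k)⁻¹) * (1 / 2) ^ k := by
          rw [mul_pow, mul_pow, one_div_pow]; field_simp; ring
      _ ≤ C * E * (1 / 2) ^ k := by
          gcongr
          rwa [← div_eq_mul_inv, div_le_iff₀ (h.pos k)]
  · have hMk := h.pos k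
    have hMp := h.pos p
    calc esym (coefX m c l) N k * (Λ ^ (l * k) * seqM m (p + 2 * (l * k)))
        ≤ (C ^ (k + 1) * ((c ^ k * seqM m k) ^ (2 * l))⁻¹) * (Λ ^ (l * k) *
            (C₀ * H ^ (p + 2 * l * k) * seqM m p *
              (C₀ ^ (2 * l) * (H ^ (2 * l * (2 * l))) ^ k * seqM m k ^ (2 * l)))) := by
          have h1 := hM.2.2 p (2 * l * k)
          have h2 := h.seq_mul_le hM (2 * l) k
          rw [← mul_assoc 2 l k]
          refine mul_le_mul (hl c hc0 N k) ?_ ?_ (by positivity)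
          · refine mul_le_mul_of_nonneg_left (h1.trans ?_) (by positivity)
            gcongr
          · exact mul_nonneg (by positivity) (h.pos _).le
      _ = C * C₀ ^ (2 * l + 1) * H ^ p * seqM m p * (A / c ^ (2 * l)) ^ k := by
          rw [div_pow, hA]
          have h3 : (c ^ k * seqM m k) ^ (2 * l) = (c ^ (2 * l)) ^ k * seqM m k ^ (2 * l) := by
            rw [mul_pow, ← pow_mul, ← pow_mul, mul_comm k]
          rw [h3, mul_inv]
          field_simp
          ring_nf
      _ ≤ _ := by gcongr

lemma pow_le_prodR (h : RegSeq m) {c : ℝ} (hc : 0 < c) {l : ℕ} (hx : ProdSeq (coefX m c l))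
    {a : ℝ} (k : ℕ) :
    (a ^ k) ^ (2 * l) ≤ (c ^ k * seqM m k) ^ (2 * l) * prodR (coefX m c l) (a ^ (2 * l)) := by
  have h1 := hx.pow_mul_le_prodR (t := a ^ (2 * l)) (by rw [pow_mul]; positivity) k
  have := h.pos k
  rw [prod_coefX, ← div_eq_mul_inv, div_le_iff₀ (by positivity)] at h1
  calc (a ^ k) ^ (2 * l) = (a ^ (2 * l)) ^ k := by rw [← pow_mul, ← pow_mul, mul_comm]
    _ ≤ _ := by linarith

end RegSeq

end Coefficients

section InfiniteOrder

variable {d : ℕ}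

/-- The operator `R - Δ`. -/
def lapOp (R : ℝ) (φ : Rd d → ℂ) : Rd d → ℂ := fun x => (R : ℂ) * φ x - ∑ j, dop j (dop j φ) x

lemma contDiff_lapOp (R : ℝ) {φ : Rd d → ℂ} (hφ : ContDiff ℝ (⊤ : ℕ∞) φ) :
    ContDiff ℝ (⊤ : ℕ∞) (lapOp R φ) :=
  (contDiff_const.mul hφ).sub
    (ContDiff.sum fun j _ => contDiff_dop (contDiff_dop hφ j) j)

lemma dop_lapOp (R : ℝ) {φ : Rd d → ℂ} (hφ : ContDiff ℝ (⊤ : ℕ∞) φ) (i : Fin d) :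
    dop i (lapOp R φ) = lapOp R (dop i φ) := by
  funext x
  have hd : ∀ {f : Rd d → ℂ}, ContDiff ℝ (⊤ : ℕ∞) f → HasFDerivAt f (fderiv ℝ f x) x :=
    fun hf => (hf.differentiable (by simp) x).hasFDerivAt
  have h1 := ((hd hφ).const_mul (R : ℂ)).sub
    (HasFDerivAt.fun_sum (u := Finset.univ) fun j _ => hd (contDiff_dop (contDiff_dop hφ j) j))
  have h2 : fderiv ℝ (lapOp R φ) x = _ := h1.fderiv
  rw [dop, h2, lapOp]
  have h3 : ∀ j, dop j (dop j (dop i φ)) = dop i (dop j (dop j φ)) := fun j => by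
    rw [dop_comm hφ j i, dop_comm (contDiff_dop hφ j) j i]
  simp only [h3]
  simp [dop, sum_apply]

lemma pD_lapOp (R : ℝ) {φ : Rd d → ℂ} (hφ : ContDiff ℝ (⊤ : ℕ∞) φ) (α : Fin d → ℕ) :
    pD α (lapOp R φ) = lapOp R (pD α φ) :=
  pD_commute (T := lapOp R) (S := {φ | ContDiff ℝ (⊤ : ℕ∞) φ}) (fun _ h j => contDiff_dop h j)
    (fun _ h => h) (fun _ h => ⟨contDiff_lapOp R h, dop_lapOp R h⟩) α φ hφ

lemma contDiff_lapOp_iterate (R : ℝ) {φ : Rd d → ℂ} (hφ : ContDiff ℝ (⊤ : ℕ∞) φ) (n : ℕ) :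
    ContDiff ℝ (⊤ : ℕ∞) ((lapOp R)^[n] φ) := by
  induction n with
  | zero => exact hφ
  | succ n ih => rw [Function.iterate_succ_apply']; exact contDiff_lapOp R ih

lemma dop_lapOp_iterate (R : ℝ) {φ : Rd d → ℂ} (hφ : ContDiff ℝ (⊤ : ℕ∞) φ) (n : ℕ) (i : Fin d) :
    dop i ((lapOp R)^[n] φ) = (lapOp R)^[n] (dop i φ) := by
  induction n with
  | zero => rfl
  | succ n ih =>
    rw [Function.iterate_succ_apply', Function.iterate_succ_apply',
      dop_lapOp R (contDiff_lapOp_iterate R hφ n), ih]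

/-- Weighted derivative bounds of class `M`, with a shift `q` of the index. -/
def DerivBound (m : ℕ → ℝ) (s : ℝ) (v : Rd d → ℝ) (C : ℝ) (q : ℕ) (φ : Rd d → ℂ) : Prop :=
  ContDiff ℝ (⊤ : ℕ∞) φ ∧
    ∀ α x, ‖pD α φ x‖ * v x ≤ C * s ^ msize α * seqM m (msize α + q)

variable {m : ℕ → ℝ} {s C R : ℝ} {v : Rd d → ℝ} {q : ℕ} {φ : Rd d → ℂ}

lemma DerivBound.dop (h : DerivBound m s v C q φ) (j : Fin d) :
    DerivBound m s v (C * s) (q + 1) (dop j φ) := by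
  refine ⟨contDiff_dop h.1 j, fun α x => ?_⟩
  rw [pD_dop h.1]
  refine (h.2 _ x).trans_eq ?_
  rw [msize_add_single, pow_succ, add_assoc, add_comm 1 q]
  ring

lemma DerivBound.pD (h : DerivBound m s v C q φ) (α : Fin d → ℕ) :
    DerivBound m s v (C * s ^ msize α) (q + msize α) (pD α φ) := by
  induction α using multiIndex_induction with
  | h0 => simpa [pD_zero, msize_zero] using h
  | hs α j ih =>
    rw [← dop_pD h.1, msize_add_single, pow_succ, ← mul_assoc, ← add_assoc]
    exact ih.dop j

lemma DerivBound.lapOp (hm : RegSeq m) (hs : 0 < s) (hR : 0 ≤ R) (hv : ∀ x, 0 ≤ v x)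
    (hC : 0 ≤ C) (h : DerivBound m s v C q φ) :
    DerivBound m s v (C * (R + d * s ^ 2)) (q + 2) (lapOp R φ) := by
  refine ⟨contDiff_lapOp R h.1, fun α x => ?_⟩
  rw [pD_lapOp R h.1]
  have h1 : ∀ j : Fin d, ‖_root_.dop j (_root_.dop j (_root_.pD α φ)) x‖ * v x ≤
      C * s ^ msize α * s ^ 2 * seqM m (msize α + (q + 2)) := fun j => by
    have := ((h.pD α).dop j).dop j |>.2 0 x
    rw [pD_zero, msize_zero, pow_zero, zero_add] at this
    refine this.trans_eq ?_
    rw [show q + msize α + 1 + 1 = msize α + (q + 2) by ring]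
    ring
  have h2 : ‖_root_.pD α φ x‖ * v x ≤ C * s ^ msize α * seqM m (msize α + (q + 2)) :=
    (h.2 α x).trans (by have := hm.seq_mono (by omega : msize α + q ≤ msize α + (q + 2)); gcongr)
  have hvx := hv x
  calc ‖_root_.lapOp R (_root_.pD α φ) x‖ * v x
      ≤ (R * ‖_root_.pD α φ x‖ + ∑ j, ‖_root_.dop j (_root_.dop j (_root_.pD α φ)) x‖) * v x := by
        gcongr
        refine (norm_sub_le _ _).trans ?_
        rw [norm_mul, Complex.norm_real, Real.norm_of_nonneg hR]
        gcongr
        exact norm_sum_le _ _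
    _ = R * (‖_root_.pD α φ x‖ * v x) +
        ∑ j, ‖_root_.dop j (_root_.dop j (_root_.pD α φ)) x‖ * v x := by
        rw [add_mul, Finset.sum_mul]; ring
    _ ≤ R * (C * s ^ msize α * seqM m (msize α + (q + 2))) +
        ∑ _j : Fin d, C * s ^ msize α * s ^ 2 * seqM m (msize α + (q + 2)) := by
        exact add_le_add (mul_le_mul_of_nonneg_left h2 hR) (Finset.sum_le_sum fun j _ => h1 j)
    _ = _ := by simp; ring

lemma DerivBound.lapOp_iterate (hm : RegSeq m) (hs : 0 < s) (hR : 0 ≤ R) (hv : ∀ x, 0 ≤ v x)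
    (hC : 0 ≤ C) (h : DerivBound m s v C q φ) (n : ℕ) :
    DerivBound m s v (C * (R + d * s ^ 2) ^ n) (q + 2 * n) ((_root_.lapOp R)^[n] φ) := by
  induction n with
  | zero => simpa using h
  | succ n ih =>
    rw [Function.iterate_succ_apply', pow_succ, ← mul_assoc]
    exact ih.lapOp hm hs hR hv (by positivity)

/-- Coefficients for which the infinite order operator acts on classes with derivative
bounds of type `(m, s)`. -/
structure OpCoef (d : ℕ) (m : ℕ → ℝ) (s R : ℝ) (l : ℕ) (H D : ℝ) (x : ℕ → ℝ) : Prop where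
  reg : RegSeq m
  s_pos : 0 < s
  R_nonneg : 0 ≤ R
  prodSeq : ProdSeq x
  D_pos : 0 < D
  H_pos : 0 < H
  bound : ∀ p N k, esym x N k * ((R + d * s ^ 2) ^ (l * k) * seqM m (p + 2 * (l * k))) ≤
    D * H ^ p * seqM m p * (1 / 2) ^ k

/-- The infinite order operator `∏ (1 + x_j (R - Δ)^l)`. -/
def infOp (R : ℝ) (l : ℕ) (x : ℕ → ℝ) (φ : Rd d → ℂ) : Rd d → ℂ :=
  fun y => ∑' k, (esymLim x k : ℂ) * (lapOp R)^[l * k] φ y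

/-- The truncated operator `∏_{j < N} (1 + x_j (R - Δ)^l)`. -/
def infOpTrunc (R : ℝ) (l : ℕ) (x : ℕ → ℝ) (N : ℕ) (φ : Rd d → ℂ) : Rd d → ℂ :=
  fun y => ∑ k ∈ Finset.range (N + 1), (esym x N k : ℂ) * (lapOp R)^[l * k] φ y

namespace OpCoef

variable {l : ℕ} {H D κ : ℝ} {x : ℕ → ℝ}

lemma esym_bound (h : OpCoef d m s R l H D x) (hv : ∀ y, 0 ≤ v y) (hC : 0 ≤ C)
    (hφ : DerivBound m s v C q φ) {c : ℝ} {k : ℕ} (hc : 0 ≤ c)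
    (hb : ∀ p, c * ((R + d * s ^ 2) ^ (l * k) * seqM m (p + 2 * (l * k))) ≤
      D * H ^ p * seqM m p * (1 / 2) ^ k) (y : Rd d) :
    ‖(c : ℂ) * (lapOp R)^[l * k] φ y‖ * v y ≤ C * D * H ^ q * seqM m q * (1 / 2) ^ k := by
  have h1 := (hφ.lapOp_iterate h.reg h.s_pos h.R_nonneg hv hC (l * k)).2 0 y
  rw [pD_zero, msize_zero, pow_zero, zero_add, mul_one] at h1
  rw [norm_mul, Complex.norm_real, Real.norm_of_nonneg hc]
  calc c * ‖(lapOp R)^[l * k] φ y‖ * v y = c * (‖(lapOp R)^[l * k] φ y‖ * v y) := by ring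
    _ ≤ c * (C * (R + d * s ^ 2) ^ (l * k) * seqM m (q + 2 * (l * k))) := by gcongr
    _ = C * (c * ((R + d * s ^ 2) ^ (l * k) * seqM m (q + 2 * (l * k)))) := by ring
    _ ≤ C * (D * H ^ q * seqM m q * (1 / 2) ^ k) := mul_le_mul_of_nonneg_left (hb q) hC
    _ = _ := by ring

lemma bound_lim (h : OpCoef d m s R l H D x) (p k : ℕ) :
    esymLim x k * ((R + d * s ^ 2) ^ (l * k) * seqM m (p + 2 * (l * k))) ≤
    D * H ^ p * seqM m p * (1 / 2) ^ k :=
  le_of_tendsto' ((h.prodSeq.tendsto_esym k).mul_const _) fun N => h.bound p N k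

/-- Termwise, total and truncated bounds for the infinite order operator, and convergence of
the truncations. -/
lemma infOp_bounds (h : OpCoef d m s R l H D x) (hv : ∀ y, 0 < v y) (hC : 0 ≤ C)
    (hφ : DerivBound m s v C q φ) (y : Rd d) :
    (∀ k, ‖(esymLim x k : ℂ) * (lapOp R)^[l * k] φ y‖ ≤
      C * D * H ^ q * seqM m q / v y * (1 / 2) ^ k) ∧
    ‖infOp R l x φ y‖ * v y ≤ 2 * (C * D * H ^ q * seqM m q) ∧
    (∀ N, ‖infOpTrunc R l x N φ y‖ * v y ≤ 2 * (C * D * H ^ q * seqM m q)) ∧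
    Tendsto (fun N => infOpTrunc R l x N φ y) atTop (nhds (infOp R l x φ y)) := by
  set B := C * D * H ^ q * seqM m q with hB
  have hvy := hv y
  have h1 : ∀ k, ‖(esymLim x k : ℂ) * (lapOp R)^[l * k] φ y‖ ≤ B / v y * (1 / 2) ^ k := fun k => by
    rw [div_mul_eq_mul_div, le_div_iff₀ hvy]
    exact h.esym_bound (fun y => (hv y).le) hC hφ (h.prodSeq.esymLim_nonneg k)
      (fun p => h.bound_lim p k) y
  have h2 : ∀ N k, ‖(esym x N k : ℂ) * (lapOp R)^[l * k] φ y‖ ≤ B / v y * (1 / 2) ^ k :=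
    fun N k => by
      rw [div_mul_eq_mul_div, le_div_iff₀ hvy]
      exact h.esym_bound (fun y => (hv y).le) hC hφ (esym_nonneg h.prodSeq.nonneg N k)
        (fun p => h.bound p N k) y
  have hsum : ∑' k : ℕ, B / v y * (1 / 2 : ℝ) ^ k = 2 * B / v y := by
    rw [tsum_mul_left, tsum_geometric_two]; ring
  have h3 : ∀ N, infOpTrunc R l x N φ y = ∑' k, (esym x N k : ℂ) * (lapOp R)^[l * k] φ y :=
    fun N => by
      refine (tsum_eq_sum fun k hk => ?_).symm
      rw [esym_eq_zero (by simpa using hk)]; simp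
  have hS := ProdSeq.summable_geom (B / v y)
  refine ⟨h1, ?_, fun N => ?_, ?_⟩
  · rw [← le_div_iff₀ hvy, ← hsum]
    exact tsum_of_norm_bounded hS.hasSum h1
  · rw [← le_div_iff₀ hvy, ← hsum, h3]
    exact tsum_of_norm_bounded hS.hasSum (h2 N)
  · simp_rw [h3]
    refine tendsto_tsum_of_dominated_convergence hS (fun k => ?_)
      (Eventually.of_forall fun N k => h2 N k)
    exact ((Complex.continuous_ofReal.tendsto _).comp (h.prodSeq.tendsto_esym k)).mul_const _

/-- The class on which the infinite order operator is considered. -/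
def domain (d : ℕ) (m : ℕ → ℝ) (s κ : ℝ) : Set (Rd d → ℂ) :=
  {φ | ∃ C q, 0 ≤ C ∧ DerivBound m s (fun x => Real.exp (-(κ * ‖x‖))) C q φ}

lemma domain_dop (h : OpCoef d m s R l H D x) (hφ : φ ∈ domain d m s κ) (j : Fin d) :
    dop j φ ∈ domain d m s κ := by
  obtain ⟨C, q, hC, hb⟩ := hφ
  exact ⟨_, _, mul_nonneg hC h.s_pos.le, hb.dop j⟩

lemma domain_subset : domain d m s κ ⊆ ExpSmooth d κ := by
  rintro φ ⟨C, q, hC, hb⟩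
  refine ⟨hb.1, fun α => ⟨C * s ^ msize α * seqM m (msize α + q), fun x => ?_⟩⟩
  have := hb.2 α x
  simp only at this
  rwa [Real.exp_neg, ← div_eq_mul_inv, div_le_iff₀ (Real.exp_pos _)] at this

lemma hasFDerivAt_infOp (hκ : 0 ≤ κ) (h : OpCoef d m s R l H D x) (hφ : φ ∈ domain d m s κ)
    (y : Rd d) : HasFDerivAt (infOp R l x φ)
      (∑ j, (EuclideanSpace.proj j : Rd d →L[ℝ] ℝ).smulRight (infOp R l x (dop j φ) y)) y := by
  obtain ⟨C, q, hC, hb⟩ := hφ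
  set v : Rd d → ℝ := fun x => Real.exp (-(κ * ‖x‖)) with hvdef
  have hv : ∀ z, 0 < v z := fun z => Real.exp_pos _
  have hC' : 0 ≤ C * s := mul_nonneg hC h.s_pos.le
  have hA : ∀ n z, HasFDerivAt ((lapOp R)^[n] φ)
      (∑ j, (EuclideanSpace.proj j : Rd d →L[ℝ] ℝ).smulRight ((lapOp R)^[n] (dop j φ) z)) z := by
    intro n z
    have := ((contDiff_lapOp_iterate R hb.1 n).differentiable (by simp) z).hasFDerivAt
    rw [fderiv_eq_sum_dop] at this
    simpa only [dop_lapOp_iterate R hb.1] using this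
  let L : Fin d → ℂ →L[ℝ] (Rd d →L[ℝ] ℂ) := fun j =>
    ContinuousLinearMap.smulRightL ℝ (Rd d) ℂ (EuclideanSpace.proj j)
  have hL : ∀ j c, L j c = (EuclideanSpace.proj j : Rd d →L[ℝ] ℝ).smulRight c := fun j c => rfl
  have hterm : ∀ j k z, ‖(esymLim x k : ℂ) * (lapOp R)^[l * k] (dop j φ) z‖ ≤
      C * s * D * H ^ (q + 1) * seqM m (q + 1) / v z * (1 / 2) ^ k := fun j k z =>
    (h.infOp_bounds hv hC' (hb.dop j) z).1 k
  set B := C * s * D * H ^ (q + 1) * seqM m (q + 1) with hB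
  have hB0 : 0 ≤ B := by
    have := h.D_pos; have := h.H_pos; have := h.reg.pos (q + 1); positivity
  have key := hasFDerivAt_tsum_of_isPreconnected (𝕜 := ℝ)
    (f := fun k z => (esymLim x k : ℂ) * (lapOp R)^[l * k] φ z)
    (f' := fun k z => ∑ j, L j ((esymLim x k : ℂ) * (lapOp R)^[l * k] (dop j φ) z))
    (u := fun k => ∑ _j : Fin d, B * Real.exp (κ * (‖y‖ + 1)) * (1 / 2 : ℝ) ^ k)
    (s := Metric.ball 0 (‖y‖ + 1)) (x₀ := y) (x := y)
    (summable_sum fun j _ => ProdSeq.summable_geom _) Metric.isOpen_ball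
    (convex_ball _ _).isPreconnected
    (fun k z _ => by
      refine ((hA (l * k) z).const_mul (esymLim x k : ℂ)).congr_fderiv ?_
      ext w
      simp [hL, Finset.mul_sum, sum_apply]
      exact Finset.sum_congr rfl fun j _ => by ring)
    (fun k z hz => by
      refine (norm_sum_le _ _).trans (Finset.sum_le_sum fun j _ => ?_)
      rw [hL, ContinuousLinearMap.norm_smulRight_apply]
      have h1 : ‖(EuclideanSpace.proj j : Rd d →L[ℝ] ℝ)‖ ≤ 1 := by
        refine ContinuousLinearMap.opNorm_le_bound _ zero_le_one fun y => ?_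
        simpa using PiLp.norm_apply_le y j
      refine (mul_le_of_le_one_left (norm_nonneg _) h1).trans ((hterm j k z).trans ?_)
      rw [mem_ball_zero_iff] at hz
      rw [hvdef, div_eq_mul_inv, ← Real.exp_neg, neg_neg]
      gcongr)
    (by simp)
    (Summable.of_norm_bounded (ProdSeq.summable_geom _) (h.infOp_bounds hv hC hb y).1)
    (by simp)
  refine key.congr_fderiv ?_
  have hsum : ∀ j, Summable fun k => (esymLim x k : ℂ) * (lapOp R)^[l * k] (dop j φ) y := fun j =>
    Summable.of_norm_bounded (ProdSeq.summable_geom _) fun k => hterm j k y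
  rw [Summable.tsum_finsetSum fun j _ => (L j).summable (hsum j)]
  refine Finset.sum_congr rfl fun j _ => ?_
  rw [← hL, infOp, (L j).map_tsum (hsum j)]

theorem infOp_smooth (hκ : 0 ≤ κ) (h : OpCoef d m s R l H D x) (hφ : φ ∈ domain d m s κ) :
    ContDiff ℝ (⊤ : ℕ∞) (infOp R l x φ) ∧ ∀ α, pD α (infOp R l x φ) = infOp R l x (pD α φ) := by
  have h1 := commute_dop (T := infOp R l x) (S := domain d m s κ) (D := dop)
    (fun φ hφ j => h.domain_dop hφ j) (fun φ hφ y => h.hasFDerivAt_infOp hκ hφ y)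
  exact ⟨(h1 φ hφ).1, fun α => pD_commute (fun φ hφ j => h.domain_dop hφ j)
    (fun φ hφ => (domain_subset hφ).1) h1 α φ hφ⟩

lemma infOp_derivBound (hκ : 0 ≤ κ) (h : OpCoef d m s R l H D x) (hφ : φ ∈ domain d m s κ)
    (hv : ∀ y, 0 < v y) (hC : 0 ≤ C) (hb : DerivBound m s v C 0 φ) :
    DerivBound m (s * H) v (2 * C * D) 0 (infOp R l x φ) := by
  have h1 := h.infOp_smooth hκ hφ
  refine ⟨h1.1, fun α y => ?_⟩
  rw [h1.2]
  have hs := h.s_pos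
  refine (h.infOp_bounds hv (by positivity) (hb.pD α) y).2.1.trans_eq ?_
  rw [zero_add, add_zero, mul_pow]
  ring

end OpCoef

end InfiniteOrder

section HolomorphicIntegral

variable {E : Type*} [NormedAddCommGroup E] [NormedSpace ℂ E] [FiniteDimensional ℂ E]
  {A : Type*} [MeasurableSpace A] {μ : Measure A}

lemma aestronglyMeasurable_clm {F : A → E →L[ℂ] ℂ}
    (hF : ∀ v, AEStronglyMeasurable (fun a => F a v) μ) : AEStronglyMeasurable F μ := by
  set b := Module.finBasis ℂ E
  have h : F = fun a => ∑ i, ContinuousLinearMap.smulRightL ℂ E ℂ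
      (LinearMap.toContinuousLinearMap (b.coord i)) (F a (b i)) := by
    funext a
    ext v
    conv_lhs => rw [← b.sum_repr v]
    rw [map_sum]
    simp [-Module.Basis.sum_repr, sum_apply]
  rw [h]
  exact Finset.aestronglyMeasurable_fun_sum _ fun i _ =>
    (ContinuousLinearMap.continuous _).comp_aestronglyMeasurable (hF _)

lemma aestronglyMeasurable_fderiv {G : E → A → ℂ} {z : E}
    (hm : ∀ᶠ w in nhds z, AEStronglyMeasurable (G w) μ)
    (hd : ∀ a, DifferentiableAt ℂ (G · a) z) :
    AEStronglyMeasurable (fun a => fderiv ℂ (G · a) z) μ := by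
  refine aestronglyMeasurable_clm fun v => ?_
  obtain ⟨ε, hε, hb⟩ := Metric.eventually_nhds_iff_ball.1 hm
  set u : ℕ → ℝ := fun n => ε / (‖v‖ + 1) * (1 / ((n : ℝ) + 1)) / 2 with hu
  have hun : ∀ n, 0 < u n := fun n => by positivity
  have hut : Tendsto u atTop (nhds 0) := by
    have := (tendsto_one_div_add_atTop_nhds_zero_nat (𝕜 := ℝ)).const_mul (ε / (‖v‖ + 1))
    simpa [hu] using this.div_const 2
  have huC : Tendsto (fun n => (u n : ℂ)) atTop (nhdsWithin 0 {0}ᶜ) := by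
    refine tendsto_nhdsWithin_iff.2 ⟨?_, Eventually.of_forall fun n => ?_⟩
    · simpa [Function.comp_def] using (Complex.continuous_ofReal.tendsto 0).comp hut
    · simpa using (hun n).ne'
  refine aestronglyMeasurable_of_tendsto_ae (u := atTop)
    (f := fun n a => ((u n : ℂ))⁻¹ • (G (z + (u n : ℂ) • v) a - G z a)) (fun n => ?_)
    (Eventually.of_forall fun a => ?_)
  · have key : AEStronglyMeasurable (G (z + (u n : ℂ) • v)) μ := hb _ ?_
    · exact (key.sub (hb z (Metric.mem_ball_self hε))).const_smul ((u n : ℂ)⁻¹)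
    rw [mem_ball_iff_norm, add_sub_cancel_left, norm_smul, Complex.norm_real,
      Real.norm_of_nonneg (hun n).le]
    have h1 : u n ≤ ε / (‖v‖ + 1) / 2 := by
      simp only [hu]
      have : 1 / ((n : ℝ) + 1) ≤ 1 := by
        rw [div_le_one (by positivity)]; linarith [Nat.cast_nonneg (α := ℝ) n]
      have h0 : 0 ≤ ε / (‖v‖ + 1) := by positivity
      nlinarith
    calc u n * ‖v‖ ≤ ε / (‖v‖ + 1) / 2 * (‖v‖ + 1) := by
          gcongr; linarith
      _ = ε / 2 := by field_simp
      _ < ε := by linarith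
  · have h := ((hd a).hasFDerivAt.comp_hasDerivAt_of_eq (0 : ℂ)
      (((hasDerivAt_id (0 : ℂ)).smul_const v).const_add z) (by simp)).tendsto_slope_zero
    simp only [Function.comp_def, id, zero_add, zero_smul, add_zero, one_smul] at h
    exact h.comp huC

/-- Holomorphy of dominated parametric integrals. -/
theorem differentiableOn_integral {G : E → A → ℂ} {U : Set E} {b : A → ℝ} (hU : IsOpen U)
    (hm : ∀ z ∈ U, AEStronglyMeasurable (G z) μ) (hd : ∀ a, DifferentiableOn ℂ (G · a) U)
    (hb : ∀ z ∈ U, ∀ a, ‖G z a‖ ≤ b a) (hbi : Integrable b μ) :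
    DifferentiableOn ℂ (fun z => ∫ a, G z a ∂μ) U := by
  intro z hz
  obtain ⟨ε, hε, hball⟩ := Metric.isOpen_iff.1 hU z hz
  have hsub : ∀ w ∈ Metric.ball z (ε / 2), Metric.ball w (ε / 2) ⊆ U := fun w hw =>
    (Metric.ball_subset_ball' (by rw [Metric.mem_ball] at hw; linarith)).trans hball
  refine (hasFDerivAt_integral_of_dominated_of_fderiv_le (𝕜 := ℂ)
    (F' := fun z a => fderiv ℂ (G · a) z) (bound := fun a => 2 * b a / (ε / 2))
    (Metric.ball_mem_nhds z (half_pos hε))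
    (Eventually.mono (hU.mem_nhds hz) hm) (hbi.mono' (hm z hz) (Eventually.of_forall (hb z hz)))
    (aestronglyMeasurable_fderiv (Eventually.mono (hU.mem_nhds hz) hm)
      fun a => (hd a).differentiableAt (hU.mem_nhds hz))
    (Eventually.of_forall fun a w hw => ?_) ((hbi.const_mul 2).div_const _)
    (Eventually.of_forall fun a w hw => ?_)).differentiableAt.differentiableWithinAt
  · refine Complex.norm_fderiv_le_div_of_mapsTo_ball ((hd a).mono (hsub w hw)) (fun y hy => ?_)
      (half_pos hε)
    rw [mem_closedBall_iff_norm]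
    have h1 := hb y (hsub w hw hy) a
    have h2 := hb w (hsub w hw (Metric.mem_ball_self (half_pos hε))) a
    exact (norm_sub_le _ _).trans (by linarith)
  · exact ((hd a).differentiableAt (hU.mem_nhds
      (hsub w hw (Metric.mem_ball_self (half_pos hε))))).hasFDerivAt

end HolomorphicIntegral

section Kernels

variable {d : ℕ}

/-- The real part of a vector in `ℂ^d`. -/
def reV (z : Fin d → ℂ) : Rd d := WithLp.toLp 2 fun j => (z j).re

/-- The imaginary part of a vector in `ℂ^d`. -/
def imV (z : Fin d → ℂ) : Rd d := WithLp.toLp 2 fun j => (z j).im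

/-- The inclusion of `ℝ^d` in `ℂ^d`. -/
def cvec (ξ : Rd d) : Fin d → ℂ := fun j => (ξ j : ℂ)

/-- The bilinear pairing of `ℝ^d` with `ℂ^d`. -/
def dotC (x : Rd d) (z : Fin d → ℂ) : ℂ := ∑ j, (x j : ℂ) * z j

/-- The tube of radius `a` around `ℝ^d`. -/
def tube (d : ℕ) (a : ℝ) : Set (Fin d → ℂ) := {z | ‖imV z‖ < a}

/-- The inverse Fourier transform of the restriction of `F` to `ℝ^d`. -/
def kern (F : (Fin d → ℂ) → ℂ) (x : Rd d) : ℂ :=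
  ∫ ξ : Rd d, F (cvec ξ) * Complex.exp (2 * Real.pi * Complex.I * dotC x (cvec ξ))

lemma continuous_imV : Continuous (imV : (Fin d → ℂ) → Rd d) :=
  (PiLp.continuous_toLp 2 _).comp
    (continuous_pi fun j => Complex.continuous_im.comp (continuous_apply j))

lemma continuous_reV : Continuous (reV : (Fin d → ℂ) → Rd d) :=
  (PiLp.continuous_toLp 2 _).comp
    (continuous_pi fun j => Complex.continuous_re.comp (continuous_apply j))

lemma continuous_cvec : Continuous (cvec : Rd d → Fin d → ℂ) := by
  unfold cvec; fun_prop

lemma reV_cvec_add (ξ u : Rd d) (ζ : ℂ) : reV (cvec ξ + ζ • cvec u) = ξ + ζ.re • u := by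
  ext j; simp [reV, cvec]

lemma imV_cvec_add (ξ u : Rd d) (ζ : ℂ) : imV (cvec ξ + ζ • cvec u) = ζ.im • u := by
  ext j; simp [imV, cvec]

@[simp] lemma reV_cvec (ξ : Rd d) : reV (cvec ξ) = ξ := by
  ext j; simp [reV, cvec]

@[simp] lemma imV_cvec (ξ : Rd d) : imV (cvec ξ) = 0 := by
  ext j; simp [imV, cvec]

lemma cvec_mem_tube {a : ℝ} (ha : 0 < a) (ξ : Rd d) : cvec ξ ∈ tube d a := by
  simpa [tube] using ha

lemma dotC_cvec (x ξ : Rd d) : dotC x (cvec ξ) = ((inner ℝ x ξ : ℝ) : ℂ) := by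
  simp [dotC, cvec, PiLp.inner_apply, mul_comm]

lemma dotC_cvec_add (x ξ u : Rd d) (ζ : ℂ) :
    dotC x (cvec ξ + ζ • cvec u) = ((inner ℝ x ξ : ℝ) : ℂ) + ζ * ((inner ℝ x u : ℝ) : ℂ) := by
  rw [← dotC_cvec, ← dotC_cvec]
  simp only [dotC, Pi.add_apply, Pi.smul_apply, smul_eq_mul, mul_add, Finset.sum_add_distrib,
    Finset.mul_sum]
  congr 1
  exact Finset.sum_congr rfl fun j _ => by ring

lemma integrable_one_add_norm_pow (d : ℕ) :
    Integrable fun ξ : Rd d => ((1 + ‖ξ‖) ^ (d + 1))⁻¹ := by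
  have := integrable_one_add_norm (E := Rd d) (μ := volume) (r := (d : ℝ) + 1) (by simp)
  refine this.congr (Eventually.of_forall fun ξ => ?_)
  have h : (0 : ℝ) < 1 + ‖ξ‖ := by positivity
  simp only
  rw [Real.rpow_neg h.le]
  congr 1
  exact_mod_cast Real.rpow_natCast (1 + ‖ξ‖) (d + 1)

/-- Holomorphic functions on a tube with a quantitative integrable decay. -/
structure SymBound (a C : ℝ) (F : (Fin d → ℂ) → ℂ) : Prop where
  diff : DifferentiableOn ℂ F (tube d a)
  le : ∀ z ∈ tube d a, ‖F z‖ * (1 + ‖reV z‖) ^ (d + 1) ≤ C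

namespace SymBound

variable {a C s : ℝ} {F : (Fin d → ℂ) → ℂ}

lemma norm_le (h : SymBound a C F) {z : Fin d → ℂ} (hz : z ∈ tube d a) :
    ‖F z‖ ≤ C * ((1 + ‖reV z‖) ^ (d + 1))⁻¹ := by
  rw [← div_eq_mul_inv, le_div_iff₀ (by positivity)]
  exact h.le z hz

lemma continuous_line (h : SymBound a C F) {w : Fin d → ℂ} (hw : ‖imV w‖ < a) :
    Continuous fun ξ : Rd d => F (cvec ξ + w) := by
  refine h.diff.continuousOn.comp_continuous (by have := continuous_cvec (d := d); fun_prop)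
    fun ξ => ?_
  have : imV (cvec ξ + w) = imV w := by ext j; simp [imV, cvec]
  simpa [tube, this] using hw

lemma norm_cexp_dotC (x : Rd d) (z : Fin d → ℂ) :
    ‖Complex.exp (2 * Real.pi * Complex.I * dotC x z)‖ =
      Real.exp (-(2 * Real.pi * (dotC x z).im)) := by
  rw [Complex.norm_exp]
  congr 1
  simp

lemma integrable (h : SymBound a C F) (ha : 0 < a) : Integrable fun ξ : Rd d => F (cvec ξ) := by
  have hc := h.continuous_line (w := 0) (by
    have : imV (0 : Fin d → ℂ) = 0 := by ext j; simp [imV]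
    rwa [this, norm_zero])
  simp only [add_zero] at hc
  refine ((integrable_one_add_norm_pow d).const_mul C).mono' hc.aestronglyMeasurable
    (Eventually.of_forall fun ξ => ?_)
  simpa using h.norm_le (cvec_mem_tube ha ξ)

/-- Shifting the contour of integration yields exponential decay. -/
theorem norm_kern_le (h : SymBound a C F) (hs : 0 ≤ s) (hsa : s < a) (x : Rd d) :
    ‖kern F x‖ ≤ C * (∫ ξ : Rd d, ((1 + ‖ξ‖) ^ (d + 1))⁻¹) * Real.exp (-(s * ‖x‖)) := by
  have ha : 0 < a := hs.trans_lt hsa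
  have hC : 0 ≤ C := le_trans (by positivity) (h.le _ (cvec_mem_tube ha 0))
  set u : Rd d := ‖x‖⁻¹ • x with hu
  have hu1 : ‖u‖ ≤ 1 := by
    rw [hu, norm_smul, norm_inv, norm_norm]
    exact inv_mul_le_one
  have hxu : inner ℝ x u = ‖x‖ := by
    rw [hu, inner_smul_right, real_inner_self_eq_norm_sq, sq, ← mul_assoc]
    rcases eq_or_ne ‖x‖ 0 with h0 | h0
    · simp [h0]
    · rw [inv_mul_cancel₀ h0, one_mul]
  let G : ℂ → Rd d → ℂ := fun ζ ξ => F (cvec ξ + ζ • cvec u) *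
    Complex.exp (2 * Real.pi * Complex.I * dotC x (cvec ξ + ζ • cvec u))
  let J : ℂ → ℂ := fun ζ => ∫ ξ, G ζ ξ
  let U : Set ℂ := {ζ | |ζ.im| < a} ∩ {ζ | |ζ.re| < 1}
  have hU : IsOpen U := (isOpen_lt Complex.continuous_im.abs continuous_const).inter
    (isOpen_lt Complex.continuous_re.abs continuous_const)
  have hUc : Convex ℝ U := by
    have h1 : {ζ : ℂ | |ζ.im| < a} = Complex.imLm ⁻¹' (Set.Ioo (-a) a) := by
      ext ζ; simp [abs_lt]
    have h2 : {ζ : ℂ | |ζ.re| < 1} = Complex.reLm ⁻¹' (Set.Ioo (-1) 1) := by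
      ext ζ; simp [abs_lt]
    simp only [U, h1, h2]
    exact ((convex_Ioo _ _).linear_preimage _).inter ((convex_Ioo _ _).linear_preimage _)
  have htube : ∀ ζ : ℂ, |ζ.im| < a → ∀ ξ : Rd d, cvec ξ + ζ • cvec u ∈ tube d a := by
    intro ζ hζ ξ
    rw [tube, Set.mem_ofPred_eq, imV_cvec_add, norm_smul]
    exact (mul_le_of_le_one_right (norm_nonneg _) hu1).trans_lt hζ
  have hGn : ∀ ζ : ℂ, |ζ.im| < a → ∀ ξ : Rd d, ‖G ζ ξ‖ ≤
      C * ((1 + ‖ξ + ζ.re • u‖) ^ (d + 1))⁻¹ * Real.exp (-(2 * Real.pi * (ζ.im * ‖x‖))) := by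
    intro ζ hζ ξ
    have h1 := h.norm_le (htube ζ hζ ξ)
    rw [reV_cvec_add] at h1
    simp only [G]
    rw [norm_mul, norm_cexp_dotC, dotC_cvec_add, hxu]
    refine (mul_le_mul_of_nonneg_right h1 (Real.exp_pos _).le).trans_eq ?_
    simp
  have hJ : DifferentiableOn ℂ J U := by
    refine differentiableOn_integral (b := fun ξ => C * (2 ^ (d + 1) *
      ((1 + ‖ξ‖) ^ (d + 1))⁻¹) * Real.exp (2 * Real.pi * (a * ‖x‖))) hU (fun ζ hζ => ?_)
      (fun ξ => ?_) (fun ζ hζ ξ => ?_)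
      ((((integrable_one_add_norm_pow d).const_mul _).const_mul _).mul_const _)
    · refine Continuous.aestronglyMeasurable (Continuous.mul (h.continuous_line ?_) ?_)
      · simpa [tube, imV, cvec] using htube ζ hζ.1 0
      · have := continuous_cvec (d := d)
        unfold dotC
        fun_prop
    · have h1 : Differentiable ℂ fun ζ : ℂ => cvec ξ + ζ • cvec u := by fun_prop
      refine (h.diff.comp h1.differentiableOn fun ζ hζ => htube ζ hζ.1 ξ).mul
        (Differentiable.differentiableOn ?_)
      simp only [dotC_cvec_add]
      fun_prop
    · refine (hGn ζ hζ.1 ξ).trans ?_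
      have h1 : 1 + ‖ξ‖ ≤ 2 * (1 + ‖ξ + ζ.re • u‖) := by
        have h2 : ‖ξ‖ ≤ ‖ξ + ζ.re • u‖ + ‖ζ.re • u‖ := by
          simpa using norm_sub_le (ξ + ζ.re • u) (ζ.re • u)
        have h3 : ‖ζ.re • u‖ ≤ 1 := by
          rw [norm_smul]
          exact mul_le_one₀ hζ.2.le (norm_nonneg _) hu1
        linarith [norm_nonneg (ξ + ζ.re • u)]
      have h4 : ((1 + ‖ξ + ζ.re • u‖) ^ (d + 1))⁻¹ ≤ 2 ^ (d + 1) * ((1 + ‖ξ‖) ^ (d + 1))⁻¹ := by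
        rw [← div_eq_mul_inv, le_div_iff₀ (by positivity), inv_mul_le_iff₀ (by positivity),
          mul_comm, ← mul_pow]
        gcongr
      have h5 : -(ζ.im * ‖x‖) ≤ a * ‖x‖ := by
        rw [← neg_mul]
        exact mul_le_mul_of_nonneg_right ((neg_le_abs _).trans hζ.1.le) (norm_nonneg _)
      have h6 : -(2 * Real.pi * (ζ.im * ‖x‖)) ≤ 2 * Real.pi * (a * ‖x‖) := by
        have := Real.pi_pos
        nlinarith
      gcongr
  have htrans : ∀ (ζ : ℂ) (t : ℝ), J (ζ + t) = J ζ := by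
    intro ζ t
    have h1 : ∀ ξ, G (ζ + t) ξ = G ζ (ξ + t • u) := by
      intro ξ
      have : cvec ξ + (ζ + t) • cvec u = cvec (ξ + t • u) + ζ • cvec u := by
        funext j; simp [cvec]; ring
      simp only [G, this]
    simp only [J, h1]
    exact integral_add_right_eq_self (G ζ) _
  have hderiv : Set.EqOn (deriv J) 0 U := by
    intro ζ hζ
    have h1 := (hJ.differentiableAt (hU.mem_nhds hζ)).hasDerivAt
    have h2 : HasDerivAt (fun t : ℝ => J (ζ + t)) (deriv J ζ) 0 := by
      have h3 := (Complex.ofRealCLM.hasDerivAt (x := (0 : ℝ))).const_add ζ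
      have h4 := HasDerivAt.comp_of_eq (h₂ := J) (h := fun t : ℝ => ζ + Complex.ofRealCLM t) 0
        h1 h3 (by simp)
      simpa [Function.comp_def] using h4
    simp only [htrans] at h2
    exact h2.unique (hasDerivAt_const _ _)
  have h0 : (0 : ℂ) ∈ U := by simp [U, ha]
  have hs' : (s * Complex.I : ℂ) ∈ U := by simp [U, abs_of_nonneg hs, hsa]
  have hkern : kern F x = J (s * Complex.I) := by
    rw [hU.is_const_of_deriv_eq_zero hUc.isPreconnected hJ hderiv hs' h0]
    simp [J, G, kern]
  rw [hkern]
  refine (norm_integral_le_of_norm_le (g := fun ξ : Rd d => C * ((1 + ‖ξ‖) ^ (d + 1))⁻¹ *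
    Real.exp (-(s * ‖x‖))) (((integrable_one_add_norm_pow d).const_mul _).mul_const _)
    (Eventually.of_forall fun ξ => (hGn _ hs'.1 ξ).trans ?_)).trans_eq ?_
  · have h1 : (s * Complex.I : ℂ).re = 0 := by simp
    have h2 : (s * Complex.I : ℂ).im = s := by simp
    rw [h1, h2, zero_smul, add_zero]
    have h3 : s * ‖x‖ ≤ 2 * Real.pi * (s * ‖x‖) := by
      have := Real.pi_gt_three
      have h4 : 0 ≤ s * ‖x‖ := by positivity
      nlinarith
    gcongr
  · rw [integral_mul_const, integral_const_mul]

end SymBound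

end Kernels

section Symbols

variable {d : ℕ}

/-- Holomorphic functions on a tube decaying rapidly in the real directions. -/
structure Symb (a : ℝ) (F : (Fin d → ℂ) → ℂ) : Prop where
  diff : DifferentiableOn ℂ F (tube d a)
  decay : ∀ r : ℕ, ∃ C : ℝ, ∀ z ∈ tube d a, ‖F z‖ * (1 + ‖reV z‖) ^ r ≤ C

lemma norm_apply_le_of_mem_tube {a : ℝ} {z : Fin d → ℂ} (hz : z ∈ tube d a) (j : Fin d) :
    ‖z j‖ ≤ ‖reV z‖ + a := by
  have h1 : |(z j).re| ≤ ‖reV z‖ := by simpa [reV] using PiLp.norm_apply_le (reV z) j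
  have h2 : |(z j).im| ≤ ‖imV z‖ := by simpa [imV] using PiLp.norm_apply_le (imV z) j
  have h3 : ‖imV z‖ < a := hz
  exact (Complex.norm_le_abs_re_add_abs_im _).trans (by linarith)

/-- Multiplication of a symbol by `2πi z_j`. -/
def mulCoord (j : Fin d) (F : (Fin d → ℂ) → ℂ) : (Fin d → ℂ) → ℂ :=
  fun z => 2 * Real.pi * Complex.I * z j * F z

/-- The monomials `∏ (2πi z_j)^{α_j}`. -/
def mon (α : Fin d → ℕ) (z : Fin d → ℂ) : ℂ := ∏ j, (2 * Real.pi * Complex.I * z j) ^ α j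

lemma mulCoord_mon (α : Fin d → ℕ) (j : Fin d) (F : (Fin d → ℂ) → ℂ) :
    mulCoord j (fun z => mon α z * F z) = fun z => mon (α + Pi.single j 1) z * F z := by
  funext z
  simp only [mulCoord, mon, Pi.add_apply, pow_add, Finset.prod_mul_distrib]
  have : ∏ i, (2 * Real.pi * Complex.I * z i) ^ (Pi.single j 1 : Fin d → ℕ) i =
      2 * Real.pi * Complex.I * z j := by
    rw [Finset.prod_eq_single j] <;> simp +contextual
  rw [this]
  ring

namespace Symb

variable {a s : ℝ} {F P : (Fin d → ℂ) → ℂ}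

lemma symBound (h : Symb a F) : ∃ C, SymBound a C F :=
  (h.decay (d + 1)).imp fun _ hC => ⟨h.diff, hC⟩

lemma mul_growth (h : Symb a F) (hP : DifferentiableOn ℂ P (tube d a)) {K : ℝ} {n : ℕ}
    (hK : ∀ z ∈ tube d a, ‖P z‖ ≤ K * (1 + ‖reV z‖) ^ n) : Symb a fun z => P z * F z := by
  refine ⟨hP.mul h.diff, fun r => ?_⟩
  obtain ⟨C, hC⟩ := h.decay (n + r)
  refine ⟨|K| * C, fun z hz => ?_⟩
  have h1 := hC z hz
  calc ‖P z * F z‖ * (1 + ‖reV z‖) ^ r = ‖P z‖ * (‖F z‖ * (1 + ‖reV z‖) ^ r) := by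
        rw [norm_mul]; ring
    _ ≤ (|K| * (1 + ‖reV z‖) ^ n) * (‖F z‖ * (1 + ‖reV z‖) ^ r) := by
        gcongr
        exact (hK z hz).trans (by gcongr; exact le_abs_self K)
    _ = |K| * (‖F z‖ * (1 + ‖reV z‖) ^ (n + r)) := by rw [pow_add]; ring
    _ ≤ |K| * C := by gcongr

lemma mulCoord (h : Symb a F) (j : Fin d) : Symb a (mulCoord j F) := by
  refine h.mul_growth (P := fun z => 2 * Real.pi * Complex.I * z j) (K := 2 * Real.pi * (1 + |a|))
    (n := 1) (Differentiable.differentiableOn (by fun_prop)) fun z hz => ?_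
  have h1 := norm_apply_le_of_mem_tube hz j
  have h2 : ‖z j‖ ≤ (1 + |a|) * (1 + ‖reV z‖) := by
    have := le_abs_self a
    have := norm_nonneg (reV z)
    have := mul_nonneg (abs_nonneg a) this
    nlinarith
  have hpi := Real.pi_pos
  simp only [norm_mul, Complex.norm_I, Complex.norm_real, Complex.norm_ofNat, mul_one,
    Real.norm_of_nonneg hpi.le, pow_one]
  rw [mul_assoc (2 * Real.pi)]
  gcongr

lemma mon_mul (h : Symb a F) (α : Fin d → ℕ) : Symb a fun z => mon α z * F z := by
  induction α using multiIndex_induction with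
  | h0 => simpa [mon] using h
  | hs α j ih => rw [← mulCoord_mon]; exact ih.mulCoord j

lemma integrable (h : Symb a F) (ha : 0 < a) : Integrable fun ξ : Rd d => F (cvec ξ) :=
  h.symBound.elim fun _ hC => hC.integrable ha

lemma norm_cexp_dotC_cvec (x ξ : Rd d) :
    ‖Complex.exp (2 * Real.pi * Complex.I * dotC x (cvec ξ))‖ = 1 := by
  rw [SymBound.norm_cexp_dotC, dotC_cvec]
  simp

lemma integrable_mul_cexp (h : Symb a F) (ha : 0 < a) (x : Rd d) : Integrable fun ξ : Rd d =>
    F (cvec ξ) * Complex.exp (2 * Real.pi * Complex.I * dotC x (cvec ξ)) := by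
  refine (h.integrable ha).mul_bdd (c := 1) (Continuous.aestronglyMeasurable ?_)
    (Eventually.of_forall fun ξ => (norm_cexp_dotC_cvec x ξ).le)
  have := continuous_cvec (d := d)
  unfold dotC; fun_prop

lemma hasFDerivAt_kern (h : Symb a F) (ha : 0 < a) (x : Rd d) : HasFDerivAt (kern F)
    (∑ j, (EuclideanSpace.proj j : Rd d →L[ℝ] ℝ).smulRight (kern (_root_.mulCoord j F) x)) x := by
  let L : Fin d → ℂ →L[ℝ] (Rd d →L[ℝ] ℂ) := fun j =>
    ContinuousLinearMap.smulRightL ℝ (Rd d) ℂ (EuclideanSpace.proj j)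
  have hL : ∀ j c, L j c = (EuclideanSpace.proj j : Rd d →L[ℝ] ℝ).smulRight c := fun j c => rfl
  let e : Rd d → Rd d → ℂ := fun x ξ =>
    Complex.exp (2 * Real.pi * Complex.I * dotC x (cvec ξ))
  have he : ∀ x ξ, ‖e x ξ‖ = 1 := norm_cexp_dotC_cvec
  have hint : ∀ {F : (Fin d → ℂ) → ℂ}, Symb a F → ∀ x,
      Integrable fun ξ : Rd d => F (cvec ξ) * e x ξ := fun hF x => hF.integrable_mul_cexp ha x
  have key := hasFDerivAt_integral_of_dominated_of_fderiv_le (𝕜 := ℝ) (μ := volume)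
    (F := fun x ξ => F (cvec ξ) * e x ξ)
    (F' := fun x ξ => ∑ j, L j (_root_.mulCoord j F (cvec ξ) * e x ξ))
    (bound := fun ξ => ∑ j, ‖_root_.mulCoord j F (cvec ξ)‖) (x₀ := x) (s := Set.univ)
    univ_mem (Eventually.of_forall fun x => (hint h x).aestronglyMeasurable) (hint h x)
    (Finset.aestronglyMeasurable_fun_sum _ fun j _ =>
      (L j).continuous.comp_aestronglyMeasurable (hint (h.mulCoord j) x).aestronglyMeasurable)
    (Eventually.of_forall fun ξ y _ => by
      refine (norm_sum_le _ _).trans (Finset.sum_le_sum fun j _ => ?_)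
      rw [hL, ContinuousLinearMap.norm_smulRight_apply, norm_mul, he, mul_one]
      refine mul_le_of_le_one_left (norm_nonneg _) ?_
      refine ContinuousLinearMap.opNorm_le_bound _ zero_le_one fun y => ?_
      simpa using PiLp.norm_apply_le y j)
    (integrable_finsetSum _ fun j _ => ((h.mulCoord j).integrable ha).norm)
    (Eventually.of_forall fun ξ y _ => by
      have h1 : HasFDerivAt (fun y : Rd d => dotC y (cvec ξ))
          (∑ j, L j (cvec ξ j)) y := by
        refine HasFDerivAt.fun_sum fun j _ => ?_
        have h2 := (Complex.ofRealCLM.hasFDerivAt (x := y j)).comp y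
          ((EuclideanSpace.proj j : Rd d →L[ℝ] ℝ).hasFDerivAt (x := y))
        refine (h2.mul_const (cvec ξ j)).congr_fderiv ?_
        ext w; simp [hL, mul_comm]
      have h3 := ((h1.const_mul (2 * Real.pi * Complex.I)).cexp).const_mul (F (cvec ξ))
      refine h3.congr_fderiv ?_
      ext w
      simp only [hL, _root_.mulCoord, sum_apply, smul_apply,
        ContinuousLinearMap.smulRight_apply, Finset.smul_sum, smul_eq_mul,
        Complex.real_smul, e]
      exact Finset.sum_congr rfl fun j _ => by ring)
  refine key.congr_fderiv ?_
  rw [integral_finsetSum _ fun j _ => (L j).integrable_comp (hint (h.mulCoord j) x)]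
  refine Finset.sum_congr rfl fun j _ => ?_
  rw [← hL, (L j).integral_comp_comm (hint (h.mulCoord j) x)]
  rfl

lemma kern_smooth (h : Symb a F) (ha : 0 < a) : ContDiff ℝ (⊤ : ℕ∞) (kern F) ∧
    ∀ j, dop j (kern F) = kern (_root_.mulCoord j F) :=
  commute_dop (T := kern) (S := {F | Symb a F}) (D := _root_.mulCoord)
    (fun _ h j => Symb.mulCoord h j) (fun _ h x => Symb.hasFDerivAt_kern h ha x) F h

lemma pD_kern (h : Symb a F) (ha : 0 < a) (α : Fin d → ℕ) :
    pD α (kern F) = kern fun z => mon α z * F z := by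
  induction α using multiIndex_induction with
  | h0 => simp [pD_zero, mon]
  | hs α j ih =>
    rw [← dop_pD (h.kern_smooth ha).1, ih, ((h.mon_mul α).kern_smooth ha).2, mulCoord_mon]

lemma kern_mem (h : Symb a F) (hs : 0 ≤ s) (hsa : s < a) : kern F ∈ ExpKernel d s := by
  obtain ⟨C, hC⟩ := h.symBound
  have ha := hs.trans_lt hsa
  have hC0 : 0 ≤ C := le_trans (by positivity) (hC.le _ (cvec_mem_tube ha 0))
  refine ⟨(h.kern_smooth ha).1.continuous.aestronglyMeasurable, _,
    mul_nonneg hC0 (integral_nonneg fun ξ => ?_), fun x => hC.norm_kern_le hs hsa x⟩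
  positivity

lemma kern_expSmooth (h : Symb a F) (ha : 0 < a) : kern F ∈ ExpSmooth d 0 := by
  refine ⟨(h.kern_smooth ha).1, fun α => ?_⟩
  rw [h.pD_kern ha]
  obtain ⟨-, C, -, hb⟩ := (h.mon_mul α).kern_mem le_rfl ha
  exact ⟨C, fun x => by simpa using hb x⟩

end Symb

section Fourier

open scoped FourierTransform

lemma kern_eq_fourierInv (F : (Fin d → ℂ) → ℂ) : kern F = 𝓕⁻ fun ξ : Rd d => F (cvec ξ) := by
  funext x
  rw [kern, Real.fourierInv_eq']
  congr 1
  funext ξ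
  rw [dotC_cvec, real_inner_comm, smul_eq_mul, mul_comm]
  congr 2
  push_cast
  ring

lemma Symb.integrable_kern {a : ℝ} (ha : 0 < a) {F : (Fin d → ℂ) → ℂ} (h : Symb a F) :
    Integrable (kern F) :=
  ExpKernel.integrable (half_pos ha) (h.kern_mem (half_pos ha).le (by linarith))

lemma fourier_kern {a : ℝ} (ha : 0 < a) {F : (Fin d → ℂ) → ℂ} (h : Symb a F) :
    𝓕 (kern F) = fun ξ : Rd d => F (cvec ξ) := by
  have hcont : Continuous fun ξ : Rd d => F (cvec ξ) :=
    h.diff.continuousOn.comp_continuous continuous_cvec (cvec_mem_tube ha)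
  have h1 := h.integrable_kern ha
  rw [kern_eq_fourierInv] at h1 ⊢
  refine hcont.fourier_fourierInv_eq (h.integrable ha) ?_
  refine h1.comp_neg.congr (Eventually.of_forall fun x => ?_)
  simp only [Real.fourierInv_eq_fourier_neg, neg_neg]

lemma integral_kern {a : ℝ} (ha : 0 < a) {F : (Fin d → ℂ) → ℂ} (h : Symb a F) :
    ∫ x, kern F x = F 0 := by
  have h1 := congrFun (fourier_kern ha h) 0
  have h2 : cvec (0 : Rd d) = 0 := by ext j; simp [cvec]
  rw [h2, Real.fourier_eq'] at h1
  simpa using h1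

/-- The convolution of two kernels is the kernel of the product of the symbols. -/
theorem convF_kern {a : ℝ} (ha : 0 < a) {F G : (Fin d → ℂ) → ℂ} (hF : Symb a F) (hG : Symb a G)
    (hFG : Symb a fun z => F z * G z) : convF (kern F) (kern G) = kern fun z => F z * G z := by
  have hconv : convF (kern F) (kern G) =
      convolution (kern F) (kern G) (ContinuousLinearMap.mul ℂ ℂ) volume := rfl
  have hint : Integrable (convF (kern F) (kern G)) := by
    rw [hconv]; exact (hF.integrable_kern ha).integrable_convolution _ (hG.integrable_kern ha)
  have hfc : 𝓕 (convF (kern F) (kern G)) = fun ξ : Rd d => F (cvec ξ) * G (cvec ξ) := by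
    funext ξ
    rw [hconv, Real.fourier_mul_convolution_eq (hF.integrable_kern ha) (hG.integrable_kern ha),
      fourier_kern ha hF, fourier_kern ha hG]
  have hcc : Continuous (convF (kern F) (kern G)) :=
    (convF_smooth le_rfl (half_pos ha) (hF.kern_mem (half_pos ha).le (by linarith))
      (hG.kern_expSmooth ha)).1.continuous
  rw [kern_eq_fourierInv fun z => F z * G z, ← hfc]
  refine (hcc.fourierInv_fourier_eq hint ?_).symm
  rw [hfc]
  exact hFG.integrable ha

end Fourier

end Symbols

section ConvolutionIdentities

variable {d : ℕ} {κ a R : ℝ} {k u : Rd d → ℂ}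

lemma convF_dop_left (hκ : 0 ≤ κ) (ha : κ < a) (hks : ContDiff ℝ (⊤ : ℕ∞) k)
    (hk : k ∈ ExpKernel d a) (j : Fin d) (hk' : dop j k ∈ ExpKernel d a) (hu : u ∈ ExpSmooth d κ) :
    convF (dop j k) u = convF k (dop j u) := by
  funext x
  obtain ⟨D, -, hD⟩ := ExpSmooth.bound hu
  obtain ⟨D', -, hD'⟩ := ExpSmooth.bound (ExpSmooth.dop_mem hu j)
  have hud : Differentiable ℝ u := hu.1.differentiable (by simp)
  have hg : ∀ t, fderiv ℝ (fun t => u (x - t)) t (EuclideanSpace.single j 1) =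
      -dop j u (x - t) := by
    intro t
    have h1 := (hud (x - t)).hasFDerivAt.comp t ((hasFDerivAt_id t).const_sub x)
    have h2 : fderiv ℝ (fun t => u (x - t)) t = _ := h1.fderiv
    rw [h2]
    simp [dop]
  have h1 := integrable_conv hκ ha hk hu.1.continuous hD x
  have h2 := integrable_conv hκ ha hk' hu.1.continuous hD x
  have h3 := integrable_conv hκ ha hk (contDiff_dop hu.1 j).continuous hD' x
  have h := integral_mul_fderiv_eq_neg_fderiv_mul_of_integrable (μ := volume) (𝕜 := ℂ)
    (f := k) (g := fun t => u (x - t)) (v := EuclideanSpace.single j 1)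
    h2 (by simpa only [hg, mul_neg] using h3.fun_neg) h1
    (fun t _ => hks.differentiable (by simp) t) (fun t _ => by fun_prop)
  simp only [hg, mul_neg, integral_neg, neg_inj] at h
  exact h.symm

/-- The symbol of `R - Δ`. -/
def lapSym (R : ℝ) (z : Fin d → ℂ) : ℂ := R - ∑ j, (2 * Real.pi * Complex.I * z j) ^ 2

lemma lapSym_mul (R : ℝ) (F : (Fin d → ℂ) → ℂ) (z : Fin d → ℂ) :
    lapSym R z * F z = R * F z - ∑ j, mulCoord j (mulCoord j F) z := by
  rw [lapSym, sub_mul, Finset.sum_mul]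
  congr 1
  refine Finset.sum_congr rfl fun j _ => ?_
  simp only [mulCoord]; ring

lemma Symb.lapSym_mul {F : (Fin d → ℂ) → ℂ} (h : Symb a F) (R : ℝ) :
    Symb a fun z => lapSym R z * F z := by
  refine ⟨?_, fun r => ?_⟩
  · refine DifferentiableOn.mul (Differentiable.differentiableOn ?_) h.diff
    unfold lapSym; fun_prop
  · obtain ⟨C, hC⟩ := h.decay r
    choose E hE using fun j => ((h.mulCoord j).mulCoord j).decay r
    refine ⟨|R| * C + ∑ j, E j, fun z hz => ?_⟩
    rw [_root_.lapSym_mul]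
    calc ‖R * F z - ∑ j, _root_.mulCoord j (_root_.mulCoord j F) z‖ * (1 + ‖reV z‖) ^ r
        ≤ (|R| * ‖F z‖ + ∑ j, ‖_root_.mulCoord j (_root_.mulCoord j F) z‖) * (1 + ‖reV z‖) ^ r := by
          gcongr
          refine (norm_sub_le _ _).trans (add_le_add ?_ (norm_sum_le _ _))
          rw [norm_mul, Complex.norm_real, Real.norm_eq_abs]
      _ = |R| * (‖F z‖ * (1 + ‖reV z‖) ^ r) +
          ∑ j, ‖_root_.mulCoord j (_root_.mulCoord j F) z‖ * (1 + ‖reV z‖) ^ r := by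
          rw [add_mul, Finset.sum_mul]; ring
      _ ≤ _ := add_le_add (mul_le_mul_of_nonneg_left (hC z hz) (abs_nonneg R))
          (Finset.sum_le_sum fun j _ => hE j z hz)

lemma ExpSmooth.lapOp_mem (hu : u ∈ ExpSmooth d κ) (R : ℝ) : lapOp R u ∈ ExpSmooth d κ := by
  refine ⟨contDiff_lapOp R hu.1, fun α => ?_⟩
  obtain ⟨D, hD, hb⟩ := ExpSmooth.bound (ExpSmooth.pD_mem hu α)
  choose E hE hb' using fun j =>
    ExpSmooth.bound (ExpSmooth.dop_mem (ExpSmooth.dop_mem (ExpSmooth.pD_mem hu α) j) j)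
  refine ⟨|R| * D + ∑ j, E j, fun x => ?_⟩
  rw [pD_lapOp R hu.1, lapOp]
  refine (norm_sub_le _ _).trans ?_
  rw [norm_mul, Complex.norm_real, Real.norm_eq_abs, add_mul, Finset.sum_mul, mul_assoc]
  exact add_le_add (mul_le_mul_of_nonneg_left (hb x) (abs_nonneg R))
    ((norm_sum_le _ _).trans (Finset.sum_le_sum fun j _ => hb' j x))

lemma ExpSmooth.lapOp_iterate_mem (hu : u ∈ ExpSmooth d κ) (R : ℝ) (n : ℕ) :
    (lapOp R)^[n] u ∈ ExpSmooth d κ := by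
  induction n with
  | zero => exact hu
  | succ n ih => rw [Function.iterate_succ_apply']; exact lapOp_mem ih R

theorem convF_lapSym {F : (Fin d → ℂ) → ℂ} (hF : Symb a F) (hκ : 0 ≤ κ) (ha : κ < a)
    (hu : u ∈ ExpSmooth d κ) :
    convF (kern fun z => lapSym R z * F z) u = convF (kern F) (lapOp R u) := by
  obtain ⟨s, hs, hsa⟩ := exists_between ha
  have ha0 : 0 < a := hκ.trans_lt ha
  have hs0 : 0 ≤ s := hκ.trans hs.le
  have hk : ∀ {F : (Fin d → ℂ) → ℂ}, Symb a F → kern F ∈ ExpKernel d s :=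
    fun h => h.kern_mem hs0 hsa
  have hint : ∀ {F : (Fin d → ℂ) → ℂ} {u : Rd d → ℂ}, Symb a F → u ∈ ExpSmooth d κ → ∀ x,
      Integrable fun t => kern F t * u (x - t) := fun hF hu x => by
    obtain ⟨D, -, hD⟩ := ExpSmooth.bound hu
    exact integrable_conv hκ hs (hk hF) hu.1.continuous hD x
  have h2 : ∀ j, convF (kern (mulCoord j (mulCoord j F))) u = convF (kern F) (dop j (dop j u)) := by
    intro j
    have hj := hF.mulCoord j
    rw [← (hj.kern_smooth ha0).2 j, convF_dop_left hκ hs (hj.kern_smooth ha0).1 (hk hj) j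
      (by rw [(hj.kern_smooth ha0).2 j]; exact hk (hj.mulCoord j)) hu, ← (hF.kern_smooth ha0).2 j,
      convF_dop_left hκ hs (hF.kern_smooth ha0).1 (hk hF) j
      (by rw [(hF.kern_smooth ha0).2 j]; exact hk hj) (ExpSmooth.dop_mem hu j)]
  have h1 : kern (fun z => lapSym R z * F z) =
      fun t => R * kern F t - ∑ j, kern (mulCoord j (mulCoord j F)) t := by
    funext t
    have hF2 : ∀ j, Integrable fun ξ : Rd d => mulCoord j (mulCoord j F) (cvec ξ) *
        Complex.exp (2 * Real.pi * Complex.I * dotC t (cvec ξ)) := fun j =>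
      ((hF.mulCoord j).mulCoord j).integrable_mul_cexp ha0 t
    simp only [kern]
    rw [← integral_finsetSum _ fun j _ => hF2 j, ← integral_const_mul,
      ← integral_sub ((hF.integrable_mul_cexp ha0 t).const_mul _)
        (integrable_finsetSum _ fun j _ => hF2 j)]
    congr 1
    funext ξ
    rw [lapSym_mul, sub_mul, Finset.sum_mul, mul_assoc]
  funext x
  have h3 : ∀ j, Integrable fun t => kern F t * dop j (dop j u) (x - t) := fun j =>
    hint hF (ExpSmooth.dop_mem (ExpSmooth.dop_mem hu j) j) x
  have h4 : ∀ j, Integrable fun t => kern (mulCoord j (mulCoord j F)) t * u (x - t) := fun j =>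
    hint ((hF.mulCoord j).mulCoord j) hu x
  have hl : convF (kern fun z => lapSym R z * F z) u x =
      R * convF (kern F) u x - ∑ j, convF (kern (mulCoord j (mulCoord j F))) u x := by
    simp only [convF, h1]
    rw [← integral_finsetSum _ fun j _ => h4 j, ← integral_const_mul,
      ← integral_sub ((hint hF hu x).const_mul _) (integrable_finsetSum _ fun j _ => h4 j)]
    congr 1
    funext t
    rw [sub_mul, Finset.sum_mul, mul_assoc]
  have hr : convF (kern F) (lapOp R u) x =
      R * convF (kern F) u x - ∑ j, convF (kern F) (dop j (dop j u)) x := by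
    simp only [convF, lapOp]
    rw [← integral_finsetSum _ fun j _ => h3 j, ← integral_const_mul,
      ← integral_sub ((hint hF hu x).const_mul _) (integrable_finsetSum _ fun j _ => h3 j)]
    congr 1
    funext t
    rw [mul_sub, Finset.mul_sum]
    ring
  rw [hl, hr]
  simp only [h2]

lemma convF_lapSym_pow {F : (Fin d → ℂ) → ℂ} (hF : Symb a F) (hκ : 0 ≤ κ) (ha : κ < a)
    (hu : u ∈ ExpSmooth d κ) (n : ℕ) :
    Symb a (fun z => lapSym R z ^ n * F z) ∧
      convF (kern fun z => lapSym R z ^ n * F z) u = convF (kern F) ((lapOp R)^[n] u) := by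
  induction n generalizing u with
  | zero => simpa using hF
  | succ n ih =>
    have h1 : (fun z => lapSym R z ^ (n + 1) * F z) =
        fun z => lapSym R z * (lapSym R z ^ n * F z) := by
      funext z; ring
    have h2 := (ih hu).1
    rw [h1, convF_lapSym h2 hκ ha hu, (ih (ExpSmooth.lapOp_mem hu R)).2,
      Function.iterate_succ_apply]
    exact ⟨h2.lapSym_mul R, rfl⟩

/-- Associativity of the convolution. -/
theorem convF_assoc {ψ f : Rd d → ℂ} (hκ : 0 ≤ κ) (ha : κ < a) (hψ : ψ ∈ ExpKernel d a)
    (hf : f ∈ ExpKernel d a) (hu : u ∈ ExpSmooth d κ) :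
    convF (convF ψ f) u = convF ψ (convF f u) := by
  have ha0 := hκ.trans_lt ha
  obtain ⟨D, -, hD⟩ := ExpSmooth.bound hu
  obtain ⟨C, hC, hfC⟩ := hf.2
  obtain ⟨C', hC', hψC⟩ := hψ.2
  funext x
  refine convolution_assoc (L := ContinuousLinearMap.mul ℂ ℂ) (L₂ := ContinuousLinearMap.mul ℂ ℂ)
    (L₃ := ContinuousLinearMap.mul ℂ ℂ) (L₄ := ContinuousLinearMap.mul ℂ ℂ) (μ := volume)
    (ν := volume) (fun x y z => by simp [mul_assoc]) hψ.1 hf.1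
    hu.1.continuous.aestronglyMeasurable ?_ (Eventually.of_forall fun y => ?_) ?_
  · exact (ExpKernel.integrable ha0 hψ).ae_convolution_exists _ (ExpKernel.integrable ha0 hf)
  · have := (integrable_conv hκ ha hf hu.1.continuous hD y).norm
    simpa [ConvolutionExistsAt] using this
  · have hb : ∀ y, ‖convolution (fun x => ‖f x‖) (fun x => ‖u x‖) (ContinuousLinearMap.mul ℝ ℝ)
        volume y‖ ≤ C * D * (∫ t : Rd d, Real.exp (-((a - κ) * ‖t‖))) * Real.exp (κ * ‖y‖) := by
      intro y
      refine (norm_integral_le_of_norm_le (g := fun t => C * D * Real.exp (κ * ‖y‖) *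
        Real.exp (-((a - κ) * ‖t‖))) ((integrable_exp_neg_norm (sub_pos.2 ha)).const_mul _)
        (Eventually.of_forall fun t => ?_)).trans_eq ?_
      · simpa using conv_bound hκ hC hfC hD y t
      · rw [integral_const_mul]; ring
    have hm : AEStronglyMeasurable (convolution (fun x => ‖f x‖) (fun x => ‖u x‖)
        (ContinuousLinearMap.mul ℝ ℝ) volume) :=
      (hf.1.norm.convolution_integrand _
        hu.1.continuous.norm.aestronglyMeasurable).integral_prod_right'
    refine ((integrable_exp_neg_norm (sub_pos.2 ha)).const_mul (C' *
      (C * D * (∫ t : Rd d, Real.exp (-((a - κ) * ‖t‖)))) * Real.exp (κ * ‖x‖))).mono'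
      (hψ.1.norm.mul (hm.comp_quasiMeasurePreserving
        (quasiMeasurePreserving_sub_left_of_right_invariant volume x)))
      (Eventually.of_forall fun t => ?_)
    have := conv_bound (φ := fun y => ((convolution (fun x => ‖f x‖) (fun x => ‖u x‖)
      (ContinuousLinearMap.mul ℝ ℝ) volume y : ℝ) : ℂ)) hκ hC' hψC
      (fun y => by rw [Complex.norm_real]; exact hb y) x t
    rw [norm_mul, Complex.norm_real] at this
    simpa using this

end ConvolutionIdentities

section Growth

/-- The growth function `log ∏ (1 + x_j (1 + t)^{2l})`. -/
def growth (x : ℕ → ℝ) (l : ℕ) (t : ℝ) : ℝ := Real.log (prodR x ((1 + t) ^ (2 * l)))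

variable {x : ℕ → ℝ} {a b : ℝ}

namespace ProdSeq

lemma prodR_pos (h : ProdSeq x) {t : ℝ} (ht : 0 ≤ t) : 0 < prodR x t :=
  one_pos.trans_le (h.one_le_prodR ht)

lemma exp_growth (h : ProdSeq x) (l : ℕ) (t : ℝ) :
    Real.exp (growth x l t) = prodR x ((1 + t) ^ (2 * l)) :=
  Real.exp_log (h.prodR_pos (by rw [pow_mul]; positivity))

lemma growth_nonneg (h : ProdSeq x) (l : ℕ) (t : ℝ) : 0 ≤ growth x l t :=
  Real.log_nonneg (h.one_le_prodR (by rw [pow_mul]; positivity))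

lemma growth_mono (h : ProdSeq x) (l : ℕ) (ha : 0 ≤ a) (hab : a ≤ b) :
    growth x l a ≤ growth x l b :=
  Real.log_le_log (h.prodR_pos (by positivity)) (h.prodR_mono (by positivity) (by gcongr))

lemma growth_le_mul (h : ProdSeq x) (l : ℕ) (ha : 0 ≤ a) (hab : a ≤ b) :
    growth x l b ≤ ((1 + b) / (1 + a)) ^ (2 * l) * growth x l a := by
  have h1 : 1 ≤ ((1 + b) / (1 + a)) ^ (2 * l) :=
    one_le_pow₀ ((one_le_div (by positivity)).2 (by linarith))
  have h2 := h.prodR_mul_le (t := (1 + a) ^ (2 * l)) (by positivity) h1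
  have h3 : ((1 + b) / (1 + a)) ^ (2 * l) * (1 + a) ^ (2 * l) = (1 + b) ^ (2 * l) := by
    rw [← mul_pow, div_mul_cancel₀ _ (by positivity)]
  have hb : 0 ≤ b := ha.trans hab
  rw [h3] at h2
  refine (Real.log_le_log (h.prodR_pos (by positivity)) h2).trans_eq ?_
  rw [Real.log_rpow (h.prodR_pos (by positivity))]
  rfl

lemma one_add_pow_sub_one_le {u : ℝ} (hu : 0 ≤ u) (n : ℕ) :
    (1 + u) ^ n - 1 ≤ n * u * (1 + u) ^ n := by
  have h1 : (0 : ℝ) < 1 + u := by linarith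
  have h2 := one_add_mul_le_pow (a := -(u / (1 + u)))
    (by have : u / (1 + u) ≤ 1 := (div_le_one h1).2 (by linarith)
        linarith) n
  have h3 : 1 + -(u / (1 + u)) = (1 + u)⁻¹ := by field_simp; ring
  rw [h3, inv_pow] at h2
  have h4 : (1 + n * -(u / (1 + u))) * (1 + u) ^ n ≤ 1 := by
    refine (mul_le_mul_of_nonneg_right h2 (by positivity)).trans_eq ?_
    rw [inv_mul_cancel₀ (by positivity)]
  have h5 : n * (u / (1 + u)) * (1 + u) ^ n ≤ n * u * (1 + u) ^ n := by
    gcongr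
    exact div_le_self hu (by linarith)
  nlinarith

lemma abs_growth_sub_le (h : ProdSeq x) (l : ℕ) (ha : 0 ≤ a) (hb : 0 ≤ b) :
    |growth x l b - growth x l a| ≤
      2 * l * growth x l a / (1 + a) * (1 + |b - a|) ^ (2 * l + 1) := by
  have hA : (0 : ℝ) < 1 + a := by linarith
  have hL := h.growth_nonneg l a
  have key : ∀ q : ℝ, q ≤ (2 * l : ℕ) * (|b - a| / (1 + a)) * (1 + |b - a|) ^ (2 * l) →
      q * growth x l a ≤ 2 * l * growth x l a / (1 + a) * (1 + |b - a|) ^ (2 * l + 1) := by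
    intro q hq
    refine (mul_le_mul_of_nonneg_right hq hL).trans ?_
    have : |b - a| ≤ 1 + |b - a| := by linarith
    calc (2 * l : ℕ) * (|b - a| / (1 + a)) * (1 + |b - a|) ^ (2 * l) * growth x l a
        = 2 * l * growth x l a / (1 + a) * ((1 + |b - a|) ^ (2 * l) * |b - a|) := by
          push_cast; ring
      _ ≤ _ := by rw [pow_succ]; gcongr
  rcases le_total a b with hab | hab
  · rw [abs_of_nonneg (sub_nonneg.2 (h.growth_mono l ha hab))]
    have h1 := h.growth_le_mul l ha hab
    have h0 : 0 ≤ b - a := sub_nonneg.2 hab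
    have h2 : (1 + b) / (1 + a) = 1 + (b - a) / (1 + a) := by field_simp; ring
    have h3 := one_add_pow_sub_one_le (u := (b - a) / (1 + a)) (by positivity) (2 * l)
    refine le_trans ?_ (key (((1 + b) / (1 + a)) ^ (2 * l) - 1) ?_)
    · linarith
    · rw [h2, abs_of_nonneg h0]
      refine h3.trans ?_
      have : (b - a) / (1 + a) ≤ b - a := div_le_self h0 (by linarith)
      gcongr
  · rw [abs_sub_comm, abs_of_nonneg (sub_nonneg.2 (h.growth_mono l hb hab))]
    have h1 := h.growth_le_mul l hb hab
    have h0 : 0 ≤ a - b := sub_nonneg.2 hab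
    have hB : (0 : ℝ) < 1 + b := by linarith
    have h2 : ((1 + b) / (1 + a)) ^ (2 * l) * growth x l a ≤ growth x l b := by
      refine (mul_le_mul_of_nonneg_left h1 (by positivity)).trans_eq ?_
      rw [← mul_assoc, ← mul_pow, div_mul_div_cancel₀ hA.ne', div_self hB.ne', one_pow, one_mul]
    have h3 : (1 + b) / (1 + a) = 1 + -((a - b) / (1 + a)) := by field_simp; ring
    have h4 := one_add_mul_le_pow (a := -((a - b) / (1 + a)))
      (by have : (a - b) / (1 + a) ≤ 1 := (div_le_one hA).2 (by linarith)
          linarith) (2 * l)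
    rw [← h3] at h4
    refine le_trans ?_ (key (1 - ((1 + b) / (1 + a)) ^ (2 * l)) ?_)
    · linarith
    · rw [abs_sub_comm, abs_of_nonneg h0]
      refine le_trans (b := (2 * l : ℕ) * ((a - b) / (1 + a))) (by linarith) ?_
      exact le_mul_of_one_le_right (by positivity) (one_le_pow₀ (by linarith))

lemma continuous_prodR (h : ProdSeq x) : Continuous (prodR x) := by
  have h1 : prodR x = fun t : ℝ => (prodC x t).re := by
    funext t; rw [prodC_ofReal, Complex.ofReal_re]
  rw [h1]
  exact Complex.continuous_re.comp (h.differentiable_prodC.continuous.comp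
    Complex.continuous_ofReal)

lemma continuous_growth (h : ProdSeq x) (l : ℕ) : Continuous (growth x l) :=
  (h.continuous_prodR.comp (by fun_prop)).log fun t =>
    (h.prodR_pos (by simp only [pow_mul]; positivity)).ne'

end ProdSeq

end Growth

section Mollifier

variable {d : ℕ}

lemma exists_pow_mul_gauss_le (n : ℕ) : ∃ C : ℝ, 0 ≤ C ∧ ∀ t : ℝ, 0 ≤ t →
    (1 + t) ^ n * Real.exp (-(t ^ 2 / 2)) ≤ C * Real.exp (-(1 * t)) := by
  refine ⟨n.factorial * Real.exp 3, by positivity, fun t ht => ?_⟩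
  have h1 : (1 + t) ^ n ≤ n.factorial * Real.exp (1 + t) := by
    have := Real.pow_div_factorial_le_exp (1 + t) (by linarith) n
    rwa [div_le_iff₀ (by positivity), mul_comm] at this
  refine (mul_le_mul_of_nonneg_right h1 (Real.exp_pos _).le).trans ?_
  rw [mul_assoc, mul_assoc, ← Real.exp_add, ← Real.exp_add]
  exact mul_le_mul_of_nonneg_left (Real.exp_le_exp.2 (by nlinarith [sq_nonneg (t - 2)]))
    (by positivity)

/-- The complex Gaussian `exp (-∑ z_j²)`. -/
def gaussC (z : Fin d → ℂ) : ℂ := Complex.exp (-∑ j, z j ^ 2)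

lemma sum_sq (z : Fin d → ℂ) : ∑ j, z j ^ 2 =
    ((‖reV z‖ ^ 2 - ‖imV z‖ ^ 2 : ℝ) : ℂ) + 2 * Complex.I * (inner ℝ (imV z) (reV z) : ℝ) := by
  rw [EuclideanSpace.real_norm_sq_eq, EuclideanSpace.real_norm_sq_eq, PiLp.inner_apply,
    ← Finset.sum_sub_distrib]
  push_cast
  rw [Finset.mul_sum, ← Finset.sum_add_distrib]
  refine Finset.sum_congr rfl fun j _ => ?_
  apply Complex.ext <;> simp [reV, imV, sq]; ring

lemma norm_gaussC (z : Fin d → ℂ) : ‖gaussC z‖ = Real.exp (‖imV z‖ ^ 2 - ‖reV z‖ ^ 2) := by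
  rw [gaussC, Complex.norm_exp, sum_sq]
  congr 1
  simp [-Complex.ofReal_pow]

lemma continuous_gaussC : Continuous (gaussC : (Fin d → ℂ) → ℂ) := by unfold gaussC; fun_prop

lemma reV_sub_cvec (z : Fin d → ℂ) (t : Rd d) : reV (z - cvec t) = reV z - t := by
  ext j; simp [reV, cvec]

lemma imV_sub_cvec (z : Fin d → ℂ) (t : Rd d) : imV (z - cvec t) = imV z := by
  ext j; simp [imV, cvec]

/-- The total mass of the Gaussian. -/
def gaussMass (d : ℕ) : ℝ := ∫ s : Rd d, Real.exp (-‖s‖ ^ 2)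

lemma integrable_pow_mul_gauss (n : ℕ) :
    Integrable fun s : Rd d => (1 + ‖s‖) ^ n * Real.exp (-(‖s‖ ^ 2 / 2)) := by
  obtain ⟨C, -, hC⟩ := exists_pow_mul_gauss_le n
  refine ((integrable_exp_neg_norm one_pos).const_mul C).mono'
    (Continuous.aestronglyMeasurable (by fun_prop)) (Eventually.of_forall fun s => ?_)
  rw [Real.norm_of_nonneg (by positivity)]
  exact hC _ (norm_nonneg s)

lemma integrable_pow_mul_gauss_sq (n : ℕ) :
    Integrable fun s : Rd d => (1 + ‖s‖) ^ n * Real.exp (-‖s‖ ^ 2) := by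
  refine (integrable_pow_mul_gauss n).mono'
    (Continuous.aestronglyMeasurable (by fun_prop)) (Eventually.of_forall fun s => ?_)
  rw [Real.norm_of_nonneg (by positivity)]
  gcongr
  nlinarith [sq_nonneg ‖s‖]

lemma gaussMass_pos : 0 < gaussMass d := by
  have hi : Integrable fun s : Rd d => Real.exp (-‖s‖ ^ 2) := by
    simpa using integrable_pow_mul_gauss_sq (d := d) 0
  exact integral_exp_pos hi

lemma integral_gaussC (z : Fin d → ℂ) : ∫ t : Rd d, gaussC (z - cvec t) = gaussMass d := by
  have h1 : ∀ w : Rd d, ∫ v : Rd d, Complex.exp (-‖v‖ ^ 2 + 2 * Complex.I * (inner ℝ w v : ℝ)) =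
      (Real.pi : ℂ) ^ (Module.finrank ℝ (Rd d) / 2 : ℂ) * Complex.exp (-‖w‖ ^ 2) := by
    intro w
    have := GaussianFourier.integral_cexp_neg_mul_sq_norm_add (b := 1) (by simp)
      (2 * Complex.I) w
    simp only [neg_mul, one_mul, div_one, mul_one] at this
    rw [this]
    congr 2
    rw [mul_pow, Complex.I_sq]; ring
  have h2 : (gaussMass d : ℂ) = (Real.pi : ℂ) ^ (Module.finrank ℝ (Rd d) / 2 : ℂ) := by
    rw [gaussMass, ← integral_complex_ofReal]
    simpa using h1 0
  rw [← integral_add_left_eq_self (μ := volume) (fun t : Rd d => gaussC (z - cvec t)) (reV z)]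
  have h3 : ∀ s : Rd d, gaussC (z - cvec (reV z + s)) = Complex.exp (‖imV z‖ ^ 2) *
      Complex.exp (-‖s‖ ^ 2 + 2 * Complex.I * (inner ℝ (imV z) s : ℝ)) := by
    intro s
    rw [gaussC, sum_sq, imV_sub_cvec, reV_sub_cvec, ← Complex.exp_add]
    congr 1
    simp only [sub_add_cancel_left, norm_neg, inner_neg_right]
    push_cast
    ring
  simp only [h3]
  rw [integral_const_mul, h1, h2, mul_left_comm, ← Complex.exp_add]
  simp

/-- The Gaussian regularization of a function on `ℝ^d`, as a function on `ℂ^d`. -/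
def mollify (L : Rd d → ℝ) (z : Fin d → ℂ) : ℂ :=
  (gaussMass d : ℂ)⁻¹ * ∫ t : Rd d, (L t : ℂ) * gaussC (z - cvec t)

variable {L : Rd d → ℝ} {n : ℕ} {K : ℝ}

lemma differentiable_mollify (hL : Continuous L) (hK : ∀ t, |L t| ≤ K * (1 + ‖t‖) ^ n) :
    Differentiable ℂ (mollify L) := by
  intro z₀
  have hc := continuous_cvec (d := d)
  have hg := continuous_gaussC (d := d)
  have hK0 : 0 ≤ K := by simpa using (abs_nonneg _).trans (hK 0)
  let U : Set (Fin d → ℂ) := {z | ‖imV z‖ < ‖imV z₀‖ + 1} ∩ {z | ‖reV z‖ < ‖reV z₀‖ + 1}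
  have hU : IsOpen U := (isOpen_lt continuous_imV.norm continuous_const).inter
    (isOpen_lt continuous_reV.norm continuous_const)
  have hz₀ : z₀ ∈ U := ⟨by simp, by simp⟩
  have hd : DifferentiableOn ℂ (fun z => ∫ t : Rd d, (L t : ℂ) * gaussC (z - cvec t)) U := by
    refine differentiableOn_integral (b := fun t => K * Real.exp ((‖imV z₀‖ + 1) ^ 2 +
      (‖reV z₀‖ + 1) ^ 2) * ((1 + ‖t‖) ^ n * Real.exp (-(‖t‖ ^ 2 / 2)))) hU (fun z _ => ?_)
      (fun t => ?_) (fun z hz t => ?_) ((integrable_pow_mul_gauss n).const_mul _)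
    · exact Continuous.aestronglyMeasurable (by fun_prop)
    · refine Differentiable.differentiableOn ?_
      unfold gaussC
      fun_prop
    · rw [norm_mul, norm_gaussC, Complex.norm_real, Real.norm_eq_abs, imV_sub_cvec, reV_sub_cvec]
      have h1 : ‖t‖ ^ 2 ≤ 2 * ‖reV z - t‖ ^ 2 + 2 * ‖reV z‖ ^ 2 := by
        have h2 : ‖t‖ ≤ ‖reV z‖ + ‖reV z - t‖ := by
          simpa using norm_sub_le (reV z) (reV z - t)
        have := norm_nonneg t
        nlinarith [sq_nonneg (‖reV z‖ - ‖reV z - t‖)]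
      have h3 : ‖imV z‖ ^ 2 ≤ (‖imV z₀‖ + 1) ^ 2 := by gcongr; exact hz.1.le
      have h4 : ‖reV z‖ ^ 2 ≤ (‖reV z₀‖ + 1) ^ 2 := by gcongr; exact hz.2.le
      calc |L t| * Real.exp (‖imV z‖ ^ 2 - ‖reV z - t‖ ^ 2)
          ≤ K * (1 + ‖t‖) ^ n * Real.exp ((‖imV z₀‖ + 1) ^ 2 + (‖reV z₀‖ + 1) ^ 2 +
            -(‖t‖ ^ 2 / 2)) := by
            gcongr
            · exact hK t
            · linarith
        _ = _ := by rw [Real.exp_add]; ring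
  exact (hd.differentiableAt (hU.mem_nhds hz₀)).const_mul _

lemma norm_mollify_sub_le (hL : Continuous L) {z : Fin d → ℂ}
    (hK : ∀ s, |L (reV z + s) - L (reV z)| ≤ K * (1 + ‖s‖) ^ n) :
    ‖mollify L z - L (reV z)‖ ≤ K * (Real.exp (‖imV z‖ ^ 2) * ((gaussMass d)⁻¹ *
      ∫ s : Rd d, (1 + ‖s‖) ^ n * Real.exp (-‖s‖ ^ 2))) := by
  have hc := continuous_cvec (d := d)
  have hg := continuous_gaussC (d := d)
  have hpos := gaussMass_pos (d := d)
  have hn : ∀ s : Rd d, ‖gaussC (z - cvec (reV z + s))‖ =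
      Real.exp (‖imV z‖ ^ 2) * Real.exp (-‖s‖ ^ 2) := by
    intro s
    rw [norm_gaussC, imV_sub_cvec, reV_sub_cvec, ← Real.exp_add]
    simp [sub_eq_add_neg]
  have hb : ∀ s : Rd d, ‖((L (reV z + s) - L (reV z) : ℝ) : ℂ) * gaussC (z - cvec (reV z + s))‖ ≤
      K * Real.exp (‖imV z‖ ^ 2) * ((1 + ‖s‖) ^ n * Real.exp (-‖s‖ ^ 2)) := by
    intro s
    rw [norm_mul, hn, Complex.norm_real, Real.norm_eq_abs]
    refine (mul_le_mul_of_nonneg_right (hK s) (by positivity)).trans_eq (by ring)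
  have hi1 : Integrable fun s : Rd d => ((L (reV z + s) - L (reV z) : ℝ) : ℂ) *
      gaussC (z - cvec (reV z + s)) :=
    ((integrable_pow_mul_gauss_sq n).const_mul _).mono'
      (Continuous.aestronglyMeasurable (by fun_prop)) (Eventually.of_forall hb)
  have hi2 : Integrable fun s : Rd d => (L (reV z) : ℂ) * gaussC (z - cvec (reV z + s)) := by
    refine Integrable.const_mul ?_ _
    refine ((integrable_pow_mul_gauss_sq 0).const_mul (Real.exp (‖imV z‖ ^ 2))).mono'
      (Continuous.aestronglyMeasurable (by fun_prop)) (Eventually.of_forall fun s => ?_)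
    rw [hn, pow_zero, one_mul]
  have h1 : ∫ t : Rd d, (L t : ℂ) * gaussC (z - cvec t) =
      (∫ s : Rd d, ((L (reV z + s) - L (reV z) : ℝ) : ℂ) * gaussC (z - cvec (reV z + s))) +
        L (reV z) * gaussMass d := by
    rw [← integral_gaussC z, ← integral_const_mul,
      ← integral_add_left_eq_self (μ := volume) (fun t : Rd d => (L t : ℂ) * gaussC (z - cvec t))
        (reV z),
      ← integral_add_left_eq_self (μ := volume)
        (fun t : Rd d => (L (reV z) : ℂ) * gaussC (z - cvec t)) (reV z),
      ← integral_add hi1 hi2]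
    congr 1
    funext s
    push_cast
    ring
  have h2 : mollify L z - L (reV z) = (gaussMass d : ℂ)⁻¹ *
      ∫ s : Rd d, ((L (reV z + s) - L (reV z) : ℝ) : ℂ) * gaussC (z - cvec (reV z + s)) := by
    have : (gaussMass d : ℂ) ≠ 0 := by exact_mod_cast hpos.ne'
    rw [mollify, h1, mul_add]
    field_simp
    ring
  rw [h2, norm_mul, norm_inv, Complex.norm_real, Real.norm_of_nonneg hpos.le]
  have h3 := norm_integral_le_of_norm_le ((integrable_pow_mul_gauss_sq (d := d) n).const_mul
    (K * Real.exp (‖imV z‖ ^ 2))) (Eventually.of_forall hb)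
  rw [integral_const_mul] at h3
  refine (mul_le_mul_of_nonneg_left h3 (by positivity)).trans_eq (by ring)

/-- The growth function is comparable, on every tube, to the real part of an entire function. -/
theorem ProdSeq.exists_entire {x : ℕ → ℝ} (h : ProdSeq x) (l d : ℕ) :
    ∃ g : (Fin d → ℂ) → ℂ, Differentiable ℂ g ∧ ∀ b, ∃ C : ℝ, ∀ z ∈ tube d b,
      ‖g z - growth x l ‖reV z‖‖ ≤ growth x l ‖reV z‖ / 2 + C := by
  have hcont : Continuous fun t : Rd d => growth x l ‖t‖ :=
    (h.continuous_growth l).comp continuous_norm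
  refine ⟨mollify fun t : Rd d => growth x l ‖t‖, differentiable_mollify hcont
    (n := 2 * l) (K := growth x l 0) fun t => ?_, fun b => ?_⟩
  · rw [abs_of_nonneg (h.growth_nonneg l _), mul_comm]
    simpa using h.growth_le_mul l le_rfl (norm_nonneg t)
  · set J := (gaussMass d)⁻¹ * ∫ s : Rd d, (1 + ‖s‖) ^ (2 * l + 1) * Real.exp (-‖s‖ ^ 2) with hJ
    have hJ0 : 0 ≤ J := mul_nonneg (inv_nonneg.2 gaussMass_pos.le)
      (integral_nonneg fun s => by positivity)
    set K := 2 * l * (Real.exp (b ^ 2) * J) with hKdef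
    have hK0 : 0 ≤ K := by positivity
    refine ⟨K * growth x l (2 * K), fun z hz => ?_⟩
    have hL := h.growth_nonneg l ‖reV z‖
    have h1 := norm_mollify_sub_le (z := z) (n := 2 * l + 1)
      (K := 2 * l * growth x l ‖reV z‖ / (1 + ‖reV z‖)) hcont fun s => by
        refine (h.abs_growth_sub_le l (norm_nonneg _) (norm_nonneg _)).trans ?_
        have : |‖reV z + s‖ - ‖reV z‖| ≤ ‖s‖ := by
          simpa using abs_norm_sub_norm_le (reV z + s) (reV z)
        gcongr
    have hz' : ‖imV z‖ ≤ b := le_of_lt hz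
    have h2 : ‖mollify (fun t : Rd d => growth x l ‖t‖) z - growth x l ‖reV z‖‖ ≤
        K * (growth x l ‖reV z‖ / (1 + ‖reV z‖)) := by
      refine h1.trans ?_
      calc _ ≤ 2 * l * growth x l ‖reV z‖ / (1 + ‖reV z‖) * (Real.exp (b ^ 2) * J) := by
            gcongr
        _ = _ := by rw [hKdef]; ring
    refine h2.trans ?_
    have hLK := h.growth_nonneg l (2 * K)
    rcases le_total (2 * K) ‖reV z‖ with hc | hc
    · have : K * (growth x l ‖reV z‖ / (1 + ‖reV z‖)) ≤ growth x l ‖reV z‖ / 2 := by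
        rw [mul_div_assoc', div_le_div_iff₀ (by positivity) two_pos]
        nlinarith
      have := mul_nonneg hK0 hLK
      linarith
    · have h3 := h.growth_mono l (norm_nonneg _) hc
      have h4 : growth x l ‖reV z‖ / (1 + ‖reV z‖) ≤ growth x l (2 * K) :=
        (div_le_self hL (by linarith [norm_nonneg (reV z)])).trans h3
      have := mul_le_mul_of_nonneg_left h4 hK0
      linarith

end Mollifier

section ParametrixSymbols

variable {d : ℕ}

lemma lapSym_eq (R : ℝ) (z : Fin d → ℂ) : lapSym R z =
    ((R + 4 * Real.pi ^ 2 * (‖reV z‖ ^ 2 - ‖imV z‖ ^ 2) : ℝ) : ℂ) +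
      ((8 * Real.pi ^ 2 * inner ℝ (imV z) (reV z) : ℝ) : ℂ) * Complex.I := by
  have h1 : ∀ j, (2 * Real.pi * Complex.I * z j) ^ 2 = -(4 * Real.pi ^ 2) * z j ^ 2 := by
    intro j
    rw [mul_pow, mul_pow, Complex.I_sq]; ring
  simp only [lapSym, h1]
  rw [← Finset.mul_sum, sum_sq]
  push_cast
  ring

lemma differentiable_lapSym (R : ℝ) : Differentiable ℂ (lapSym R : (Fin d → ℂ) → ℂ) := by
  unfold lapSym; fun_prop

lemma exists_lapSym_pow_ge (d l : ℕ) {a : ℝ} (ha : 0 < a) : ∃ R : ℝ, 0 < R ∧ ∀ z ∈ tube d a,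
    (1 + ‖reV z‖) ^ (2 * l) / 2 ≤ (lapSym R z ^ l).re := by
  obtain ⟨τ, hτ, hpow⟩ : ∃ τ : ℝ, 0 < τ ∧ ∀ ζ : ℂ, ‖ζ‖ ≤ τ → 1 / 2 ≤ ((1 + ζ) ^ l).re := by
    have hc : ContinuousAt (fun ζ : ℂ => ((1 + ζ) ^ l).re) 0 := by fun_prop
    have h1 : ∀ᶠ ζ : ℂ in nhds 0, 1 / 2 < ((1 + ζ) ^ l).re :=
      hc.eventually_const_lt (by norm_num)
    obtain ⟨ε, hε, hb⟩ := Metric.eventually_nhds_iff.1 h1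
    refine ⟨ε / 2, by positivity, fun ζ hζ => (hb ?_).le⟩
    rw [dist_zero_right]; linarith
  have hpi := Real.pi_pos
  refine ⟨2 + 4 * Real.pi ^ 2 * a ^ 2 + 4 * Real.pi ^ 2 * (a / τ) ^ 2, by positivity,
    fun z hz => ?_⟩
  set r := ‖reV z‖ with hr
  have hr0 : 0 ≤ r := norm_nonneg _
  have hz' : ‖imV z‖ ≤ a := le_of_lt hz
  set q : ℝ := inner ℝ (imV z) (reV z) with hq
  have hq' : |q| ≤ a * r :=
    (abs_real_inner_le_norm _ _).trans (mul_le_mul_of_nonneg_right hz' hr0)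
  have hpi2 : 0 < 4 * Real.pi ^ 2 := by positivity
  set ρ : ℝ := 2 + 4 * Real.pi ^ 2 * a ^ 2 + 4 * Real.pi ^ 2 * (a / τ) ^ 2 +
    4 * Real.pi ^ 2 * (r ^ 2 - ‖imV z‖ ^ 2) with hρ
  have him : ‖imV z‖ ^ 2 ≤ a ^ 2 := by gcongr
  have hρ1 : 2 + 4 * Real.pi ^ 2 * (a / τ) ^ 2 + 4 * Real.pi ^ 2 * r ^ 2 ≤ ρ := by
    have := mul_le_mul_of_nonneg_left him hpi2.le
    rw [hρ]; linarith
  have hρ2 : (1 + r) ^ 2 ≤ ρ := by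
    have h1 : 0 ≤ 4 * Real.pi ^ 2 * (a / τ) ^ 2 := by positivity
    have h4 : (10 : ℝ) * r ^ 2 ≤ 4 * Real.pi ^ 2 * r ^ 2 := by
      have : (10 : ℝ) ≤ 4 * Real.pi ^ 2 := by nlinarith [Real.pi_gt_three]
      exact mul_le_mul_of_nonneg_right this (sq_nonneg r)
    nlinarith [sq_nonneg (r - 1)]
  have hρ0 : 0 < ρ := lt_of_lt_of_le (by positivity) hρ2
  have hq2 : |8 * Real.pi ^ 2 * q| ≤ τ * ρ := by
    rw [abs_mul, abs_of_pos (by positivity)]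
    have h1 : 2 * (a * r) ≤ τ * ((a / τ) ^ 2 + r ^ 2) := by
      have h2 : τ * ((a / τ) ^ 2 + r ^ 2) - 2 * (a * r) = τ * (a / τ - r) ^ 2 := by
        field_simp; ring
      have := mul_nonneg hτ.le (sq_nonneg (a / τ - r))
      linarith
    calc 8 * Real.pi ^ 2 * |q| ≤ 4 * Real.pi ^ 2 * (2 * (a * r)) := by nlinarith
      _ ≤ 4 * Real.pi ^ 2 * (τ * ((a / τ) ^ 2 + r ^ 2)) := by gcongr
      _ = τ * (4 * Real.pi ^ 2 * (a / τ) ^ 2 + 4 * Real.pi ^ 2 * r ^ 2) := by ring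
      _ ≤ τ * ρ := by gcongr; linarith
  have hw : lapSym (2 + 4 * Real.pi ^ 2 * a ^ 2 + 4 * Real.pi ^ 2 * (a / τ) ^ 2) z =
      (ρ : ℂ) * (1 + ((8 * Real.pi ^ 2 * q / ρ : ℝ) : ℂ) * Complex.I) := by
    have : (ρ : ℂ) ≠ 0 := by exact_mod_cast hρ0.ne'
    rw [lapSym_eq, ← hr, ← hq, ← hρ, mul_add, mul_one, ← mul_assoc, ← Complex.ofReal_mul,
      mul_div_cancel₀ _ hρ0.ne']
  have h1 := hpow (((8 * Real.pi ^ 2 * q / ρ : ℝ) : ℂ) * Complex.I) (by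
    rw [norm_mul, Complex.norm_I, mul_one, Complex.norm_real, Real.norm_eq_abs, abs_div,
      abs_of_pos hρ0, div_le_iff₀ hρ0]
    exact hq2)
  rw [hw, mul_pow, ← Complex.ofReal_pow, Complex.re_ofReal_mul, pow_mul]
  have h2 : ((1 + r) ^ 2) ^ l ≤ ρ ^ l := by gcongr
  have h3 : 0 < ρ ^ l := by positivity
  nlinarith

/-- The symbol of the infinite order operator. -/
def opSym (R : ℝ) (l : ℕ) (x : ℕ → ℝ) (z : Fin d → ℂ) : ℂ := prodC x (lapSym R z ^ l)

/-- The estimates needed to invert the symbol of the infinite order operator on a tube. -/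
structure SymData (d : ℕ) (m : ℕ → ℝ) (a R : ℝ) (l : ℕ) (c : ℝ) (x : ℕ → ℝ) : Prop where
  reg : RegSeq m
  a_pos : 0 < a
  one_le_c : 1 ≤ c
  prodSeq : ProdSeq x
  lapSym_ge : ∀ z ∈ tube d a, (1 + ‖reV z‖) ^ (2 * l) / 2 ≤ (lapSym R z ^ l).re
  pow_le : ∀ (k : ℕ) (t : ℝ), 0 ≤ t →
    (1 + t) ^ k ≤ c ^ k * seqM m k * Real.exp (growth x l t / 12)

lemma RegSeq.symData {m : ℕ → ℝ} (h : RegSeq m) {a R c : ℝ} {l : ℕ} (ha : 0 < a) (hl : 6 ≤ l)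
    (hc : 1 ≤ c) (hx : ProdSeq (coefX m c l))
    (hR : ∀ z ∈ tube d a, (1 + ‖reV z‖) ^ (2 * l) / 2 ≤ (lapSym R z ^ l).re) :
    SymData d m a R l c (coefX m c l) := by
  refine ⟨h, ha, hc, hx, hR, fun k t ht => ?_⟩
  have h1 := h.pow_le_prodR (one_pos.trans_le hc) hx (a := 1 + t) k
  have hk := h.pos k
  have hg := hx.growth_nonneg l t
  have h2 : prodR (coefX m c l) ((1 + t) ^ (2 * l)) ≤
      Real.exp (growth (coefX m c l) l t / 12) ^ (2 * l) := by
    rw [← hx.exp_growth, ← Real.exp_nat_mul]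
    refine Real.exp_le_exp.2 ?_
    have : (12 : ℝ) ≤ (2 * l : ℕ) := by exact_mod_cast (by omega : 12 ≤ 2 * l)
    nlinarith
  refine le_of_pow_le_pow_left₀ (n := 2 * l) (by omega) (by positivity) ?_
  rw [mul_pow _ (Real.exp _)]
  exact h1.trans (by gcongr)

namespace SymData

variable {m x : ℕ → ℝ} {a R c : ℝ} {l : ℕ}

lemma re_nonneg (h : SymData d m a R l c x) {z : Fin d → ℂ} (hz : z ∈ tube d a) :
    0 ≤ (lapSym R z ^ l).re :=
  le_trans (by positivity) (h.lapSym_ge z hz)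

lemma exp_growth_le (h : SymData d m a R l c x) {z : Fin d → ℂ} (hz : z ∈ tube d a) :
    Real.exp (growth x l ‖reV z‖ / 2) ≤ ‖opSym R l x z‖ := by
  have h1 := h.prodSeq.prodR_le_norm_sq (t := (1 + ‖reV z‖) ^ (2 * l)) (by positivity)
    (h.lapSym_ge z hz)
  rw [← h.prodSeq.exp_growth] at h1
  refine le_of_pow_le_pow_left₀ two_ne_zero (norm_nonneg _) ?_
  rw [← Real.exp_nat_mul]
  refine le_trans (le_of_eq ?_) h1
  congr 1
  push_cast
  ring

lemma opSym_ne_zero (h : SymData d m a R l c x) {z : Fin d → ℂ} (hz : z ∈ tube d a) :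
    opSym R l x z ≠ 0 :=
  norm_pos_iff.1 ((Real.exp_pos _).trans_le (h.exp_growth_le hz))

lemma differentiable_opSym (h : SymData d m a R l c x) :
    Differentiable ℂ (opSym R l x : (Fin d → ℂ) → ℂ) :=
  h.prodSeq.differentiable_prodC.comp ((differentiable_lapSym R).pow l)

lemma norm_inv_opSym_le (h : SymData d m a R l c x) {z : Fin d → ℂ} (hz : z ∈ tube d a) :
    ‖(opSym R l x z)⁻¹‖ ≤ Real.exp (-(growth x l ‖reV z‖ / 2)) := by
  rw [norm_inv, Real.exp_neg]
  exact inv_anti₀ (Real.exp_pos _) (h.exp_growth_le hz)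

lemma symb_of_le (h : SymData d m a R l c x) {b K : ℝ} {F : (Fin d → ℂ) → ℂ}
    (hF : DifferentiableOn ℂ F (tube d b))
    (hb : ∀ z ∈ tube d b, ‖F z‖ ≤ K * Real.exp (-(growth x l ‖reV z‖ / 12))) : Symb b F := by
  refine ⟨hF, fun r => ⟨K * (c ^ r * seqM m r), fun z hz => ?_⟩⟩
  have h1 := h.pow_le r ‖reV z‖ (norm_nonneg _)
  have hK : 0 ≤ K := nonneg_of_mul_nonneg_left ((norm_nonneg _).trans (hb z hz)) (Real.exp_pos _)
  calc ‖F z‖ * (1 + ‖reV z‖) ^ r ≤ (K * Real.exp (-(growth x l ‖reV z‖ / 12))) *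
        (c ^ r * seqM m r * Real.exp (growth x l ‖reV z‖ / 12)) := by
        gcongr; exact hb z hz
    _ = K * (c ^ r * seqM m r) * (Real.exp (-(growth x l ‖reV z‖ / 12)) *
        Real.exp (growth x l ‖reV z‖ / 12)) := by ring
    _ = _ := by rw [← Real.exp_add]; simp

lemma symb_inv (h : SymData d m a R l c x) : Symb a fun z : Fin d → ℂ => (opSym R l x z)⁻¹ := by
  refine h.symb_of_le (K := 1) (h.differentiable_opSym.differentiableOn.inv
    fun z hz => h.opSym_ne_zero hz) fun z hz => ?_
  refine (h.norm_inv_opSym_le hz).trans ?_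
  rw [one_mul]
  refine Real.exp_le_exp.2 ?_
  linarith [h.prodSeq.growth_nonneg l ‖reV z‖]

lemma norm_mon_le {b : ℝ} {z : Fin d → ℂ} (hz : z ∈ tube d b) (α : Fin d → ℕ) :
    ‖mon α z‖ ≤ (4 * Real.pi) ^ msize α * ((1 + ‖reV z‖) ^ msize α + |b| ^ msize α) := by
  have hpi := Real.pi_pos
  have h0 : 0 ≤ ‖reV z‖ := norm_nonneg _
  have h1 : ‖mon α z‖ ≤ (2 * Real.pi * (‖reV z‖ + |b|)) ^ msize α := by
    rw [mon, norm_prod, msize, ← Finset.prod_pow_eq_pow_sum]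
    refine Finset.prod_le_prod (fun j _ => norm_nonneg _) fun j _ => ?_
    rw [norm_pow]
    have h2 := norm_apply_le_of_mem_tube hz j
    have h3 : ‖z j‖ ≤ ‖reV z‖ + |b| := h2.trans (by linarith [le_abs_self b])
    have h4 : ‖2 * Real.pi * Complex.I * z j‖ = 2 * Real.pi * ‖z j‖ := by
      simp [abs_of_pos hpi]
    rw [h4]
    gcongr
  refine h1.trans ?_
  have h5 : (‖reV z‖ + |b|) ^ msize α ≤
      2 ^ msize α * ((1 + ‖reV z‖) ^ msize α + |b| ^ msize α) := by
    have hb := abs_nonneg b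
    rcases le_total (1 + ‖reV z‖) |b| with hle | hle
    · calc (‖reV z‖ + |b|) ^ msize α ≤ (2 * |b|) ^ msize α := by gcongr; linarith
        _ = 2 ^ msize α * |b| ^ msize α := mul_pow _ _ _
        _ ≤ _ := by gcongr; exact le_add_of_nonneg_left (by positivity)
    · calc (‖reV z‖ + |b|) ^ msize α ≤ (2 * (1 + ‖reV z‖)) ^ msize α := by gcongr; linarith
        _ = 2 ^ msize α * (1 + ‖reV z‖) ^ msize α := mul_pow _ _ _
        _ ≤ _ := by gcongr; exact le_add_of_nonneg_right (by positivity)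
  calc (2 * Real.pi * (‖reV z‖ + |b|)) ^ msize α
      = (2 * Real.pi) ^ msize α * (‖reV z‖ + |b|) ^ msize α := mul_pow _ _ _
    _ ≤ (2 * Real.pi) ^ msize α * (2 ^ msize α * ((1 + ‖reV z‖) ^ msize α + |b| ^ msize α)) := by
        gcongr
    _ = _ := by rw [← mul_assoc, ← mul_pow]; ring_nf

/-- Entire symbols decaying on every tube have inverse Fourier transforms in `𝒦^{{M}}`. -/
theorem kRou_kern (h : SymData d m a R l c x) {F : (Fin d → ℂ) → ℂ} (hF : Differentiable ℂ F)
    (hb : ∀ b, ∃ K, ∀ z ∈ tube d b, ‖F z‖ ≤ K * Real.exp (-(growth x l ‖reV z‖ / 12))) :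
    KRou d (seqM m) (kern F) := by
  have hS : ∀ b, Symb b F := fun b => (hb b).elim fun K hK => h.symb_of_le hF.differentiableOn hK
  refine ⟨((hS 1).kern_smooth one_pos).1, ?_⟩
  obtain ⟨C₀, H, hC₀, hH, hM⟩ := h.reg.m2
  have hc : 1 ≤ c := h.one_le_c
  have hpi := Real.pi_pos
  refine ⟨(4 * Real.pi * (c * H))⁻¹, by positivity, fun n => ?_⟩
  obtain ⟨K, hK⟩ := hb ((n : ℝ) + 1)
  have hK0 : 0 ≤ K := by
    have := (norm_nonneg _).trans (hK _ (cvec_mem_tube (by positivity) 0))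
    exact nonneg_of_mul_nonneg_left this (Real.exp_pos _)
  obtain ⟨B, hB, hBp⟩ := h.reg.exists_pow_le ((n : ℝ) + 1)
  set I := ∫ ξ : Rd d, ((1 + ‖ξ‖) ^ (d + 1))⁻¹ with hI
  have hI0 : 0 ≤ I := integral_nonneg fun ξ => by positivity
  set E := c ^ (d + 1) * seqM m (d + 1) with hE
  have hE0 : 0 ≤ E := by have := h.reg.pos (d + 1); positivity
  refine ⟨K * E * (C₀ * H ^ (d + 1) + B) * I, fun α y => ?_⟩
  set p := msize α with hp
  have hMp := h.reg.pos p
  have hcp : 1 ≤ (c * H) ^ p := one_le_pow₀ (one_le_mul_of_one_le_of_one_le hc hH)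
  have hbound : SymBound ((n : ℝ) + 1)
      ((4 * Real.pi * (c * H)) ^ p * (K * E * (C₀ * H ^ (d + 1) + B)) * seqM m p)
      (fun z => mon α z * F z) := by
    refine ⟨((hS _).mon_mul α).diff, fun z hz => ?_⟩
    set r := ‖reV z‖ with hr
    set e := Real.exp (-(growth x l r / 12)) with he
    have hr0 : 0 ≤ r := norm_nonneg _
    have hee : Real.exp (growth x l r / 12) * e = 1 := by rw [he, ← Real.exp_add]; simp
    have he0 : 0 < e := Real.exp_pos _
    have hpow : ∀ k, (1 + r) ^ k * e ≤ c ^ k * seqM m k := fun k => by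
      calc (1 + r) ^ k * e ≤ c ^ k * seqM m k * Real.exp (growth x l r / 12) * e := by
            gcongr; exact h.pow_le k r hr0
        _ = _ := by rw [mul_assoc, hee, mul_one]
    have h1 : (1 + r) ^ (p + (d + 1)) * e ≤ (c * H) ^ p * seqM m p * (E * (C₀ * H ^ (d + 1))) := by
      refine (hpow _).trans ?_
      calc c ^ (p + (d + 1)) * seqM m (p + (d + 1))
          ≤ c ^ (p + (d + 1)) * (C₀ * H ^ (p + (d + 1)) * seqM m p * seqM m (d + 1)) := by
            gcongr; exact hM p (d + 1)
        _ = _ := by rw [hE]; ring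
    have h2 : |(n : ℝ) + 1| ^ p * ((1 + r) ^ (d + 1) * e) ≤ (c * H) ^ p * seqM m p * (E * B) := by
      calc |(n : ℝ) + 1| ^ p * ((1 + r) ^ (d + 1) * e) ≤ (B * seqM m p) * E := by
            gcongr
            · exact hBp p
            · exact hpow _
        _ = 1 * (seqM m p * (E * B)) := by ring
        _ ≤ (c * H) ^ p * (seqM m p * (E * B)) := by gcongr
        _ = _ := by ring
    rw [norm_mul]
    calc ‖mon α z‖ * ‖F z‖ * (1 + r) ^ (d + 1)
        ≤ ((4 * Real.pi) ^ p * ((1 + r) ^ p + |(n : ℝ) + 1| ^ p)) * (K * e) *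
            (1 + r) ^ (d + 1) := by
          gcongr
          · exact norm_mon_le hz α
          · exact hK z hz
      _ = (4 * Real.pi) ^ p * K * ((1 + r) ^ (p + (d + 1)) * e +
            |(n : ℝ) + 1| ^ p * ((1 + r) ^ (d + 1) * e)) := by ring
      _ ≤ (4 * Real.pi) ^ p * K * ((c * H) ^ p * seqM m p * (E * (C₀ * H ^ (d + 1))) +
            (c * H) ^ p * seqM m p * (E * B)) := by gcongr
      _ = _ := by rw [mul_pow (4 * Real.pi)]; ring
  have h3 := hbound.norm_kern_le (s := n) (by positivity) (by linarith) y
  rw [(hS 1).pD_kern one_pos]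
  have hA : 0 < (4 * Real.pi * (c * H)) ^ p := by positivity
  have hexp : Real.exp (-(n * ‖y‖)) * Real.exp (n * ‖y‖) = 1 := by rw [← Real.exp_add]; simp
  rw [inv_pow]
  calc _ ≤ ((4 * Real.pi * (c * H)) ^ p)⁻¹ * (((4 * Real.pi * (c * H)) ^ p *
        (K * E * (C₀ * H ^ (d + 1) + B)) * seqM m p) * I * Real.exp (-(n * ‖y‖))) *
        Real.exp (n * ‖y‖) := by gcongr
    _ = (((4 * Real.pi * (c * H)) ^ p)⁻¹ * (4 * Real.pi * (c * H)) ^ p) *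
        (Real.exp (-(n * ‖y‖)) * Real.exp (n * ‖y‖)) *
        (K * E * (C₀ * H ^ (d + 1) + B) * I * seqM m p) := by ring
    _ = _ := by rw [inv_mul_cancel₀ hA.ne', hexp]; ring

/-- The fundamental solution of the infinite order operator factorizes. -/
theorem exists_factorization (h : SymData d m a R l c x) {s : ℝ} (hs : 0 ≤ s) (hsa : s < a) :
    ∃ ψ f : Rd d → ℂ, KRou d (seqM m) ψ ∧ ψ ∈ ExpKernel d s ∧ f ∈ ExpKernel d s ∧
      convF ψ f = kern fun z => (opSym R l x z)⁻¹ := by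
  obtain ⟨g, hg, hgb⟩ := h.prodSeq.exists_entire l d
  have hre : ∀ b, ∃ C, ∀ z ∈ tube d b, growth x l ‖reV z‖ / 2 - C ≤ (g z).re ∧
      (g z).re ≤ 3 / 2 * growth x l ‖reV z‖ + C := by
    intro b
    obtain ⟨C, hC⟩ := hgb b
    refine ⟨C, fun z hz => ?_⟩
    have h1 := (Complex.abs_re_le_norm _).trans (hC z hz)
    rw [Complex.sub_re, Complex.ofReal_re, abs_le] at h1
    constructor <;> linarith [h1.1, h1.2]
  have hψ : ∀ b, ∃ K, ∀ z ∈ tube d b,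
      ‖Complex.exp (-(g z / 6))‖ ≤ K * Real.exp (-(growth x l ‖reV z‖ / 12)) := by
    intro b
    obtain ⟨C, hC⟩ := hre b
    refine ⟨Real.exp (C / 6), fun z hz => ?_⟩
    rw [Complex.norm_exp, ← Real.exp_add]
    refine Real.exp_le_exp.2 ?_
    have : (-(g z / 6)).re = -((g z).re / 6) := by simp
    rw [this]
    linarith [(hC z hz).1]
  have hψd : Differentiable ℂ fun z => Complex.exp (-(g z / 6)) := by fun_prop
  have hψS : Symb a fun z => Complex.exp (-(g z / 6)) :=
    (hψ a).elim fun K hK => h.symb_of_le hψd.differentiableOn hK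
  have hfS : Symb a fun z => Complex.exp (g z / 6) * (opSym R l x z)⁻¹ := by
    obtain ⟨C, hC⟩ := hre a
    refine h.symb_of_le (K := Real.exp (C / 6)) (DifferentiableOn.mul
      (Differentiable.differentiableOn (by fun_prop)) h.symb_inv.diff) fun z hz => ?_
    rw [norm_mul, Complex.norm_exp, ← Real.exp_add]
    refine (mul_le_mul_of_nonneg_left (h.norm_inv_opSym_le hz) (Real.exp_pos _).le).trans ?_
    rw [← Real.exp_add]
    refine Real.exp_le_exp.2 ?_
    have : (g z / 6).re = (g z).re / 6 := by simp
    rw [this]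
    linarith [(hC z hz).2, h.prodSeq.growth_nonneg l ‖reV z‖]
  have hprod : ∀ z, Complex.exp (-(g z / 6)) * (Complex.exp (g z / 6) * (opSym R l x z)⁻¹) =
      (opSym R l x z)⁻¹ := by
    intro z
    rw [← mul_assoc, ← Complex.exp_add]; simp
  refine ⟨_, _, h.kRou_kern hψd hψ, hψS.kern_mem hs hsa, hfS.kern_mem hs hsa, ?_⟩
  rw [convF_kern h.a_pos hψS hfS (by simpa only [hprod] using h.symb_inv)]
  simp only [hprod]

end SymData

end ParametrixSymbols

section Inversion

variable {d : ℕ} {a κ : ℝ}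

lemma tendsto_convF (hκ : 0 ≤ κ) (ha : κ < a) {C D : ℝ} (hC : 0 ≤ C) {k u : ℕ → Rd d → ℂ}
    {k₀ u₀ : Rd d → ℂ} (hk : ∀ n, AEStronglyMeasurable (k n))
    (hkC : ∀ n x, ‖k n x‖ ≤ C * Real.exp (-(a * ‖x‖))) (hu : ∀ n, Continuous (u n))
    (huD : ∀ n x, ‖u n x‖ ≤ D * Real.exp (κ * ‖x‖))
    (hk₀ : ∀ x, Tendsto (fun n => k n x) atTop (nhds (k₀ x)))
    (hu₀ : ∀ x, Tendsto (fun n => u n x) atTop (nhds (u₀ x))) (x : Rd d) :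
    Tendsto (fun n => convF (k n) (u n) x) atTop (nhds (convF k₀ u₀ x)) := by
  refine tendsto_integral_of_dominated_convergence
    (fun t => C * D * Real.exp (κ * ‖x‖) * Real.exp (-((a - κ) * ‖t‖))) (fun n => ?_)
    ((integrable_exp_neg_norm (sub_pos.2 ha)).const_mul _)
    (fun n => Eventually.of_forall fun t => conv_bound hκ hC (hkC n) (huD n) x t)
    (Eventually.of_forall fun t => (hk₀ t).mul (hu₀ (x - t)))
  exact aestronglyMeasurable_conv ⟨hk n, C, hC, hkC n⟩ (hu n) x

lemma tendsto_kern (ha : 0 < a) {C : ℝ} {F : ℕ → (Fin d → ℂ) → ℂ} {F₀ : (Fin d → ℂ) → ℂ}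
    (hF : ∀ n, SymBound a C (F n))
    (hF₀ : ∀ ξ : Rd d, Tendsto (fun n => F n (cvec ξ)) atTop (nhds (F₀ (cvec ξ)))) (x : Rd d) :
    Tendsto (fun n => kern (F n) x) atTop (nhds (kern F₀ x)) := by
  refine tendsto_integral_of_dominated_convergence
    (fun ξ : Rd d => C * ((1 + ‖ξ‖) ^ (d + 1))⁻¹) (fun n => ?_)
    ((integrable_one_add_norm_pow d).const_mul C) (fun n => Eventually.of_forall fun ξ => ?_)
    (Eventually.of_forall fun ξ => (hF₀ ξ).mul_const _)
  · refine ((hF n).integrable ha).aestronglyMeasurable.mul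
      (Continuous.aestronglyMeasurable ?_)
    have := continuous_cvec (d := d)
    unfold dotC
    fun_prop
  · rw [norm_mul, Symb.norm_cexp_dotC_cvec, mul_one]
    simpa using (hF n).norm_le (cvec_mem_tube ha ξ)

lemma kern_sum (ha : 0 < a) {ι : Type*} (s : Finset ι) {F : ι → (Fin d → ℂ) → ℂ} (c : ι → ℂ)
    (hF : ∀ k, Symb a (F k)) :
    kern (fun z => ∑ k ∈ s, c k * F k z) = fun x => ∑ k ∈ s, c k * kern (F k) x := by
  funext x
  simp only [kern, Finset.sum_mul, mul_assoc (c _)]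
  rw [integral_finsetSum]
  · simp only [integral_const_mul]
  · intro k _
    exact ((hF k).integrable_mul_cexp ha x).const_mul (c k)

lemma norm_gaussC_smul_le {τ : ℝ} (hτ : 0 ≤ τ) (hτ1 : τ ≤ 1) {z : Fin d → ℂ}
    (hz : z ∈ tube d a) : ‖gaussC ((τ : ℂ) • z)‖ ≤
      Real.exp (a ^ 2) * Real.exp (-(τ * ‖reV z‖) ^ 2) := by
  have h1 : reV ((τ : ℂ) • z) = τ • reV z := by ext j; simp [reV]
  have h2 : imV ((τ : ℂ) • z) = τ • imV z := by ext j; simp [imV]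
  rw [norm_gaussC, h1, h2, norm_smul, norm_smul, Real.norm_of_nonneg hτ, ← Real.exp_add]
  refine Real.exp_le_exp.2 ?_
  have h3 : τ * ‖imV z‖ ≤ 1 * a := mul_le_mul hτ1 (le_of_lt hz) (norm_nonneg _) zero_le_one
  have h4 : (τ * ‖imV z‖) ^ 2 ≤ a ^ 2 := by
    rw [one_mul] at h3
    exact pow_le_pow_left₀ (by positivity) h3 2
  linarith

lemma differentiable_gaussC_smul (τ : ℂ) :
    Differentiable ℂ fun z : Fin d → ℂ => gaussC (τ • z) := by
  unfold gaussC; simp only [Pi.smul_apply]; fun_prop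

lemma symb_gaussC_smul {τ : ℝ} (hτ : 0 < τ) (hτ1 : τ ≤ 1) :
    Symb a fun z : Fin d → ℂ => gaussC ((τ : ℂ) • z) := by
  refine ⟨(differentiable_gaussC_smul _).differentiableOn, fun r => ?_⟩
  obtain ⟨C, hC, hb⟩ := exists_pow_mul_gauss_le r
  refine ⟨Real.exp (a ^ 2) * ((τ⁻¹) ^ r * C), fun z hz => ?_⟩
  have ht : 0 ≤ τ * ‖reV z‖ := by positivity
  have h1 : 1 + ‖reV z‖ ≤ τ⁻¹ * (1 + τ * ‖reV z‖) := by
    rw [mul_add, ← mul_assoc, inv_mul_cancel₀ hτ.ne']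
    have := (one_le_inv₀ hτ).2 hτ1
    linarith
  have h2 : (1 + τ * ‖reV z‖) ^ r * Real.exp (-(τ * ‖reV z‖) ^ 2) ≤ C := by
    refine le_trans (by gcongr; nlinarith [sq_nonneg (τ * ‖reV z‖)])
      ((hb _ ht).trans (mul_le_of_le_one_right hC (Real.exp_le_one_iff.2 (by linarith))))
  calc ‖gaussC ((τ : ℂ) • z)‖ * (1 + ‖reV z‖) ^ r ≤
        (Real.exp (a ^ 2) * Real.exp (-(τ * ‖reV z‖) ^ 2)) *
          (τ⁻¹ * (1 + τ * ‖reV z‖)) ^ r := by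
        gcongr
        exact norm_gaussC_smul_le hτ.le hτ1 hz
    _ = Real.exp (a ^ 2) * ((τ⁻¹) ^ r *
          ((1 + τ * ‖reV z‖) ^ r * Real.exp (-(τ * ‖reV z‖) ^ 2))) := by
        rw [mul_pow τ⁻¹]; ring
    _ ≤ _ := by gcongr

lemma kern_gaussC_smul {τ : ℝ} (hτ : 0 < τ) (x : Rd d) :
    kern (fun z => gaussC ((τ : ℂ) • z)) x = |(τ ^ d)⁻¹| • kern gaussC (τ⁻¹ • x) := by
  have h1 := Measure.integral_comp_smul (μ := (volume : Measure (Rd d)))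
    (fun η : Rd d => gaussC (cvec η) *
      Complex.exp (2 * Real.pi * Complex.I * dotC (τ⁻¹ • x) (cvec η))) τ
  rw [finrank_euclideanSpace_fin] at h1
  rw [kern, kern, ← h1]
  congr 1
  funext ξ
  have h2 : cvec (τ • ξ) = (τ : ℂ) • cvec ξ := by ext j; simp [cvec]
  have h3 : dotC (τ⁻¹ • x) ((τ : ℂ) • cvec ξ) = dotC x (cvec ξ) := by
    unfold dotC
    refine Finset.sum_congr rfl fun j _ => ?_
    have : (τ : ℂ) ≠ 0 := by exact_mod_cast hτ.ne'
    simp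
    field_simp
  rw [h2, h3]

lemma convF_kern_gaussC_smul {τ : ℝ} (hτ : 0 < τ) (u : Rd d → ℂ) (x : Rd d) :
    convF (kern fun z => gaussC ((τ : ℂ) • z)) u x =
      ∫ y : Rd d, kern gaussC y * u (x - τ • y) := by
  have h1 := Measure.integral_comp_smul (μ := (volume : Measure (Rd d)))
    (fun t : Rd d => kern gaussC (τ⁻¹ • t) * u (x - t)) τ
  rw [finrank_euclideanSpace_fin] at h1
  simp only [smul_smul, inv_mul_cancel₀ hτ.ne', one_smul] at h1
  rw [h1, convF, ← integral_smul]
  congr 1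
  funext t
  rw [kern_gaussC_smul hτ, smul_mul_assoc]

/-- Gaussian regularizations of a continuous function of exponential growth. -/
lemma tendsto_convF_gaussC (hκ : 0 ≤ κ) {D : ℝ} {u : Rd d → ℂ} (hu : Continuous u)
    (huD : ∀ x, ‖u x‖ ≤ D * Real.exp (κ * ‖x‖)) {τ : ℕ → ℝ} (hτ : ∀ n, 0 < τ n)
    (hτ1 : ∀ n, τ n ≤ 1) (hτ0 : Tendsto τ atTop (nhds 0)) (x : Rd d) :
    Tendsto (fun n => convF (kern fun z => gaussC ((τ n : ℂ) • z)) u x) atTop (nhds (u x)) := by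
  have hG : Symb (κ + 2) (gaussC : (Fin d → ℂ) → ℂ) := by
    simpa using symb_gaussC_smul (d := d) (a := κ + 2) (τ := 1) one_pos le_rfl
  have hG1 : (gaussC : (Fin d → ℂ) → ℂ) 0 = 1 := by simp [gaussC]
  obtain ⟨hm, C, hC, hb⟩ := hG.kern_mem (s := κ + 1) (by linarith) (by linarith)
  have hD : 0 ≤ D := nonneg_of_mul_nonneg_left ((norm_nonneg _).trans (huD 0)) (Real.exp_pos _)
  have hlim : u x = ∫ y : Rd d, kern gaussC y * u x := by
    rw [integral_mul_const, integral_kern (by linarith) hG, hG1, one_mul]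
  rw [hlim]
  simp only [convF_kern_gaussC_smul (hτ _)]
  refine tendsto_integral_of_dominated_convergence
    (fun y => C * D * Real.exp (κ * ‖x‖) * Real.exp (-(1 * ‖y‖))) (fun n => ?_)
    ((integrable_exp_neg_norm one_pos).const_mul _)
    (fun n => Eventually.of_forall fun y => ?_) (Eventually.of_forall fun y => ?_)
  · exact hm.mul (by fun_prop : Continuous fun y => u (x - τ n • y)).aestronglyMeasurable
  · have h1 : ‖x - τ n • y‖ ≤ ‖x‖ + ‖y‖ := by
      refine (norm_sub_le _ _).trans ?_
      rw [norm_smul, Real.norm_of_nonneg (hτ n).le]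
      have := mul_le_of_le_one_left (norm_nonneg y) (hτ1 n)
      linarith
    rw [norm_mul]
    calc ‖kern gaussC y‖ * ‖u (x - τ n • y)‖ ≤ (C * Real.exp (-((κ + 1) * ‖y‖))) *
          (D * Real.exp (κ * (‖x‖ + ‖y‖))) := by
          gcongr
          · exact hb y
          · exact (huD _).trans (by gcongr)
      _ = C * D * (Real.exp (-((κ + 1) * ‖y‖)) * Real.exp (κ * (‖x‖ + ‖y‖))) := by ring
      _ = C * D * (Real.exp (κ * ‖x‖) * Real.exp (-(1 * ‖y‖))) := by
          rw [← Real.exp_add, ← Real.exp_add]; congr 2; ring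
      _ = _ := by ring
  · refine Tendsto.const_mul _ ((hu.tendsto x).comp ?_)
    have : Tendsto (fun n => x - τ n • y) atTop (nhds (x - (0 : ℝ) • y)) :=
      tendsto_const_nhds.sub (hτ0.smul_const y)
    simpa using this

end Inversion

section Parametrix

variable {d l : ℕ} {m x : ℕ → ℝ} {a s R c H D κ : ℝ} {u : Rd d → ℂ}

lemma convF_kern_sum (hκ : 0 ≤ κ) (hκa : κ < a) (hu : u ∈ ExpSmooth d κ) {ι : Type*}
    (t : Finset ι) {F : ι → (Fin d → ℂ) → ℂ} (b : ι → ℂ) (hF : ∀ k, Symb a (F k)) :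
    convF (kern fun z => ∑ k ∈ t, b k * F k z) u =
      fun y => ∑ k ∈ t, b k * convF (kern (F k)) u y := by
  obtain ⟨E, -, hE⟩ := ExpSmooth.bound hu
  funext y
  rw [kern_sum (hκ.trans_lt hκa) t b hF]
  simp only [convF, Finset.sum_mul, mul_assoc (b _)]
  rw [integral_finsetSum]
  · simp only [integral_const_mul]
  · intro k _
    refine Integrable.const_mul ?_ _
    exact integrable_conv hκ (a := (κ + a) / 2) (by linarith)
      ((hF k).kern_mem (by linarith) (by linarith)) hu.1.continuous hE y

lemma convF_kern_infOpTrunc (hκ : 0 ≤ κ) (hκa : κ < a) (hu : u ∈ ExpSmooth d κ)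
    {F : (Fin d → ℂ) → ℂ} (hF : Symb a F) (N : ℕ) :
    convF (kern fun z => (∏ j ∈ Finset.range N, (1 + (x j : ℂ) * lapSym R z ^ l)) * F z) u =
      convF (kern F) (infOpTrunc R l x N u) := by
  have h1 : (fun z => (∏ j ∈ Finset.range N, (1 + (x j : ℂ) * lapSym R z ^ l)) * F z) =
      fun z : Fin d → ℂ => ∑ k ∈ Finset.range (N + 1),
        (esym x N k : ℂ) * (lapSym R z ^ (l * k) * F z) := by
    funext z
    have := prod_one_add_eq_sum_esym (x := x) Complex.ofRealHom N (lapSym R z ^ l)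
    simp only [Complex.ofRealHom_eq_coe] at this
    rw [this, Finset.sum_mul]
    exact Finset.sum_congr rfl fun k _ => by rw [pow_mul]; ring
  rw [h1, convF_kern_sum hκ hκa hu (F := fun k z => lapSym R z ^ (l * k) * F z) _ _
    fun k => (convF_lapSym_pow hF hκ hκa hu (l * k)).1]
  funext y
  simp only [(convF_lapSym_pow hF hκ hκa hu (l * _)).2]
  simp only [convF, infOpTrunc, Finset.mul_sum]
  rw [integral_finsetSum]
  · refine Finset.sum_congr rfl fun k _ => ?_
    rw [← integral_const_mul]
    congr 1
    funext t
    ring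
  · intro k _
    have hk := ExpSmooth.lapOp_iterate_mem hu R (l * k)
    obtain ⟨E, -, hE⟩ := ExpSmooth.bound hk
    have := (integrable_conv hκ (a := (κ + a) / 2) (by linarith)
      (hF.kern_mem (by linarith) (by linarith)) hk.1.continuous hE y).const_mul (esym x N k : ℂ)
    refine this.congr (Eventually.of_forall fun t => ?_)
    simp only
    ring

lemma OpCoef.infOp_mem (hκ : 0 ≤ κ) (h : OpCoef d m s R l H D x) (hu : u ∈ domain d m s κ) :
    infOp R l x u ∈ ExpSmooth d κ := by
  obtain ⟨C, q, hC, hb⟩ := id hu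
  have hs := h.s_pos
  have h1 := h.infOp_smooth hκ hu
  refine ⟨h1.1, fun α => ⟨2 * (C * s ^ msize α * D * H ^ (q + msize α) * seqM m (q + msize α)),
    fun y => ?_⟩⟩
  have h2 := (h.infOp_bounds (fun _ => Real.exp_pos _) (by positivity) (hb.pD α) y).2.1
  rw [h1.2]
  rwa [Real.exp_neg, ← div_eq_mul_inv, div_le_iff₀ (Real.exp_pos _)] at h2

namespace SymData

lemma symb_gaussC_mul_inv (hS : SymData d m a R l c x) {τ : ℝ} (hτ : 0 ≤ τ) (hτ1 : τ ≤ 1) :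
    Symb a fun z : Fin d → ℂ => gaussC ((τ : ℂ) • z) * (opSym R l x z)⁻¹ := by
  refine hS.symb_inv.mul_growth (differentiable_gaussC_smul _).differentiableOn
    (K := Real.exp (a ^ 2)) (n := 0) fun z hz => ?_
  rw [pow_zero]
  refine (norm_gaussC_smul_le hτ hτ1 hz).trans ?_
  gcongr
  exact Real.exp_le_one_iff.2 (by nlinarith [sq_nonneg (τ * ‖reV z‖)])

lemma convF_gaussC_infOp (hS : SymData d m a R l c x) (hκ : 0 ≤ κ) (hκa : κ < a)
    (h : OpCoef d m s R l H D x) (hu : u ∈ OpCoef.domain d m s κ) {τ : ℝ} (hτ : 0 < τ)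
    (hτ1 : τ ≤ 1) :
    convF (kern fun z => gaussC ((τ : ℂ) • z) * (opSym R l x z)⁻¹) (infOp R l x u) =
      convF (kern fun z => gaussC ((τ : ℂ) • z)) u := by
  have ha : 0 < a := hκ.trans_lt hκa
  have huE := OpCoef.domain_subset hu
  have hF := hS.symb_gaussC_mul_inv hτ.le hτ1
  have hθ : Symb a fun z : Fin d → ℂ => gaussC ((τ : ℂ) • z) := symb_gaussC_smul hτ hτ1
  obtain ⟨hkm, B, hB, hk⟩ := hF.kern_mem (s := (κ + a) / 2) (by linarith) (by linarith)
  obtain ⟨K, hK⟩ := hθ.symBound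
  obtain ⟨E, hE0, hE⟩ := ExpSmooth.bound huE
  obtain ⟨C, q, hC, hb⟩ := id hu
  have hH := h.H_pos
  have hD := h.D_pos
  funext y
  have h1 := tendsto_convF (k := fun _ => kern fun z => gaussC ((τ : ℂ) • z) * (opSym R l x z)⁻¹)
    (u := fun N => infOpTrunc R l x N u) (u₀ := infOp R l x u)
    (D := 2 * (C * D * H ^ q * seqM m q)) hκ (by linarith : κ < (κ + a) / 2) hB
    (fun _ => hkm) (fun _ => hk) (fun N => ?_) (fun N t => ?_) (fun _ => tendsto_const_nhds)
    (fun t => (h.infOp_bounds (fun _ => Real.exp_pos _) hC hb t).2.2.2) y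
  rotate_left
  · refine continuous_finsetSum _ fun k _ => continuous_const.mul ?_
    exact (ExpSmooth.lapOp_iterate_mem huE R (l * k)).1.continuous
  · have h2 := (h.infOp_bounds (fun _ => Real.exp_pos _) hC hb t).2.2.1 N
    rwa [Real.exp_neg, ← div_eq_mul_inv, div_le_iff₀ (Real.exp_pos _)] at h2
  refine tendsto_nhds_unique h1 ?_
  simp only [← convF_kern_infOpTrunc hκ hκa huE hF]
  set F : ℕ → (Fin d → ℂ) → ℂ := fun N z =>
    (∏ j ∈ Finset.range N, (1 + (x j : ℂ) * lapSym R z ^ l)) *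
      (gaussC ((τ : ℂ) • z) * (opSym R l x z)⁻¹) with hFdef
  have hdiff : ∀ N, DifferentiableOn ℂ (F N) (tube d a) := fun N => by
    have h2 : Differentiable ℂ fun w : ℂ => ∏ j ∈ Finset.range N, (1 + (x j : ℂ) * w) := by
      fun_prop
    exact (h2.comp ((differentiable_lapSym R).pow l)).differentiableOn.mul hF.diff
  have hle : ∀ N, ∀ z ∈ tube d a, ‖F N z‖ ≤ ‖gaussC ((τ : ℂ) • z)‖ := by
    intro N z hz
    rw [norm_mul, norm_mul, norm_inv]
    have h2 := hS.prodSeq.norm_partial_le (hS.re_nonneg hz) N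
    have h3 : 0 < ‖opSym R l x z‖ := norm_pos_iff.2 (hS.opSym_ne_zero hz)
    calc _ ≤ ‖opSym R l x z‖ * (‖gaussC ((τ : ℂ) • z)‖ * ‖opSym R l x z‖⁻¹) := by
          gcongr; exact h2
      _ = _ := by field_simp
  have hP : ∀ N, SymBound a K (F N) := fun N => ⟨hdiff N, fun z hz =>
    le_trans (by gcongr; exact hle N z hz) (hK.le z hz)⟩
  have hSy : ∀ N, Symb a (F N) := fun N => ⟨hdiff N, fun r => (hθ.decay r).imp fun _ hr z hz =>
    le_trans (by gcongr; exact hle N z hz) (hr z hz)⟩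
  refine tendsto_convF (C := K * ∫ ξ : Rd d, ((1 + ‖ξ‖) ^ (d + 1))⁻¹) hκ
    (by linarith : κ < (κ + a) / 2) ?_ (fun N => ?_) (fun N t => ?_)
    (fun _ => huE.1.continuous) (fun _ => hE) (fun t => ?_) (fun _ => tendsto_const_nhds) y
  · have : 0 ≤ K := le_trans (by positivity) (hK.le _ (cvec_mem_tube ha 0))
    exact mul_nonneg this (integral_nonneg fun ξ => by positivity)
  · exact ((hSy N).kern_mem le_rfl ha).1
  · exact (hP N).norm_kern_le (by linarith) (by linarith) t
  · refine tendsto_kern ha hP (fun ξ => ?_) t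
    have h2 := (hS.prodSeq.tendsto_prodC (lapSym R (cvec ξ) ^ l)).mul_const
      (gaussC ((τ : ℂ) • cvec ξ) * (opSym R l x (cvec ξ))⁻¹)
    convert h2 using 2
    have h3 := hS.opSym_ne_zero (cvec_mem_tube ha ξ)
    change _ = opSym R l x (cvec ξ) * _
    field_simp

/-- Inversion of the infinite order operator. -/
theorem convF_infOp (hS : SymData d m a R l c x) (hκ : 0 ≤ κ) (hκa : κ < a)
    (h : OpCoef d m s R l H D x) (hu : u ∈ OpCoef.domain d m s κ) :
    convF (kern fun z => (opSym R l x z)⁻¹) (infOp R l x u) = u := by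
  have ha : 0 < a := hκ.trans_lt hκa
  have huE := OpCoef.domain_subset hu
  have hPu := h.infOp_mem hκ hu
  obtain ⟨E, -, hE⟩ := ExpSmooth.bound huE
  obtain ⟨E', -, hE'⟩ := ExpSmooth.bound hPu
  obtain ⟨K, hK⟩ := hS.symb_inv.symBound
  funext y
  set τ : ℕ → ℝ := fun n => 1 / ((n : ℝ) + 1) with hτdef
  have hτ : ∀ n, 0 < τ n := fun n => by positivity
  have hτ1 : ∀ n, τ n ≤ 1 := fun n => by
    rw [hτdef, div_le_one (by positivity)]; linarith [n.cast_nonneg (α := ℝ)]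
  have hτ0 : Tendsto τ atTop (nhds 0) := tendsto_one_div_add_atTop_nhds_zero_nat
  have h1 := tendsto_convF_gaussC hκ huE.1.continuous hE hτ hτ1 hτ0 y
  simp only [← hS.convF_gaussC_infOp hκ hκa h hu (hτ _) (hτ1 _)] at h1
  refine tendsto_nhds_unique ?_ h1
  have hK0 : 0 ≤ K := le_trans (by positivity) (hK.le _ (cvec_mem_tube ha 0))
  have hθ : ∀ n, ∀ z ∈ tube d a, ‖gaussC ((τ n : ℂ) • z)‖ ≤ Real.exp (a ^ 2) := fun n z hz =>
    (norm_gaussC_smul_le (hτ n).le (hτ1 n) hz).trans (mul_le_of_le_one_right (Real.exp_pos _).le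
      (Real.exp_le_one_iff.2 (by nlinarith [sq_nonneg (τ n * ‖reV z‖)])))
  have hP : ∀ n, SymBound a (Real.exp (a ^ 2) * K) fun z : Fin d → ℂ =>
      gaussC ((τ n : ℂ) • z) * (opSym R l x z)⁻¹ := fun n =>
    ⟨(hS.symb_gaussC_mul_inv (hτ n).le (hτ1 n)).diff, fun z hz => by
      rw [norm_mul, mul_assoc]
      exact mul_le_mul (hθ n z hz) (hK.le z hz) (by positivity) (Real.exp_pos _).le⟩
  refine tendsto_convF (C := Real.exp (a ^ 2) * K * ∫ ξ : Rd d, ((1 + ‖ξ‖) ^ (d + 1))⁻¹) hκ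
    (by linarith : κ < (κ + a) / 2) ?_ (fun n => ?_) (fun n t => ?_)
    (fun _ => hPu.1.continuous) (fun _ => hE') (fun t => ?_) (fun _ => tendsto_const_nhds) y
  · exact mul_nonneg (by positivity) (integral_nonneg fun ξ => by positivity)
  · exact ((hS.symb_gaussC_mul_inv (hτ n).le (hτ1 n)).kern_mem le_rfl ha).1
  · exact (hP n).norm_kern_le (by linarith) (by linarith) t
  · refine tendsto_kern ha hP (fun ξ => ?_) t
    have h2 : Tendsto (fun n => gaussC ((τ n : ℂ) • cvec ξ)) atTop
        (nhds (gaussC ((0 : ℂ) • cvec ξ))) := by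
      have h3 : Tendsto (fun n => (τ n : ℂ)) atTop (nhds 0) := by
        simpa [Function.comp_def] using (Complex.continuous_ofReal.tendsto 0).comp hτ0
      exact (continuous_gaussC.tendsto _).comp (h3.smul_const _)
    have h3 : gaussC ((0 : ℂ) • cvec ξ) = 1 := by simp [gaussC]
    simpa only [h3, one_mul] using h2.mul_const (opSym R l x (cvec ξ))⁻¹

end SymData

end Parametrix

section Factorization

variable {d : ℕ} {m : ℕ → ℝ} {κ s : ℝ}

/-- Factorization of functions with weighted derivative bounds, with a left factor depending only
on the growth rate of the weights and on the size of the derivatives. -/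
theorem RegSeq.exists_factorization (h : RegSeq m) (d : ℕ) (hκ : 0 ≤ κ) (hs : 0 < s) :
    ∃ ψ : Rd d → ℂ, KRou d (seqM m) ψ ∧ ∃ s' : ℝ, 0 < s' ∧
      ∀ (v w : Rd d → ℝ) (C₁ C₂ : ℝ), (∀ x, 0 < v x) → (∀ x, 0 < w x) →
        (∀ x y, w (x + y) ≤ C₁ * v x * Real.exp (κ * ‖y‖)) →
        ∃ C₃ : ℝ, ∀ φ, DerivBound m s v C₂ 0 φ →
          ∃ χ, DerivBound m s' w C₃ 0 χ ∧ convF ψ χ = φ := by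
  obtain ⟨C₀, H, hM⟩ := h.m2
  have hH : 0 < H := one_pos.trans_le hM.2.1
  obtain ⟨l, hl, hcoef⟩ := h.exists_coef hM 6
  obtain ⟨R, hR, hlap⟩ := exists_lapSym_pow_ge d l (a := κ + 2) (by linarith)
  obtain ⟨c, hc, hx, D, hD, hb⟩ := hcoef (R + d * s ^ 2) (by positivity)
  have hS := h.symData (by linarith : 0 < κ + 2) hl hc hx hlap
  have hO : OpCoef d m s R l H D (coefX m c l) := ⟨h, hs, hR.le, hx, hD, hH, hb⟩
  obtain ⟨ψ, f, hψ, hψk, hf, hψf⟩ := hS.exists_factorization (s := κ + 1) (by linarith)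
    (by linarith)
  obtain ⟨E, hE, hfE⟩ := hf.2
  refine ⟨ψ, hψ, s * H, by positivity, fun v w C₁ C₂ hv hw hvw =>
    ⟨E * C₁ * (2 * |C₂| * D) * ∫ t : Rd d, Real.exp (-((κ + 1 - κ) * ‖t‖)), fun φ hφ => ?_⟩⟩
  have hpos := h.pos
  have hC₁ : 0 ≤ C₁ := by
    have h1 := (hw 0).trans_le (by simpa using hvw 0 0)
    exact (pos_of_mul_pos_left h1 (hv 0).le).le
  have hφ' : DerivBound m s v |C₂| 0 φ := ⟨hφ.1, fun α x => (hφ.2 α x).trans (by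
    have := hpos (msize α + 0)
    gcongr
    exact le_abs_self _)⟩
  have hφd : φ ∈ OpCoef.domain d m s κ := by
    refine ⟨|C₂| * (C₁ / w 0), 0, mul_nonneg (abs_nonneg _) (div_nonneg hC₁ (hw 0).le), hφ.1,
      fun α x => ?_⟩
    have h1 := norm_le_exp_of_weighted hw hv hvw (hφ'.2 α) x
    beta_reduce
    rw [Real.exp_neg, ← div_eq_mul_inv, div_le_iff₀ (Real.exp_pos _)]
    exact h1.trans_eq (by ring)
  have hu := hO.infOp_mem hκ hφd
  have hub := hO.infOp_derivBound hκ hφd hv (abs_nonneg _) hφ'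
  have hχ := convF_smooth hκ (by linarith : κ < κ + 1) hf hu
  refine ⟨convF f (infOp R l (coefX m c l) φ), ⟨hχ.1, fun α x => ?_⟩, ?_⟩
  · rw [hχ.2]
    refine (convF_weighted_bound (by linarith : κ < κ + 1) hw hvw hE hC₁ hfE
      (hub.2 α) x).trans_eq ?_
    ring
  · rw [← convF_assoc hκ (by linarith : κ < κ + 1) hψk hf hu, hψf]
    exact hS.convF_infOp hκ (by linarith) hO hφd

end Factorization

section SlowerSequence

/-- Thresholds for a slowly increasing function. -/
def slowThreshold (K p₀ : ℕ) (G : ℕ → ℕ) : ℕ → ℕ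
  | 0 => 0
  | i + 1 => max (K * slowThreshold K p₀ G i) (max (G (i + 1)) p₀) + 1

/-- A slowly varying, unbounded function that stays below a given rate of growth. -/
lemma exists_slow {K : ℕ} (hK : 1 ≤ K) (p₀ : ℕ) (G : ℕ → ℕ) : ∃ k : ℕ → ℕ, Monotone k ∧
    (∀ p, p ≤ p₀ → k p = 0) ∧ (∀ n, ∃ p, n ≤ k p) ∧ (∀ p, k (K * p) ≤ k p + 1) ∧
    ∀ p, k p ≠ 0 → G (k p) ≤ p := by
  set T := slowThreshold K p₀ G with hT
  have hs : ∀ i, K * T i < T (i + 1) ∧ G (i + 1) < T (i + 1) ∧ p₀ < T (i + 1) := fun i => by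
    rw [hT, slowThreshold]; omega
  have hle : ∀ i, i ≤ T i := fun i => by
    induction i with
    | zero => exact Nat.zero_le _
    | succ i ih =>
      have := (hs i).1
      have := Nat.le_mul_of_pos_left (T i) hK
      omega
  let k : ℕ → ℕ := fun p => Nat.findGreatest (fun i => T i ≤ p) p
  have hk : ∀ p, T (k p) ≤ p := fun p =>
    Nat.findGreatest_spec (P := fun i => T i ≤ p) (Nat.zero_le p) (Nat.zero_le p)
  have hk' : ∀ i p, T i ≤ p → i ≤ k p := fun i p h => Nat.le_findGreatest ((hle i).trans h) h
  have hlt : ∀ p, k p ≠ 0 → G (k p) ≤ p ∧ p₀ < p := fun p hp => by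
    obtain ⟨i, hi⟩ := Nat.exists_eq_succ_of_ne_zero hp
    have h1 := hs i
    have h2 := hk p
    rw [hi] at h2 ⊢
    simp only [Nat.succ_eq_add_one] at h2 ⊢
    omega
  refine ⟨k, fun p q h => hk' _ _ ((hk p).trans h), fun p hp => ?_, fun n => ⟨T n, hk' _ _ le_rfl⟩,
    fun p => ?_, fun p hp => (hlt p hp).1⟩
  · by_contra h
    exact absurd (hlt p h).2 (by omega)
  · rcases Nat.eq_zero_or_eq_succ_pred (k (K * p)) with h | h
    · omega
    · have h1 := hk (K * p)
      rw [h] at h1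
      have h2 : K * T (k (K * p)).pred < K * p := (hs _).1.trans_le h1
      have := hk' _ _ (Nat.lt_of_mul_lt_mul_left h2).le
      omega

variable {m : ℕ → ℝ}

/-- The running maximum of `m / σ`. -/
def runMax (m σ : ℕ → ℝ) (p : ℕ) : ℝ := partialSups (fun j => m j / σ j) p

lemma le_runMax {m σ : ℕ → ℝ} {i p : ℕ} (h : i ≤ p) : m i / σ i ≤ runMax m σ p :=
  le_partialSups_of_le (fun j => m j / σ j) h

lemma runMax_le {m σ : ℕ → ℝ} {p : ℕ} {a : ℝ} (h : ∀ j, j ≤ p → m j / σ j ≤ a) :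
    runMax m σ p ≤ a :=
  partialSups_le _ p a h

lemma runMax_mono (m σ : ℕ → ℝ) : Monotone (runMax m σ) := (partialSups _).monotone

lemma runMax_succ (m σ : ℕ → ℝ) (p : ℕ) :
    runMax m σ (p + 1) = max (runMax m σ p) (m (p + 1) / σ (p + 1)) :=
  partialSups_add_one _ p

lemma seqM_div (m n : ℕ → ℝ) (p : ℕ) : seqM (fun j => m j / n j) p = seqM m p / seqM n p :=
  Finset.prod_div_distrib ..

lemma seqM_mul_le {r : ℕ → ℝ} (hr : Monotone r) (h0 : ∀ j, 0 ≤ r j) (p q : ℕ) :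
    seqM r p * seqM r q ≤ seqM r (p + q) := by
  simp only [seqM, Finset.prod_range_add]
  refine mul_le_mul_of_nonneg_left (Finset.prod_le_prod (fun j _ => h0 j)
    fun j _ => hr (Nat.le_add_left j p)) (Finset.prod_nonneg fun j _ => h0 j)

lemma RegSeq.monotone_div_runMax (h : RegSeq m) {σ : ℕ → ℝ} (hσ : Monotone σ)
    (h0 : ∀ j, 0 < σ j) : Monotone fun p => m p / runMax m σ p := by
  have hpos : ∀ p, 0 < runMax m σ p := fun p =>
    (div_pos (h.quot_pos p) (h0 p)).trans_le (le_runMax le_rfl)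
  refine monotone_nat_of_le_succ fun p => ?_
  rw [div_le_div_iff₀ (hpos p) (hpos _), runMax_succ]
  rcases max_choice (runMax m σ p) (m (p + 1) / σ (p + 1)) with h1 | h1 <;> rw [h1]
  · exact mul_le_mul_of_nonneg_right (h.mono p.le_succ) (hpos p).le
  · have h2 : m p / σ (p + 1) ≤ runMax m σ p :=
      (div_le_div_of_nonneg_left (h.quot_pos p).le (h0 p) (hσ p.le_succ)).trans (le_runMax le_rfl)
    calc m p * (m (p + 1) / σ (p + 1)) = m (p + 1) * (m p / σ (p + 1)) := by ring
      _ ≤ _ := mul_le_mul_of_nonneg_left h2 (h.quot_pos _).le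

lemma RegSeq.regSeq_runMax (h : RegSeq m) {σ : ℕ → ℝ} (hσ : Monotone σ) {K p₀ : ℕ}
    (hσ1 : ∀ p, p ≤ p₀ → σ p = 1) (hd : ∀ p, p₀ ≤ p → 4 * m p ≤ m (K * p))
    (hK : ∀ p, σ (K * p) ≤ 2 * σ p) : RegSeq (runMax m σ) := by
  have h0 : ∀ j, 0 < σ j := fun j => by
    have := hσ (Nat.zero_le j); rw [hσ1 0 (Nat.zero_le _)] at this; linarith
  have hpos : ∀ p, 0 < runMax m σ p := fun p =>
    (div_pos (h.quot_pos p) (h0 p)).trans_le (le_runMax le_rfl)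
  have hr := h.monotone_div_runMax hσ h0
  have hr0 : ∀ j, 0 < m j / runMax m σ j := fun j => div_pos (h.quot_pos j) (hpos j)
  refine ⟨runMax_mono m σ, ?_, ?_, K, p₀, fun p hp => ?_⟩
  · have := le_runMax (m := m) (σ := σ) (le_refl 0)
    rw [hσ1 0 (Nat.zero_le _), div_one] at this
    exact h.one_le.trans this
  · obtain ⟨C₀, H, hC, hH, hM⟩ := h.m2
    refine ⟨C₀, H, hC, hH, fun p q => ?_⟩
    have hM' : ∀ p, 0 < seqM (runMax m σ) p := fun p => Finset.prod_pos fun j _ => hpos j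
    have h1 := seqM_mul_le hr (fun j => (hr0 j).le) p q
    simp only [seqM_div] at h1
    rw [div_mul_div_comm, div_le_div_iff₀ (mul_pos (hM' p) (hM' q)) (hM' _)] at h1
    have h2 : 0 < seqM m p * seqM m q := mul_pos (h.pos p) (h.pos q)
    refine le_of_mul_le_mul_left ?_ h2
    calc _ ≤ seqM m (p + q) * (seqM (runMax m σ) p * seqM (runMax m σ) q) := h1
      _ ≤ C₀ * H ^ (p + q) * seqM m p * seqM m q *
          (seqM (runMax m σ) p * seqM (runMax m σ) q) :=
        mul_le_mul_of_nonneg_right (hM p q) (mul_pos (hM' p) (hM' q)).le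
      _ = _ := by ring
  · have key : ∀ j, p₀ ≤ j → j ≤ p → m j / σ j ≤ runMax m σ (K * p) / 2 := fun j hj hjp => by
      have h1 : m (K * j) / σ (K * j) ≤ runMax m σ (K * p) := le_runMax (Nat.mul_le_mul_left K hjp)
      have h2 : 4 * m j / (2 * σ j) ≤ m (K * j) / σ (K * j) :=
        div_le_div₀ (h.quot_pos _).le (hd j hj) (h0 _) (hK j)
      have h3 : 4 * m j / (2 * σ j) = 2 * (m j / σ j) := by
        have := h0 j
        field_simp
        ring
      linarith
    have h4 : runMax m σ p ≤ runMax m σ (K * p) / 2 := runMax_le fun j hj => by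
      by_cases hjp : p₀ ≤ j
      · exact key j hjp hj
      · refine le_trans ?_ (key p₀ le_rfl hp)
        rw [hσ1 j (by omega), hσ1 p₀ le_rfl, div_one, div_one]
        exact h.mono (by omega)
    linarith

/-- A countable family of bounds of Beurling type is controlled by a single regular sequence which
is still essentially smaller. -/
theorem RegSeq.exists_smaller (h : RegSeq m) (C : ℕ → ℝ) : ∃ n : ℕ → ℝ, RegSeq n ∧
    (∀ t : ℝ, 0 < t → ∃ D : ℝ, 0 ≤ D ∧ ∀ p, t ^ p * seqM n p ≤ D * seqM m p) ∧
    ∃ E : ℝ, ∀ p : ℕ, ∀ X : ℝ, 0 ≤ X →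
      (∀ k : ℕ, (2 * ((k : ℝ) + 1)) ^ p * X ≤ C k * seqM m p) → X ≤ E * seqM n p := by
  obtain ⟨K, p₀, hK, hp₀, hd⟩ := h.exists_dbl
  choose G hG using fun k => pow_unbounded_of_one_lt (C k) (one_lt_two (α := ℝ))
  obtain ⟨k, hk, hk0, hku, hkK, hkG⟩ := exists_slow (Nat.one_le_pow 2 K (by omega)) p₀ G
  let σ : ℕ → ℝ := fun p => k p + 1
  have hσ : Monotone σ := fun p q hpq => by
    have : (k p : ℝ) ≤ k q := by exact_mod_cast hk hpq
    simp only [σ]; linarith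
  have h0 : ∀ j, 0 < σ j := fun j => by positivity
  have hpos : ∀ p, 0 < runMax m σ p := fun p =>
    (div_pos (h.quot_pos p) (h0 p)).trans_le (le_runMax le_rfl)
  have hM' : ∀ p, 0 < seqM (runMax m σ) p := fun p => Finset.prod_pos fun j _ => hpos j
  refine ⟨runMax m σ, h.regSeq_runMax hσ (fun p hp => by simp [σ, hk0 p hp])
    (fun p hp => by simpa [show (2 : ℝ) ^ 2 = 4 by norm_num] using hd 2 p hp) (fun p => ?_),
    fun t ht => ?_, max 1 (C 0), fun p X hX hb => ?_⟩
  · have : (k (K ^ 2 * p) : ℝ) ≤ k p + 1 := by exact_mod_cast hkK p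
    have := (k p).cast_nonneg (α := ℝ)
    simp only [σ]; linarith
  · obtain ⟨n, hn⟩ := exists_nat_gt (2 * t)
    obtain ⟨J, hJ⟩ := hku n
    obtain ⟨P, hP⟩ := eventually_atTop.1 (h.tendsto_quot.eventually_ge_atTop (t * m J))
    have hr : ∀ p, P ≤ p → t * runMax m σ p ≤ m p := fun p hp => by
      rw [← le_div_iff₀' ht]
      refine runMax_le fun j hj => ?_
      rw [div_le_div_iff₀ (h0 j) ht]
      by_cases hjJ : j ≤ J
      · have h1 : (1 : ℝ) ≤ σ j := by simp [σ]
        calc m j * t ≤ m J * t := mul_le_mul_of_nonneg_right (h.mono hjJ) ht.le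
          _ ≤ m p := by rw [mul_comm]; exact hP p hp
          _ ≤ m p * σ j := le_mul_of_one_le_right (h.quot_pos p).le h1
      · have h1 : (n : ℝ) ≤ k j := by exact_mod_cast hJ.trans (hk (by omega))
        exact mul_le_mul (h.mono hj) (by simp only [σ]; linarith) ht.le (h.quot_pos p).le
    refine ⟨∏ j ∈ Finset.range P, max 1 (t * runMax m σ j), by positivity, fun p => ?_⟩
    have h1 : t ^ p * seqM (runMax m σ) p = ∏ j ∈ Finset.range p, t * runMax m σ j := by
      rw [Finset.prod_mul_distrib, Finset.prod_const, Finset.card_range]; rfl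
    rw [h1]
    have h2 : ∀ j, 0 ≤ t * runMax m σ j := fun j => mul_nonneg ht.le (hpos j).le
    rcases le_total p P with hp | hp
    · calc ∏ j ∈ Finset.range p, t * runMax m σ j
          ≤ ∏ j ∈ Finset.range p, max 1 (t * runMax m σ j) :=
            Finset.prod_le_prod (fun j _ => h2 j) fun j _ => le_max_right _ _
        _ ≤ ∏ j ∈ Finset.range P, max 1 (t * runMax m σ j) :=
            Finset.prod_le_prod_of_subset_of_one_le (Finset.range_mono hp)
              (fun j _ => by positivity) fun j _ _ => le_max_left _ _
        _ ≤ _ := le_mul_of_one_le_right (by positivity) (h.one_le_seq p)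
    · obtain ⟨q, rfl⟩ := Nat.exists_eq_add_of_le hp
      rw [Finset.prod_range_add, seqM, Finset.prod_range_add]
      refine mul_le_mul (Finset.prod_le_prod (fun j _ => h2 j) fun j _ => le_max_right _ _) ?_
        (Finset.prod_nonneg fun j _ => h2 _) (by positivity)
      calc ∏ j ∈ Finset.range q, t * runMax m σ (P + j)
          ≤ ∏ j ∈ Finset.range q, m (P + j) :=
            Finset.prod_le_prod (fun j _ => h2 _) fun j _ => hr _ (Nat.le_add_right P j)
        _ ≤ _ := le_mul_of_one_le_left (Finset.prod_nonneg fun j _ => (h.quot_pos _).le)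
            (h.one_le_seq P)
  · have h1 : seqM m p ≤ σ p ^ p * seqM (runMax m σ) p := by
      calc seqM m p ≤ ∏ j ∈ Finset.range p, σ p * runMax m σ j := by
            refine Finset.prod_le_prod (fun j _ => (h.quot_pos j).le) fun j hj => ?_
            rw [Finset.mem_range] at hj
            calc m j = σ j * (m j / σ j) := by rw [mul_div_cancel₀ _ (h0 j).ne']
              _ ≤ _ := mul_le_mul (hσ hj.le) (le_runMax le_rfl)
                (div_pos (h.quot_pos j) (h0 j)).le (h0 p).le
        _ = _ := by rw [Finset.prod_mul_distrib, Finset.prod_const, Finset.card_range]; rfl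
    have h2 : C (k p) ≤ max 1 (C 0) * 2 ^ p := by
      by_cases hkp : k p = 0
      · rw [hkp]
        exact (le_max_right _ _).trans (le_mul_of_one_le_right (by positivity)
          (one_le_pow₀ one_le_two))
      · calc C (k p) ≤ 2 ^ G (k p) := (hG _).le
          _ ≤ 2 ^ p := pow_le_pow_right₀ one_le_two (hkG p hkp)
          _ ≤ _ := le_mul_of_one_le_left (by positivity) (le_max_left _ _)
    have h3 := hb (k p)
    rw [mul_pow] at h3
    have h4 : (0 : ℝ) < 2 ^ p * σ p ^ p := by have := h0 p; positivity
    refine le_of_mul_le_mul_left ?_ h4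
    calc 2 ^ p * σ p ^ p * X ≤ C (k p) * seqM m p := h3
      _ ≤ (max 1 (C 0) * 2 ^ p) * (σ p ^ p * seqM (runMax m σ) p) :=
        mul_le_mul h2 h1 (h.pos p).le (by positivity)
      _ = _ := by ring

end SlowerSequence

section WeightedSpaces

variable {d : ℕ} {M : ℕ → ℝ}

lemma seqM_quot (hM : IsWeightSeq M) : seqM (fun p => M (p + 1) / M p) = M := by
  funext p
  induction p with
  | zero => rw [seqM_zero, hM.2.1]
  | succ p ih => rw [seqM_succ, ih, mul_div_cancel₀ _ (hM.1 p).ne']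

lemma regSeq_quot (hM : IsWeightSeq M) (hM2 : M2 M) (h2s : M2star M) :
    RegSeq fun p => M (p + 1) / M p := by
  have hmono : Monotone fun p => M (p + 1) / M p := monotone_nat_of_le_succ fun p => by
    rw [div_le_div_iff₀ (hM.1 _) (hM.1 _)]
    have := hM.2.2.2.2 (p + 1) (by omega)
    simp only [Nat.add_sub_cancel] at this
    nlinarith
  obtain ⟨p₀, N, -, hN, hd⟩ := h2s
  refine ⟨hmono, ?_, by rwa [seqM_quot hM], 2 * N, p₀ + 1, fun p hp => ?_⟩
  · simp [hM.2.1, hM.2.2.1]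
  · have h1 := hd (p + 1) (by omega)
    have h2 : N * (p + 1) - 1 + 1 = N * (p + 1) :=
      Nat.sub_add_cancel (Nat.mul_pos hN (Nat.succ_pos p))
    have h3 : N * (p + 1) - 1 ≤ 2 * N * p := by
      have : N * 1 ≤ N * p := Nat.mul_le_mul_left N (by omega)
      have : N * (p + 1) = N * p + N := by ring
      have : 2 * N * p = N * p + N * p := by ring
      omega
    have h4 := hmono h3
    simp only [h2] at h4
    exact h1.trans h4

lemma KBeu.kRou {ψ : Rd d → ℂ} (h : KBeu d M ψ) : KRou d M ψ := ⟨h.1, 1, one_pos, h.2 1 one_pos⟩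

lemma KRou.mem_expKernel {ψ : Rd d → ℂ} (h : KRou d M ψ) (a : ℝ) : ψ ∈ ExpKernel d a := by
  obtain ⟨hs, k, -, hb⟩ := h
  obtain ⟨n, hn⟩ := exists_nat_ge a
  obtain ⟨C, hC⟩ := hb n
  refine ⟨hs.continuous.aestronglyMeasurable, |C * M 0|, abs_nonneg _, fun x => ?_⟩
  have h1 := hC 0 x
  rw [pD_zero, msize_zero, pow_zero, one_mul] at h1
  rw [Real.exp_neg, ← div_eq_mul_inv, le_div_iff₀ (Real.exp_pos _)]
  calc ‖ψ x‖ * Real.exp (a * ‖x‖) ≤ ‖ψ x‖ * Real.exp (n * ‖x‖) := by gcongr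
    _ ≤ C * M 0 := h1
    _ ≤ _ := le_abs_self _

lemma bNorm_convF {κ C₁ h : ℝ} {v w : Rd d → ℝ} (hκ : 0 ≤ κ) (hv : ∀ x, 0 < v x)
    (hw : ∀ x, 0 < w x) (hvw : ∀ x y, w (x + y) ≤ C₁ * v x * Real.exp (κ * ‖y‖)) (hh : 0 < h)
    {ψ χ : Rd d → ℂ} (hψ : ψ ∈ ExpKernel d (κ + 1)) (hχ : ContDiff ℝ (⊤ : ℕ∞) χ)
    (hb : BNorm d M h v χ) : ContDiff ℝ (⊤ : ℕ∞) (convF ψ χ) ∧ BNorm d M h w (convF ψ χ) := by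
  obtain ⟨D, hD⟩ := hb
  have hD' : ∀ α x, ‖pD α χ x‖ * v x ≤ D * M (msize α) / h ^ msize α := fun α x => by
    rw [le_div_iff₀ (by positivity)]
    exact (hD α x).trans_eq' (by ring)
  have hχ' : χ ∈ ExpSmooth d κ := ⟨hχ, fun α => ⟨_, norm_le_exp_of_weighted hw hv hvw (hD' α)⟩⟩
  have hC₁ : 0 ≤ C₁ := by
    have h1 := (hw 0).trans_le (by simpa using hvw 0 0)
    exact (pos_of_mul_pos_left h1 (hv 0).le).le
  have hs := convF_smooth hκ (lt_add_one κ) hψ hχ'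
  obtain ⟨-, E, hE, hψE⟩ := hψ
  refine ⟨hs.1, E * C₁ * D * ∫ t : Rd d, Real.exp (-((κ + 1 - κ) * ‖t‖)), fun α x => ?_⟩
  rw [hs.2]
  have h1 := convF_weighted_bound (lt_add_one κ) hw hvw hE hC₁ hψE (hD' α) x
  calc h ^ msize α * ‖convF ψ (pD α χ) x‖ * w x
      = h ^ msize α * (‖convF ψ (pD α χ) x‖ * w x) := by ring
    _ ≤ h ^ msize α * (E * C₁ * (D * M (msize α) / h ^ msize α) *
        ∫ t : Rd d, Real.exp (-((κ + 1 - κ) * ‖t‖))) := by gcongr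
    _ = _ := by field_simp

variable {v : ℕ → Rd d → ℝ}

lemma BRouVS.convF {ψ χ : Rd d → ℂ} (hv : DecWS d v) (hψ : KRou d M ψ)
    (hχ : BRouVS d M v χ) : BRouVS d M v (convF ψ χ) := by
  obtain ⟨hpos, -, -, -, hb⟩ := hv
  obtain ⟨n, hn, hs, hB⟩ := hχ
  obtain ⟨m, hm, κ, C, hκ, -, hvw⟩ := hb n
  have hn0 : (0 : ℝ) < n := by exact_mod_cast hn
  obtain ⟨h1, D, hD⟩ := bNorm_convF hκ.le (hpos n) (hpos m) hvw (by positivity)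
    (hψ.mem_expKernel _) hs hB
  refine ⟨m, hn.trans hm, h1, D, fun α x => (hD α x).trans' ?_⟩
  have := (hpos m x).le
  gcongr

lemma BBeuVS.convF {ψ χ : Rd d → ℂ} (hv : DecWS d v) (hψ : KBeu d M ψ)
    (hχ : BBeuVS d M v χ) : BBeuVS d M v (convF ψ χ) := by
  obtain ⟨hpos, -, -, -, hb⟩ := hv
  obtain ⟨n, hs, hB⟩ := hχ
  obtain ⟨m, -, κ, C, hκ, -, hvw⟩ := hb n
  have key := fun h hh => bNorm_convF hκ.le (hpos n) (hpos m) hvw hh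
    (hψ.kRou.mem_expKernel _) hs (hB h hh)
  exact ⟨m, (key 1 one_pos).1, fun h hh => (key h hh).2⟩

lemma image_convF_eq {ψ : Rd d → ℂ} {B : Set (Rd d → ℂ)} {P : (Rd d → ℂ) → Prop}
    (h : ∀ φ ∈ B, ∃ χ, P χ ∧ convF ψ χ = φ) :
    (fun χ => convF ψ χ) '' {χ | P χ ∧ convF ψ χ ∈ B} = B := by
  ext φ
  refine ⟨?_, fun hφ => ?_⟩
  · rintro ⟨χ, ⟨-, hχ⟩, rfl⟩
    exact hχ
  · obtain ⟨χ, hχ, rfl⟩ := h φ hφ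
    exact ⟨χ, ⟨hχ, hφ⟩, rfl⟩

theorem BRouVBdd.exists_factorization (hM : IsWeightSeq M) (hM2 : M2 M) (h2s : M2star M)
    (hv : DecWS d v) {B : Set (Rd d → ℂ)} (hB : BRouVBdd d M v B) :
    ∃ ψ, KRou d M ψ ∧ ∃ A, BRouVBdd d M v A ∧ (fun χ => convF ψ χ) '' A = B := by
  obtain ⟨hpos, -, hanti, -, hb⟩ := hv
  obtain ⟨hBs, n, hn, C, hC⟩ := hB
  obtain ⟨m, hm, κ, C₁, hκ, -, hvw⟩ := hb n
  have hn0 : (0 : ℝ) < n := by exact_mod_cast hn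
  obtain ⟨ψ, hψ, s, hs, hf⟩ := (regSeq_quot hM hM2 h2s).exists_factorization d hκ.le hn0
  obtain ⟨C₃, hf⟩ := hf (v n) (v m) C₁ C (hpos n) (hpos m) hvw
  rw [seqM_quot hM] at hψ
  simp only [DerivBound, seqM_quot hM, add_zero] at hf
  obtain ⟨N, hN⟩ := exists_nat_ge s
  have hk : 1 ≤ max m N := le_max_of_le_left (hn.trans hm)
  have hk0 : (0 : ℝ) < (max m N : ℕ) := by exact_mod_cast hk
  have hbd : ∀ χ : Rd d → ℂ,
      (∀ α x, ‖pD α χ x‖ * v m x ≤ C₃ * s ^ msize α * M (msize α)) → ∀ α x,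
      (1 / ((max m N : ℕ) : ℝ)) ^ msize α * ‖pD α χ x‖ * v (max m N) x ≤ C₃ * M (msize α) :=
    fun χ hχ α x => by
      have hsk : s ≤ (max m N : ℕ) := hN.trans (by exact_mod_cast le_max_right m N)
      have := (hpos m x).le
      have := (hpos (max m N) x).le
      calc _ ≤ (1 / s) ^ msize α * ‖pD α χ x‖ * v m x := by
            gcongr
            exact hanti _ _ (le_max_left m N) x
        _ = (1 / s) ^ msize α * (‖pD α χ x‖ * v m x) := by ring
        _ ≤ (1 / s) ^ msize α * (C₃ * s ^ msize α * M (msize α)) :=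
            mul_le_mul_of_nonneg_left (hχ α x) (by positivity)
        _ = _ := by rw [one_div_pow]; field_simp
  refine ⟨ψ, hψ, _, ⟨fun χ hχ => ⟨_, hk, hχ.1.1, C₃, hbd χ hχ.1.2⟩,
    _, hk, C₃, fun χ hχ => hbd χ hχ.1.2⟩, image_convF_eq fun φ hφ => hf φ ⟨?_, fun α x => ?_⟩⟩
  · obtain ⟨_, _, h, _⟩ := hBs φ hφ
    exact h
  · calc ‖pD α φ x‖ * v n x
        = (n : ℝ) ^ msize α * ((1 / (n : ℝ)) ^ msize α * ‖pD α φ x‖ * v n x) := by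
          rw [one_div_pow]; field_simp
      _ ≤ (n : ℝ) ^ msize α * (C * M (msize α)) :=
          mul_le_mul_of_nonneg_left (hC φ hφ α x) (by positivity)
      _ = _ := by ring

theorem BBeuVBdd.exists_factorization (hM : IsWeightSeq M) (hM2 : M2 M) (h2s : M2star M)
    (hv : DecWS d v) {n : ℕ} {B : Set (Rd d → ℂ)} (hB : BBeuVBdd d M (v n) B) :
    ∃ ψ, KBeu d M ψ ∧ ∃ m A, BBeuVBdd d M (v m) A ∧ (fun χ => convF ψ χ) '' A = B := by
  obtain ⟨hpos, -, -, -, hb⟩ := hv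
  obtain ⟨hBs, hC⟩ := hB
  obtain ⟨m, hm, κ, C₁, hκ, -, hvw⟩ := hb n
  choose C hC using fun k : ℕ => hC (2 * ((k : ℝ) + 1)) (by positivity)
  obtain ⟨r, hr, hrM, E, hE⟩ := (regSeq_quot hM hM2 h2s).exists_smaller C
  rw [seqM_quot hM] at hrM hE
  obtain ⟨ψ, ⟨hψs, k, hk, hψ⟩, s, hs, hf⟩ := hr.exists_factorization d hκ.le one_pos
  obtain ⟨C₃, hf⟩ := hf (v n) (v m) C₁ E (hpos n) (hpos m) hvw
  have hψ' : KBeu d M ψ := by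
    refine ⟨hψs, fun t ht N => ?_⟩
    obtain ⟨D, hD⟩ := hψ N
    obtain ⟨D', hD', hrD⟩ := hrM (t / k) (by positivity)
    refine ⟨|D| * D', fun α x => ?_⟩
    have hpr := (hr.pos (msize α)).le
    calc t ^ msize α * ‖pD α ψ x‖ * Real.exp (N * ‖x‖)
        = (t / k) ^ msize α * (k ^ msize α * ‖pD α ψ x‖ * Real.exp (N * ‖x‖)) := by
          rw [div_pow]; field_simp
      _ ≤ (t / k) ^ msize α * (|D| * seqM r (msize α)) :=
          mul_le_mul_of_nonneg_left ((hD α x).trans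
            (mul_le_mul_of_nonneg_right (le_abs_self D) hpr)) (by positivity)
      _ = |D| * ((t / k) ^ msize α * seqM r (msize α)) := by ring
      _ ≤ |D| * (D' * M (msize α)) := mul_le_mul_of_nonneg_left (hrD _) (abs_nonneg _)
      _ = _ := by ring
  have hbd : ∀ t : ℝ, 0 < t → ∃ D : ℝ, ∀ χ, DerivBound r s (v m) C₃ 0 χ → ∀ α x,
      t ^ msize α * ‖pD α χ x‖ * v m x ≤ D * M (msize α) := fun t ht => by
    obtain ⟨D', hD', hrD⟩ := hrM (t * s) (by positivity)
    refine ⟨|C₃| * D', fun χ hχ α x => ?_⟩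
    have hpr := (hr.pos (msize α)).le
    calc t ^ msize α * ‖pD α χ x‖ * v m x = t ^ msize α * (‖pD α χ x‖ * v m x) := by ring
      _ ≤ t ^ msize α * (|C₃| * s ^ msize α * seqM r (msize α)) := by
          refine mul_le_mul_of_nonneg_left ((hχ.2 α x).trans ?_) (by positivity)
          rw [add_zero]
          gcongr
          exact le_abs_self C₃
      _ = |C₃| * ((t * s) ^ msize α * seqM r (msize α)) := by rw [mul_pow]; ring
      _ ≤ |C₃| * (D' * M (msize α)) := mul_le_mul_of_nonneg_left (hrD _) (abs_nonneg _)
      _ = _ := by ring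
  refine ⟨ψ, hψ', m, _, ⟨fun χ hχ => ⟨hχ.1.1, fun t ht => ?_⟩, fun t ht => ?_⟩,
    image_convF_eq fun φ hφ => hf φ ⟨(hBs φ hφ).1, fun α x => ?_⟩⟩
  · obtain ⟨D, hD⟩ := hbd t ht
    exact ⟨D, hD χ hχ.1⟩
  · obtain ⟨D, hD⟩ := hbd t ht
    exact ⟨D, fun χ hχ => hD χ hχ.1⟩
  · rw [one_pow, mul_one, add_zero]
    refine hE _ _ (mul_nonneg (norm_nonneg _) (hpos n x).le) fun k => ?_
    rw [← mul_assoc]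
    exact hC k φ hφ α x

end WeightedSpaces

/-- Strong factorization for weighted spaces `ℬ^{[M]}_𝒱` over a decreasing weight
system (Theorem 7.12(ii)). -/
theorem stmt19 (d : ℕ) (M : ℕ → ℝ) (hM : IsWeightSeq M) (hM2 : M2 M) (h2s : M2star M)
    (v : ℕ → Rd d → ℝ) (hv : DecWS d v) :
    convSet {f | KBeu d M f} {f | BBeuVS d M v f} = {f | BBeuVS d M v f} ∧
    convSet {f | KRou d M f} {f | BRouVS d M v f} = {f | BRouVS d M v f} ∧
    (∀ n : ℕ, ∀ B : Set (Rd d → ℂ), BBeuVBdd d M (v n) B →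
      ∃ ψ : Rd d → ℂ, KBeu d M ψ ∧ ∃ m : ℕ,
        ∃ A : Set (Rd d → ℂ), BBeuVBdd d M (v m) A ∧ (fun χ => convF ψ χ) '' A = B) ∧
    (∀ B : Set (Rd d → ℂ), BRouVBdd d M v B →
      ∃ ψ : Rd d → ℂ, KRou d M ψ ∧
        ∃ A : Set (Rd d → ℂ), BRouVBdd d M v A ∧ (fun χ => convF ψ χ) '' A = B) := by
  have hBeu : ∀ n : ℕ, ∀ B : Set (Rd d → ℂ), BBeuVBdd d M (v n) B →
      ∃ ψ : Rd d → ℂ, KBeu d M ψ ∧ ∃ m : ℕ,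
        ∃ A : Set (Rd d → ℂ), BBeuVBdd d M (v m) A ∧ (fun χ => convF ψ χ) '' A = B :=
    fun n B hB => hB.exists_factorization hM hM2 h2s hv
  have hRou : ∀ B : Set (Rd d → ℂ), BRouVBdd d M v B →
      ∃ ψ : Rd d → ℂ, KRou d M ψ ∧
        ∃ A : Set (Rd d → ℂ), BRouVBdd d M v A ∧ (fun χ => convF ψ χ) '' A = B :=
    fun B hB => hB.exists_factorization hM hM2 h2s hv
  refine ⟨Set.Subset.antisymm ?_ ?_, Set.Subset.antisymm ?_ ?_, hBeu, hRou⟩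
  · rintro _ ⟨ψ, hψ, χ, hχ, rfl⟩
    exact BBeuVS.convF hv hψ hχ
  · rintro φ ⟨n, hs, hb⟩
    obtain ⟨ψ, hψ, m, A, hA, hAB⟩ := hBeu n {φ} ⟨by rintro _ rfl; exact ⟨hs, hb⟩, fun h hh => by
      obtain ⟨C, hC⟩ := hb h hh
      exact ⟨C, by rintro _ rfl; exact hC⟩⟩
    obtain ⟨χ, hχ, hφ⟩ := hAB.ge (Set.mem_singleton φ)
    exact ⟨ψ, hψ, χ, ⟨m, hA.1 χ hχ⟩, hφ.symm⟩
  · rintro _ ⟨ψ, hψ, χ, hχ, rfl⟩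
    exact BRouVS.convF hv hψ hχ
  · rintro φ hφ
    obtain ⟨ψ, hψ, A, hA, hAB⟩ := hRou {φ} ⟨by rintro _ rfl; exact hφ, by
      obtain ⟨n, hn, -, C, hC⟩ := hφ
      exact ⟨n, hn, C, by rintro _ rfl; exact hC⟩⟩
    obtain ⟨χ, hχ, hφχ⟩ := hAB.ge (Set.mem_singleton φ)
    exact ⟨ψ, hψ, χ, hA.1 χ hχ, hφχ.symm⟩
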